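/- Let (a_n)_{n≥1} be a sequence of distinct positive integers. Then for almost all α ∈ [0,1], the inequality δ_min^α(N) ≤ 4·log₂ B̄_N / (D_N · log(N/9) · log₂(N/9)) holds for infinitely many N, where B̄_N = max(a_1, …, a_N). -/

import Mathlib

open MeasureTheory Filter

/-- Distance from a real number to the nearest integer. -/
noncomputable def nint (x : ℝ) : ℝ := |x - round x|

/-- `deltaMin a α N` is the minimal gap
`min { ‖α (a_m − a_n)‖ : 1 ≤ m ≠ n ≤ N }`. -/
noncomputable def deltaMin (a : ℕ → ℝ) (α : ℝ) (N : ℕ) : ℝ :=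
  sInf {d : ℝ | ∃ m n : ℕ, 1 ≤ m ∧ m ≤ N ∧ 1 ≤ n ∧ n ≤ N ∧ m ≠ n ∧
    d = nint (α * (a m - a n))}

/-- `Dcard a N` is the number of distinct positive differences
`#{ |a_m − a_n| : 1 ≤ m ≠ n ≤ N }`. -/
noncomputable def Dcard (a : ℕ → ℝ) (N : ℕ) : ℕ :=
  Set.ncard {x : ℝ | ∃ m n : ℕ, 1 ≤ m ∧ m ≤ N ∧ 1 ≤ n ∧ n ≤ N ∧ m ≠ n ∧
    x = |a m - a n|}

/-- `Log x = max (1, log x)`. -/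
noncomputable def Log (x : ℝ) : ℝ := max 1 (Real.log x)

/-- Iterated logarithm `log₂ x = Log (Log x)`. -/
noncomputable def Log2 (x : ℝ) : ℝ := Log (Log x)

/-- The infimum `inf_{n ≥ 1} a_n` of the terms of the sequence. -/
noncomputable def seqInf (a : ℕ → ℝ) : ℝ := sInf {x : ℝ | ∃ n : ℕ, 1 ≤ n ∧ x = a n}

/-! ### Two interlaced sequences -/

lemma sum_pow_sub_left_le {ρ : ℝ} (h0 : 0 ≤ ρ) (h1 : ρ < 1) (n k : ℕ) :
    ∑ i ∈ Finset.range n, (if i < k then ρ ^ (k - i) else 0) ≤ ρ / (1 - ρ) := by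
  have key : ∀ k : ℕ, ∑ i ∈ Finset.range k, ρ ^ (k - i) ≤ ρ / (1 - ρ) := by
    intro k
    induction k with
    | zero => simp; exact div_nonneg h0 (by linarith)
    | succ k ih =>
      rw [Finset.sum_range_succ]
      have : ∑ i ∈ Finset.range k, ρ ^ (k + 1 - i) = ρ * ∑ i ∈ Finset.range k, ρ ^ (k - i) := by
        rw [Finset.mul_sum]
        refine Finset.sum_congr rfl fun i hi => ?_
        have : i < k := Finset.mem_range.mp hi
        rw [show k + 1 - i = (k - i) + 1 by omega, pow_succ]; ring
      rw [this]
      have h2 := mul_le_mul_of_nonneg_left ih h0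
      have h3 : ρ * (ρ / (1 - ρ)) + ρ = ρ / (1 - ρ) := by
        have : (1 - ρ) ≠ 0 := by linarith
        field_simp; ring
      simp; linarith
  calc ∑ i ∈ Finset.range n, (if i < k then ρ ^ (k - i) else 0)
      = ∑ i ∈ (Finset.range n).filter (· < k), ρ ^ (k - i) := by rw [Finset.sum_filter]
    _ ≤ ∑ i ∈ Finset.range k, ρ ^ (k - i) := by
        refine Finset.sum_le_sum_of_subset_of_nonneg ?_ fun _ _ _ => by positivity
        intro i; simp
    _ ≤ _ := key k

lemma sum_pow_sub_right_le {ρ : ℝ} (h0 : 0 ≤ ρ) (h1 : ρ < 1) (n k : ℕ) :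
    ∑ j ∈ Finset.range n, (if k ≤ j then ρ ^ (j - k) else 0) ≤ 1 / (1 - ρ) := by
  have key : ∀ m : ℕ, ∑ i ∈ Finset.range m, ρ ^ i ≤ 1 / (1 - ρ) := by
    intro m
    rw [geom_sum_eq (by linarith), ← neg_div_neg_eq]
    have : 0 ≤ ρ ^ m := by positivity
    have : 0 < 1 - ρ := by linarith
    rw [neg_sub, neg_sub]
    gcongr; linarith
  refine le_trans ?_ (key n)
  rw [← Finset.sum_filter]
  have : ∑ j ∈ (Finset.range n).filter (k ≤ ·), ρ ^ (j - k)
      = ∑ i ∈ ((Finset.range n).filter (k ≤ ·)).image (· - k), ρ ^ i := by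
    rw [Finset.sum_image]
    intro a ha b hb h
    simp at ha hb h; omega
  rw [this]
  refine Finset.sum_le_sum_of_subset_of_nonneg ?_ fun _ _ _ => by positivity
  intro i; simp; intro j hj hk hi; omega

lemma sum_pow_sub_right_lt_le {ρ : ℝ} (h0 : 0 ≤ ρ) (h1 : ρ < 1) (n k : ℕ) :
    ∑ j ∈ Finset.range n, (if k < j then ρ ^ (j - k) else 0) ≤ ρ / (1 - ρ) := by
  have := mul_le_mul_of_nonneg_left (sum_pow_sub_right_le h0 h1 n (k + 1)) h0
  rw [Finset.mul_sum] at this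
  calc _ = _ := ?_
    _ ≤ _ := this
    _ = _ := by ring
  refine Finset.sum_congr rfl fun j _ => ?_
  by_cases h : k < j
  · rw [if_pos h, if_pos (by omega), show j - k = (j - (k + 1)) + 1 by omega, pow_succ]; ring
  · rw [if_neg h, if_neg (by omega)]; simp

lemma sum_pow_dist_ne_le {ρ : ℝ} (h0 : 0 ≤ ρ) (h1 : ρ < 1) (n k : ℕ) :
    ∑ j ∈ Finset.range n, (if k = j then 0 else ρ ^ ((k - j) + (j - k))) ≤ 2 * (ρ / (1 - ρ)) := by
  have a := sum_pow_sub_right_lt_le h0 h1 n k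
  have b := sum_pow_sub_left_le h0 h1 n k
  have : ∑ j ∈ Finset.range n, (if k = j then 0 else ρ ^ ((k - j) + (j - k)))
    = ∑ j ∈ Finset.range n, (if k < j then ρ ^ (j - k) else 0)
      + ∑ i ∈ Finset.range n, (if i < k then ρ ^ (k - i) else 0) := by
    rw [← Finset.sum_add_distrib]
    refine Finset.sum_congr rfl fun j _ => ?_
    rcases lt_trichotomy k j with h | h | h
    · rw [if_neg (by omega), if_pos h, if_neg (by omega), show k - j = 0 by omega]; simp
    · rw [if_pos h, if_neg (by omega), if_neg (by omega)]; simp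
    · rw [if_neg (by omega), if_neg (by omega), if_pos h, show j - k = 0 by omega]; simp
  linarith

lemma sum_dist_ne_mul_le {ρ : ℝ} (h0 : 0 ≤ ρ) (h1 : ρ < 1) (n : ℕ) (x y : ℕ → ℝ) :
    ∑ i ∈ Finset.range n, ∑ j ∈ Finset.range n,
      (if i = j then 0 else ρ ^ ((i - j) + (j - i))) * (x i * y j) ≤
    (ρ / (1 - ρ)) * (∑ i ∈ Finset.range n, x i ^ 2 + ∑ i ∈ Finset.range n, y i ^ 2) := by
  have hc : ∀ i j : ℕ, (0 : ℝ) ≤ (if i = j then 0 else ρ ^ ((i - j) + (j - i))) := by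
    intro i j; split_ifs <;> positivity
  have e : ∀ i j : ℕ, (if i = j then 0 else ρ ^ ((i - j) + (j - i))) * (x i * y j) ≤
      (if i = j then 0 else ρ ^ ((i - j) + (j - i))) * (x i ^ 2 / 2) +
      (if i = j then 0 else ρ ^ ((i - j) + (j - i))) * (y j ^ 2 / 2) := by
    intro i j
    rw [← mul_add]
    refine mul_le_mul_of_nonneg_left ?_ (hc i j)
    nlinarith [sq_nonneg (x i - y j)]
  calc _ ≤ ∑ i ∈ Finset.range n, ∑ j ∈ Finset.range n,
        ((if i = j then 0 else ρ ^ ((i - j) + (j - i))) * (x i ^ 2 / 2) +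
        (if i = j then 0 else ρ ^ ((i - j) + (j - i))) * (y j ^ 2 / 2)) :=
        Finset.sum_le_sum fun i _ => Finset.sum_le_sum fun j _ => e i j
    _ = ∑ i ∈ Finset.range n, (∑ j ∈ Finset.range n,
          (if i = j then 0 else ρ ^ ((i - j) + (j - i)))) * (x i ^ 2 / 2) +
        ∑ j ∈ Finset.range n, (∑ i ∈ Finset.range n,
          (if j = i then 0 else ρ ^ ((j - i) + (i - j)))) * (y j ^ 2 / 2) := by
        simp only [Finset.sum_add_distrib, Finset.sum_mul]
        congr 1
        rw [Finset.sum_comm]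
        refine Finset.sum_congr rfl fun j _ => Finset.sum_congr rfl fun i _ => ?_
        rw [add_comm (i - j)]; simp only [eq_comm]
    _ ≤ ∑ i ∈ Finset.range n, 2 * (ρ / (1 - ρ)) * (x i ^ 2 / 2) +
        ∑ j ∈ Finset.range n, 2 * (ρ / (1 - ρ)) * (y j ^ 2 / 2) := by
        gcongr <;> exact sum_pow_dist_ne_le h0 h1 n _
    _ = _ := by
        rw [mul_add, Finset.mul_sum, Finset.mul_sum]
        congr 1 <;> refine Finset.sum_congr rfl fun j _ => by ring

lemma sum_dist_mul_le {ρ : ℝ} (h0 : 0 ≤ ρ) (h1 : ρ < 1) (n : ℕ) (x y : ℕ → ℝ) :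
    ∑ i ∈ Finset.range n, ∑ j ∈ Finset.range n, ρ ^ ((i - j) + (j - i)) * (x i * y j) ≤
    (1 / (1 - ρ)) * (∑ i ∈ Finset.range n, x i ^ 2 + ∑ i ∈ Finset.range n, y i ^ 2) := by
  have a := sum_dist_ne_mul_le h0 h1 n x y
  have b : ∑ i ∈ Finset.range n, ∑ j ∈ Finset.range n, ρ ^ ((i - j) + (j - i)) * (x i * y j)
      = ∑ i ∈ Finset.range n, ∑ j ∈ Finset.range n,
      (if i = j then 0 else ρ ^ ((i - j) + (j - i))) * (x i * y j)
      + ∑ i ∈ Finset.range n, x i * y i := by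
    rw [← Finset.sum_add_distrib]
    refine Finset.sum_congr rfl fun i hi => ?_
    rw [← Finset.sum_erase_add _ _ hi, ← Finset.sum_erase_add (Finset.range n)
      (fun j => (if i = j then 0 else ρ ^ ((i - j) + (j - i))) * (x i * y j)) hi]
    simp
    refine Finset.sum_congr rfl fun j hj => ?_
    rw [if_neg]
    have := Finset.ne_of_mem_erase hj
    tauto
  have c : ∑ i ∈ Finset.range n, x i * y i ≤
      ∑ i ∈ Finset.range n, x i ^ 2 + ∑ i ∈ Finset.range n, y i ^ 2 := by
    rw [← Finset.sum_add_distrib]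
    refine Finset.sum_le_sum fun i _ => ?_
    nlinarith [sq_nonneg (x i - y i), sq_nonneg (x i), sq_nonneg (y i)]
  rw [b]
  refine (add_le_add a c).trans (le_of_eq ?_)
  have : (1 - ρ) ≠ 0 := by linarith
  field_simp; ring

/-- Cross terms below and above a fixed index. -/
lemma sum_cross_le {ρ : ℝ} (h0 : 0 ≤ ρ) (h1 : ρ < 1) (n k : ℕ) (x y : ℕ → ℝ) {B : ℝ}
    (hB : 0 ≤ B) (hy0 : ∀ i ∈ Finset.range n, 0 ≤ y i)
    (hx : ∀ i ∈ Finset.range n, i < k → x i ≤ B) (hy : ∀ i ∈ Finset.range n, y i ≤ 1) :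
    ∑ i ∈ Finset.range n, ∑ j ∈ Finset.range n,
      (if i < k ∧ k ≤ j then ρ ^ ((i - j) + (j - i)) * (x i * y j) else 0) ≤
    ρ / (1 - ρ) ^ 2 * B := by
  have e : ∀ i ∈ Finset.range n, ∀ j ∈ Finset.range n,
      (if i < k ∧ k ≤ j then ρ ^ ((i - j) + (j - i)) * (x i * y j) else 0 : ℝ) ≤
      ((if i < k then ρ ^ (k - i) else 0 : ℝ)) * ((if k ≤ j then ρ ^ (j - k) else 0 : ℝ) * B) := by
    intro i hi j hj
    by_cases hik : i < k
    · by_cases hkj : k ≤ j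
      · rw [if_pos ⟨hik, hkj⟩, if_pos hik, if_pos hkj,
          show (i - j) + (j - i) = (k - i) + (j - k) by omega, pow_add, mul_assoc]
        refine mul_le_mul_of_nonneg_left (mul_le_mul_of_nonneg_left ?_ (pow_nonneg h0 _))
          (pow_nonneg h0 _)
        calc x i * y j ≤ B * y j := mul_le_mul_of_nonneg_right (hx i hi hik) (hy0 j hj)
          _ ≤ B * 1 := mul_le_mul_of_nonneg_left (hy j hj) hB
          _ = B := mul_one B
      · simp [hkj]
    · simp [hik]
  calc _ ≤ ∑ i ∈ Finset.range n, ∑ j ∈ Finset.range n,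
      ((if i < k then ρ ^ (k - i) else 0 : ℝ)) * ((if k ≤ j then ρ ^ (j - k) else 0 : ℝ) * B) :=
        Finset.sum_le_sum fun i hi => Finset.sum_le_sum fun j hj => e i hi j hj
    _ = (∑ i ∈ Finset.range n, (if i < k then ρ ^ (k - i) else 0 : ℝ)) *
        ((∑ j ∈ Finset.range n, (if k ≤ j then ρ ^ (j - k) else 0 : ℝ)) * B) := by
        rw [Finset.sum_mul, Finset.sum_mul]
        simp only [Finset.mul_sum]
    _ ≤ (ρ / (1 - ρ)) * ((1 / (1 - ρ)) * B) := by
        have : 0 ≤ ρ / (1 - ρ) := div_nonneg h0 (by linarith)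
        refine mul_le_mul (sum_pow_sub_left_le h0 h1 n k)
          (mul_le_mul_of_nonneg_right (sum_pow_sub_right_le h0 h1 n k) hB)
          (mul_nonneg (Finset.sum_nonneg fun j _ => ?_) hB) this
        split_ifs <;> positivity
    _ = _ := by
        have : (1 - ρ) ≠ 0 := by linarith
        field_simp

/-- The one-variable inequality: `A z³ - (3/4) z⁴` is essentially at most `A⁴ / 4`. -/
lemma quartic_bound {ρ ε z : ℝ} (h0 : 0 < ρ) (h1 : ρ ≤ 1 / 100000) (he0 : 0 ≤ ε) (he : ε ≤ 2)
    (hz : 0 ≤ z) (hz4 : z ^ 4 ≤ 4 / 10000) :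
    (1 + ε) * (ρ / (1 - ρ) ^ 2) * z ^ 3 + 5 * z ^ 6 + z ^ 8 + ρ ^ 4 * z ^ 4 - 3 / 4 * z ^ 4 ≤
      ρ ^ 4 / 4 + 10 ^ 10 * (ρ ^ 5 + ε * ρ ^ 4) ∧
    (24 * ρ ≤ z →
    (1 + ε) * (ρ / (1 - ρ) ^ 2) * z ^ 3 + 5 * z ^ 6 + z ^ 8 + ρ ^ 4 * z ^ 4 - 3 / 4 * z ^ 4 ≤
      - (1 / 2) * z ^ 4) := by
  have hA1 : ρ / (1 - ρ) ^ 2 ≤ ρ * (1 + 3 * ρ) := by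
    rw [div_le_iff₀ (by nlinarith)]
    nlinarith [mul_pos h0 h0, pow_pos h0 3, pow_pos h0 4]
  have hA0 : 0 < ρ / (1 - ρ) ^ 2 := div_pos h0 (by nlinarith)
  set A := (1 + ε) * (ρ / (1 - ρ) ^ 2) with hA
  have hAp : 0 < A := by positivity
  have hA2 : A ≤ (1 + ε) * (ρ * (1 + 3 * ρ)) := by rw [hA]; gcongr
  have hz2 : z ^ 2 ≤ 2 / 100 := by
    by_contra h
    push Not at h
    nlinarith [sq_nonneg z]
  have hz40 : 0 ≤ z ^ 4 := by positivity
  have large : 24 * ρ ≤ z → A * z ^ 3 + 5 * z ^ 6 + z ^ 8 + ρ ^ 4 * z ^ 4 - 3 / 4 * z ^ 4 ≤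
      - (1 / 2) * z ^ 4 := by
    intro hzρ
    have : A ≤ 31 / 10 * ρ := by
      refine hA2.trans ?_
      have : (1 + ε) * (1 + 3 * ρ) ≤ 31 / 10 := by nlinarith
      nlinarith
    have h3 : A * z ^ 3 ≤ 31 / 240 * z ^ 4 := by
      have : A ≤ 31 / 240 * z := by linarith
      calc A * z ^ 3 ≤ 31 / 240 * z * z ^ 3 := by gcongr
        _ = _ := by ring
    have h4 : z ^ 6 ≤ 2 / 100 * z ^ 4 := by
      calc z ^ 6 = z ^ 2 * z ^ 4 := by ring
        _ ≤ _ := by gcongr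
    have h5 : z ^ 8 ≤ 4 / 10000 * z ^ 4 := by
      calc z ^ 8 = z ^ 4 * z ^ 4 := by ring
        _ ≤ _ := by gcongr
    have h6 : ρ ^ 4 ≤ 1 / 100000 := by
      calc ρ ^ 4 ≤ ρ ^ 1 := pow_le_pow_of_le_one h0.le (by linarith) (by norm_num)
        _ ≤ _ := by linarith
    have h7 : ρ ^ 4 * z ^ 4 ≤ 1 / 100000 * z ^ 4 := by gcongr
    linarith
  refine ⟨?_, large⟩
  have hρ4 : 0 < ρ ^ 4 := by positivity
  have hρ5 : 0 < ρ ^ 5 := by positivity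
  by_cases hzρ : 24 * ρ ≤ z
  · have := large hzρ
    have : 0 ≤ ε * ρ ^ 4 := by positivity
    linarith
  · push Not at hzρ
    have amgm : A * z ^ 3 ≤ A ^ 4 / 4 + 3 / 4 * z ^ 4 := by
      nlinarith [mul_nonneg (sq_nonneg (A - z)) (add_nonneg (add_nonneg (sq_nonneg A)
        (mul_nonneg (mul_nonneg zero_le_two hAp.le) hz)) (mul_nonneg zero_le_three (sq_nonneg z)))]
    have hA4 : A ^ 4 ≤ ρ ^ 4 * (1 + 800 * (ε + ρ)) := by
      set t := (1 + ε) * (1 + 3 * ρ) - 1 with ht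
      have t0 : 0 ≤ t := by rw [ht]; nlinarith
      have t2 : t ≤ 3 := by rw [ht]; nlinarith
      have t3 : t ≤ ε + 9 * ρ := by rw [ht]; nlinarith
      have : (1 + t) ^ 4 ≤ 1 + 85 * t := by
        nlinarith [mul_nonneg t0 (sub_nonneg.2 t2), mul_nonneg (mul_nonneg t0 t0) (sub_nonneg.2 t2),
          mul_nonneg (mul_nonneg (mul_nonneg t0 t0) t0) (sub_nonneg.2 t2)]
      calc A ^ 4 ≤ ((1 + ε) * (ρ * (1 + 3 * ρ))) ^ 4 := by gcongr
        _ = ρ ^ 4 * (1 + t) ^ 4 := by rw [ht]; ring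
        _ ≤ ρ ^ 4 * (1 + 85 * (ε + 9 * ρ)) := by gcongr; linarith
        _ ≤ ρ ^ 4 * (1 + 800 * (ε + ρ)) := mul_le_mul_of_nonneg_left (by linarith) hρ4.le
    have h6 : z ^ 6 ≤ 10 ^ 9 * ρ ^ 5 := by
      calc z ^ 6 ≤ (24 * ρ) ^ 6 := by gcongr
        _ = 24 ^ 6 * ρ * ρ ^ 5 := by ring
        _ ≤ _ := by gcongr; nlinarith
    have h8 : z ^ 8 ≤ 10 ^ 9 * ρ ^ 5 := by
      calc z ^ 8 = z ^ 2 * z ^ 6 := by ring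
        _ ≤ 1 * z ^ 6 := by gcongr; linarith
        _ ≤ _ := by linarith
    have h4 : ρ ^ 4 * z ^ 4 ≤ 10 ^ 9 * ρ ^ 5 := by
      calc ρ ^ 4 * z ^ 4 ≤ ρ ^ 4 * (24 * ρ) ^ 4 := by gcongr
        _ = 24 ^ 4 * ρ ^ 3 * ρ ^ 5 := by ring
        _ ≤ _ := by
          gcongr
          have : ρ ^ 3 ≤ 1 := pow_le_one₀ h0.le (by linarith)
          linarith
    have : 0 ≤ ε * ρ ^ 4 := by positivity
    have : ρ ^ 4 * (1 + 800 * (ε + ρ)) = ρ ^ 4 + 800 * (ε * ρ ^ 4) + 800 * ρ ^ 5 := by ring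
    linarith

lemma small_product_bound {t G x y : ℝ} (ht : 0 ≤ t) (hG1 : G ≤ 1)
    (hx : 0 ≤ x) (hy : 0 ≤ y) (hx1 : x ≤ 4 / 10000) (hy1 : y ≤ 4 / 10000) :
    G * ((1 - 3 / 4 * x) * (1 - 3 / 4 * y)) ≤
        1 - 3 / 4 * (x + y) + 1 / 2 * (x ^ 2 + y ^ 2) ∧
    (G ≤ 1 - t / 2 → G * ((1 - 3 / 4 * x) * (1 - 3 / 4 * y)) ≤
        1 - t / 2 - 3 / 4 * (x + y) + t * (x + y) + 1 / 2 * (x ^ 2 + y ^ 2)) := by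
  have hP0 : 0 ≤ (1 - 3 / 4 * x) * (1 - 3 / 4 * y) := by
    apply mul_nonneg <;> linarith
  have hP : (1 - 3 / 4 * x) * (1 - 3 / 4 * y) ≤
      1 - 3 / 4 * (x + y) + 1 / 2 * (x ^ 2 + y ^ 2) := by
    linarith [sq_nonneg (x - y), sq_nonneg x, sq_nonneg y]
  have hPl : 1 - (x + y) ≤ (1 - 3 / 4 * x) * (1 - 3 / 4 * y) := by
    linarith [mul_nonneg hx hy]
  generalize (1 - 3 / 4 * x) * (1 - 3 / 4 * y) = P at *
  constructor
  · linarith [mul_le_mul_of_nonneg_right hG1 hP0]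
  · intro hG
    have h1 := mul_le_mul_of_nonneg_right hG hP0
    have h2 := mul_le_mul_of_nonneg_left hPl ht
    have h3 : 0 ≤ t * (x + y) := by positivity
    linarith

/-- The numerical heart of the two-sequence estimate. -/
lemma numerical_bound {ρ ε u v u' v' G Mid : ℝ} (h0 : 0 < ρ) (h1 : ρ ≤ 1 / 100000)
    (he0 : 0 ≤ ε) (he : ε ≤ 2) (hu : 0 ≤ u) (hv : 0 ≤ v) (hu' : 0 ≤ u') (hv' : 0 ≤ v')
    (hU : u ^ 4 + u' ^ 4 ≤ 4 / 10000) (hV : v ^ 4 + v' ^ 4 ≤ 4 / 10000)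
    (hG1 : G ≤ 1) (hG : (u = 0 ∧ v = 0) ∨ G ≤ 1 - ρ ^ 4 / 2)
    (hm1 : Mid ≤ G * ((1 - 3 / 4 * u ^ 4) * (1 - 3 / 4 * v ^ 4)) +
      ε * (ρ / (1 - ρ) ^ 2) * (u' ^ 3 + v' ^ 3))
    (hm2 : Mid ≤ G * ((1 - 3 / 4 * (u ^ 4 + u' ^ 4)) * (1 - 3 / 4 * (v ^ 4 + v' ^ 4))) +
      (1 + ε) * (ρ / (1 - ρ) ^ 2) * (u' ^ 3 + v' ^ 3)) :
    Mid + (1 + ε) * (ρ / (1 - ρ) ^ 2) * (u ^ 3 + v ^ 3) +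
      5 * (u ^ 6 + v ^ 6 + u' ^ 6 + v' ^ 6) ≤ 1 + 10 ^ 12 * (ρ ^ 5 + ε * ρ ^ 4) := by
  have hu4 : 0 ≤ u ^ 4 := by positivity
  have hv4 : 0 ≤ v ^ 4 := by positivity
  have hu4' : 0 ≤ u' ^ 4 := by positivity
  have hv4' : 0 ≤ v' ^ 4 := by positivity
  obtain ⟨qu, -⟩ := quartic_bound h0 h1 he0 he hu (by linarith)
  obtain ⟨qv, -⟩ := quartic_bound h0 h1 he0 he hv (by linarith)
  obtain ⟨qu', ru'⟩ := quartic_bound h0 h1 he0 he hu' (by linarith)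
  obtain ⟨qv', rv'⟩ := quartic_bound h0 h1 he0 he hv' (by linarith)
  have hA1 : ρ / (1 - ρ) ^ 2 ≤ 2 * ρ := by
    rw [div_le_iff₀ (by nlinarith)]
    nlinarith [mul_pos h0 h0, pow_pos h0 3, pow_pos h0 4]
  have hA0 : 0 < ρ / (1 - ρ) ^ 2 := div_pos h0 (by nlinarith)
  set A := ρ / (1 - ρ) ^ 2 with hA
  set E := ρ ^ 5 + ε * ρ ^ 4 with hE
  have hρ4 : 0 < ρ ^ 4 := by positivity
  have hρ5 : 0 < ρ ^ 5 := by positivity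
  have hερ : 0 ≤ ε * ρ ^ 4 := by positivity
  have hE0 : 0 ≤ E := by positivity
  have prod := fun x y : ℝ => small_product_bound (x := x) (y := y) hρ4.le hG1
  have sq2 : ∀ a b : ℝ, (a + b) ^ 2 ≤ 2 * (a ^ 2 + b ^ 2) := fun a b => by
    nlinarith [sq_nonneg (a - b)]
  by_cases hc : u' ≤ 24 * ρ ∧ v' ≤ 24 * ρ
  · obtain ⟨hc1, hc2⟩ := hc
    have up3 : ∀ z : ℝ, 0 ≤ z → z ≤ 24 * ρ → ε * A * z ^ 3 ≤ 10 ^ 5 * E ∧ z ^ 6 ≤ 10 ^ 9 * E := by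
      intro z hz hz1
      constructor
      · calc ε * A * z ^ 3 ≤ ε * (2 * ρ) * (24 * ρ) ^ 3 := by gcongr
          _ = 27648 * (ε * ρ ^ 4) := by ring
          _ ≤ _ := by rw [hE]; linarith only [hρ5, hερ]
      · calc z ^ 6 ≤ (24 * ρ) ^ 6 := by gcongr
          _ = 24 ^ 6 * ρ * ρ ^ 5 := by ring
          _ ≤ 10 ^ 9 * ρ ^ 5 := by gcongr; linarith only [h1]
          _ ≤ _ := by rw [hE]; linarith only [hρ5, hερ]
    obtain ⟨a1, a2⟩ := up3 u' hu' hc1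
    obtain ⟨b1, b2⟩ := up3 v' hv' hc2
    obtain ⟨p1, p2⟩ := prod (u ^ 4) (v ^ 4) hu4 hv4 (by linarith) (by linarith)
    rcases hG with hG | hG
    · have := p1
      obtain ⟨rfl, rfl⟩ := hG
      simp only [ne_eq, OfNat.ofNat_ne_zero, not_false_eq_true, zero_pow] at *
      linarith only [this, hm1, a1, a2, b1, b2, hE0]
    · have := p2 hG
      linarith only [this, hm1, a1, a2, b1, b2, hE0, qu, qv, hρ4, sq_nonneg (u ^ 4),
        sq_nonneg (v ^ 4)]
  · have key : (1 + ε) * A * u' ^ 3 + 5 * u' ^ 6 + u' ^ 8 + ρ ^ 4 * u' ^ 4 - 3 / 4 * u' ^ 4 +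
       ((1 + ε) * A * v' ^ 3 + 5 * v' ^ 6 + v' ^ 8 + ρ ^ 4 * v' ^ 4 - 3 / 4 * v' ^ 4) ≤
       10 ^ 10 * E := by
      have h24 : ∀ z : ℝ, 24 * ρ ≤ z → ρ ^ 4 ≤ z ^ 4 := fun z hz => by
        have : ρ ≤ z := by linarith
        gcongr
      by_cases hu24 : 24 * ρ ≤ u'
      · have := ru' hu24
        have := h24 _ hu24
        linarith only [ru' hu24, this, qv', hE0, hρ4]
      · have hv24 : 24 * ρ ≤ v' := by
          by_contra h
          exact hc ⟨by linarith, by linarith⟩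
        have := rv' hv24
        have := h24 _ hv24
        linarith only [rv' hv24, this, qu', hE0, hρ4]
    obtain ⟨p1, p2⟩ := prod (u ^ 4 + u' ^ 4) (v ^ 4 + v' ^ 4) (by positivity) (by positivity) hU hV
    have s1 := sq2 (u ^ 4) (u' ^ 4)
    have s2 := sq2 (v ^ 4) (v' ^ 4)
    have e1 : ∀ z : ℝ, (z ^ 4) ^ 2 = z ^ 8 := fun z => by ring
    rw [e1, e1] at s1 s2
    rcases hG with hG | hG
    · have := p1
      obtain ⟨rfl, rfl⟩ := hG
      simp only [ne_eq, OfNat.ofNat_ne_zero, not_false_eq_true, zero_pow] at *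
      have H1 : 0 ≤ ρ ^ 4 * u' ^ 4 := by positivity
      have H2 : 0 ≤ ρ ^ 4 * v' ^ 4 := by positivity
      linarith only [this,  hm2, key, s1, s2, hE0, H1, H2]
    · have := p2 hG
      linarith only [this, hm2, key, s1, s2, hE0, qu, qv, hρ4]

lemma exists_fourth_root {t : ℝ} (ht : 0 ≤ t) : ∃ x : ℝ, 0 ≤ x ∧ x ^ 4 = t :=
  ⟨Real.sqrt (Real.sqrt t), Real.sqrt_nonneg _, by
    rw [show 4 = 2 * 2 by rfl, pow_mul, Real.sq_sqrt (Real.sqrt_nonneg _), Real.sq_sqrt ht]⟩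

lemma le_of_fourth_pow_eq_sum {n : ℕ} {ξ : ℕ → ℝ} {P : ℕ → Prop} [DecidablePred P] {u : ℝ}
    (hu : 0 ≤ u) (h : u ^ 4 = ∑ i ∈ Finset.range n, if P i then ξ i ^ 4 else 0) {i : ℕ}
    (hi : i ∈ Finset.range n) (hP : P i) : ξ i ≤ u := by
  refine le_of_pow_le_pow_left₀ (n := 4) (by norm_num) hu ?_
  rw [h]
  refine le_trans (by rw [if_pos hP]) (Finset.single_le_sum
    (f := fun i => if P i then ξ i ^ 4 else 0) (fun j _ => ?_) hi)
  split_ifs <;> positivity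

lemma sum_sixth_le {n : ℕ} {ξ : ℕ → ℝ} {P : ℕ → Prop} [DecidablePred P] {u : ℝ}
    (hξ : ∀ i, 0 ≤ ξ i)
    (hu : 0 ≤ u) (h : u ^ 4 = ∑ i ∈ Finset.range n, if P i then ξ i ^ 4 else 0) :
    ∑ i ∈ Finset.range n, (if P i then ξ i ^ 3 else 0) ^ 2 ≤ u ^ 6 := by
  rw [show u ^ 6 = u ^ 2 * u ^ 4 by ring, h, Finset.mul_sum]
  refine Finset.sum_le_sum fun i hi => ?_
  split_ifs with hP
  · have := le_of_fourth_pow_eq_sum hu h hi hP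
    calc (ξ i ^ 3) ^ 2 = ξ i ^ 2 * ξ i ^ 4 := by ring
      _ ≤ _ := by have := hξ i; gcongr
  · simp

lemma cube_le_of_fourth {z t : ℝ} (hz : 0 ≤ z) (h : z ^ 4 = 1 - t) : z ^ 3 ≤ 1 - 3 / 4 * t := by
  have : t = 1 - z ^ 4 := by linarith
  rw [this]
  nlinarith [sq_nonneg (z - 1), sq_nonneg (z * (z - 1)), sq_nonneg (z ^ 2 - 1),
    mul_nonneg hz (sq_nonneg (z - 1)), sq_nonneg (z ^ 2 - z)]

lemma sum_sum_ite_eq_left {n k : ℕ} (hk : k ∈ Finset.range n) (f : ℕ → ℝ) :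
    ∑ i ∈ Finset.range n, ∑ j ∈ Finset.range n, (if i = k then f j else 0) =
      ∑ j ∈ Finset.range n, f j := by
  rw [Finset.sum_comm]
  refine Finset.sum_congr rfl fun j _ => ?_
  rw [Finset.sum_ite_eq', if_pos hk]

lemma sum_sum_ite_eq_right {n k : ℕ} (hk : k ∈ Finset.range n) (f : ℕ → ℝ) :
    ∑ i ∈ Finset.range n, ∑ j ∈ Finset.range n, (if j = k then f i else 0) =
      ∑ j ∈ Finset.range n, f j := by
  refine Finset.sum_congr rfl fun j _ => ?_
  rw [Finset.sum_ite_eq', if_pos hk]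

set_option maxHeartbeats 4000000 in
/-- Two sequences of unit `ℓ⁴` mass interact through a geometrically decaying kernel with total
essentially at most one, once a saving for nonzero indices is taken into account. -/
theorem two_sequence_bound {ρ ε γ : ℝ} (h0 : 0 < ρ) (hρ : ρ ^ 4 ≤ 1 / 2) (he0 : 0 ≤ ε)
    (he : ε ≤ 2) (n : ℕ) (b : ℕ → ℕ → ℝ) (ξ η : ℕ → ℝ) (hξ : ∀ i, 0 ≤ ξ i) (hη : ∀ i, 0 ≤ η i)
    (sξ : ∑ i ∈ Finset.range n, ξ i ^ 4 = 1) (sη : ∑ i ∈ Finset.range n, η i ^ 4 = 1)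
    (hγ0 : 0 ≤ γ) (hγ : γ ^ 4 = 1 - ρ ^ 4) (hb : ∀ i j, 0 ≤ b i j)
    (H1 : ∀ i j, b i j ≤ ρ ^ ((i - j) + (j - i)) *
      ((if i = 0 then 1 else γ) * (if j = 0 then 1 else γ)) * (ξ i ^ 3 * η j ^ 3))
    (H3 : ∀ (k : ℕ) (x y : ℝ), 0 ≤ x → 0 ≤ y →
      x ^ 4 = ∑ i ∈ Finset.range n, (if k ≤ i then ξ i ^ 4 else 0) →
      y ^ 4 = ∑ i ∈ Finset.range n, (if k ≤ i then η i ^ 4 else 0) →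
      ∑ i ∈ Finset.range n, ∑ j ∈ Finset.range n, (if min i j = k then b i j else 0) ≤
        (if k = 0 then 1 else γ ^ 2) * (x ^ 3 * y ^ 3)) :
    ∑ i ∈ Finset.range n, ∑ j ∈ Finset.range n, (if i = j then 1 else 1 + ε) * b i j ≤
      1 + 10 ^ 27 * (ρ ^ 5 + ε * ρ ^ 4) := by
  have hρ1 : ρ ≤ 17 / 20 := by
    by_contra h
    push Not at h
    have : (17 / 20 : ℝ) ^ 4 < ρ ^ 4 := by gcongr
    norm_num at this; linarith
  have hρ4 : 0 < ρ ^ 4 := by positivity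
  have hρ5 : 0 < ρ ^ 5 := by positivity
  have hερ : 0 ≤ ε * ρ ^ 4 := by positivity
  have hγ1 : γ ≤ 1 := by
    by_contra h
    push Not at h
    have : 1 < γ ^ 4 := one_lt_pow₀ h (by norm_num)
    linarith
  have hξ1 : ∀ i ∈ Finset.range n, ξ i ≤ 1 := fun i hi =>
    le_of_fourth_pow_eq_sum (P := fun _ => True) zero_le_one (by simp [sξ]) hi trivial
  have hη1 : ∀ i ∈ Finset.range n, η i ≤ 1 := fun i hi =>
    le_of_fourth_pow_eq_sum (P := fun _ => True) zero_le_one (by simp [sη]) hi trivial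
  have hg : ∀ i : ℕ, (0 : ℝ) ≤ (if i = 0 then 1 else γ) ∧ (if i = 0 then 1 else γ) ≤ 1 := by
    intro i; split_ifs <;> constructor <;> linarith
  set c : ℕ → ℕ → ℝ := fun i j => ρ ^ ((i - j) + (j - i)) * (ξ i ^ 3 * η j ^ 3) with hc
  have hc0 : ∀ i j, 0 ≤ c i j := fun i j => by
    have := hξ i; have := hη j; simp only [hc]; positivity
  have hbc : ∀ i j, b i j ≤ c i j := by
    intro i j
    refine (H1 i j).trans ?_
    have : (if i = 0 then 1 else γ) * (if j = 0 then 1 else γ) ≤ 1 :=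
      mul_le_one₀ (hg i).2 (hg j).1 (hg j).2
    have h3 := hc0 i j
    simp only [hc] at h3 ⊢
    nlinarith
  have s6 : ∀ x : ℕ → ℝ, (∀ i, 0 ≤ x i) → (∀ i ∈ Finset.range n, x i ≤ 1) →
      ∑ i ∈ Finset.range n, x i ^ 4 = 1 → ∑ i ∈ Finset.range n, (x i ^ 3) ^ 2 ≤ 1 := by
    intro x hx hx1 hs
    rw [← hs]
    refine Finset.sum_le_sum fun i hi => ?_
    rw [← pow_mul]
    exact pow_le_pow_of_le_one (hx i) (hx1 i hi) (by norm_num)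
  have s6ξ := s6 ξ hξ hξ1 sξ
  have s6η := s6 η hη hη1 sη
  by_cases hsmall : 1 / 100000 < ρ
  · have t1 : ∑ i ∈ Finset.range n, ∑ j ∈ Finset.range n, (if i = j then 1 else 1 + ε) * b i j ≤
        ∑ i ∈ Finset.range n, ∑ j ∈ Finset.range n, 3 * c i j := by
      refine Finset.sum_le_sum fun i _ => Finset.sum_le_sum fun j _ => ?_
      refine mul_le_mul ?_ (hbc i j) (hb i j) (by norm_num)
      split_ifs <;> linarith
    have t2 := sum_dist_mul_le h0.le (by linarith) n (fun i => ξ i ^ 3) (fun i => η i ^ 3)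
    have t3 : 1 / (1 - ρ) ≤ 7 := by
      rw [div_le_iff₀ (by linarith)]; linarith
    simp only [← Finset.mul_sum] at t1
    have t4 : 1 / (1 - ρ) * (∑ i ∈ Finset.range n, (ξ i ^ 3) ^ 2 +
        ∑ i ∈ Finset.range n, (η i ^ 3) ^ 2) ≤ 7 * (1 + 1) := by
      gcongr
    have t5 : (1 / 100000 : ℝ) ^ 5 < ρ ^ 5 := by gcongr
    norm_num at t5
    linarith
  push Not at hsmall
  by_cases hI : ∀ i ∈ Finset.range n, ξ i * η i ≤ 1 - 1 / 10000
  · have t1 : ∑ i ∈ Finset.range n, ∑ j ∈ Finset.range n, (if i = j then 1 else 1 + ε) * b i j ≤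
        ∑ i ∈ Finset.range n, ∑ j ∈ Finset.range n,
          ((if j = i then ξ i ^ 3 * η i ^ 3 else 0) +
          3 * ((if i = j then 0 else ρ ^ ((i - j) + (j - i))) * (ξ i ^ 3 * η j ^ 3))) := by
      refine Finset.sum_le_sum fun i _ => Finset.sum_le_sum fun j _ => ?_
      have := hbc i j
      simp only [hc] at this
      by_cases hij : i = j
      · subst hij
        simpa using this
      · rw [if_neg hij, if_neg (Ne.symm hij), if_neg hij, zero_add]
        refine mul_le_mul (by linarith) this (hb i j) (by norm_num)
    simp only [Finset.sum_add_distrib, ← Finset.mul_sum] at t1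
    have t2 := sum_dist_ne_mul_le h0.le (by linarith) n (fun i => ξ i ^ 3) (fun i => η i ^ 3)
    have t3 : ρ / (1 - ρ) ≤ 1 / 90000 := by
      rw [div_le_iff₀ (by linarith)]; linarith
    have t4 : ρ / (1 - ρ) * (∑ i ∈ Finset.range n, (ξ i ^ 3) ^ 2 +
        ∑ i ∈ Finset.range n, (η i ^ 3) ^ 2) ≤ 1 / 90000 * (1 + 1) := by
      gcongr
    have t5 : ∑ i ∈ Finset.range n, ∑ j ∈ Finset.range n, (if j = i then ξ i ^ 3 * η i ^ 3 else 0)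
        ≤ 1 - 1 / 10000 := by
      calc _ = ∑ i ∈ Finset.range n, ξ i ^ 3 * η i ^ 3 := by
            refine Finset.sum_congr rfl fun i hi => ?_
            rw [Finset.sum_ite_eq', if_pos hi]
        _ ≤ ∑ i ∈ Finset.range n, (1 - 1 / 10000) * ((ξ i ^ 4 + η i ^ 4) / 2) := by
            refine Finset.sum_le_sum fun i hi => ?_
            calc ξ i ^ 3 * η i ^ 3 = (ξ i * η i) * (ξ i ^ 2 * η i ^ 2) := by ring
              _ ≤ _ := by
                refine mul_le_mul (hI i hi) ?_ (by positivity) (by norm_num)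
                nlinarith [sq_nonneg (ξ i ^ 2 - η i ^ 2)]
        _ = 1 - 1 / 10000 := by
            rw [← Finset.mul_sum, ← Finset.sum_div, Finset.sum_add_distrib, sξ, sη]; norm_num
    linarith
  push Not at hI
  obtain ⟨k, hk, hkk⟩ := hI
  have hξk : 1 - 1 / 10000 ≤ ξ k := hkk.le.trans (mul_le_of_le_one_right (hξ k) (hη1 k hk))
  have hηk : 1 - 1 / 10000 ≤ η k := hkk.le.trans (mul_le_of_le_one_left (hη k) (hξ1 k hk))
  have nn : ∀ (x : ℕ → ℝ) (P : ℕ → Prop) [DecidablePred P],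
      0 ≤ ∑ i ∈ Finset.range n, (if P i then x i ^ 4 else 0) := by
    intro x P _
    refine Finset.sum_nonneg fun i _ => ?_
    split_ifs <;> positivity
  obtain ⟨u, hu, eu⟩ := exists_fourth_root (nn ξ (fun i => i < k))
  obtain ⟨u', hu', eu'⟩ := exists_fourth_root (nn ξ (fun i => k < i))
  obtain ⟨v, hv, ev⟩ := exists_fourth_root (nn η (fun i => i < k))
  obtain ⟨v', hv', ev'⟩ := exists_fourth_root (nn η (fun i => k < i))
  obtain ⟨x, hx, ex⟩ := exists_fourth_root (nn ξ (fun i => k ≤ i))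
  obtain ⟨y, hy, ey⟩ := exists_fourth_root (nn η (fun i => k ≤ i))
  have split : ∀ z : ℕ → ℝ, ∑ i ∈ Finset.range n, z i ^ 4 = 1 →
      (∑ i ∈ Finset.range n, (if i < k then z i ^ 4 else 0) +
      ∑ i ∈ Finset.range n, (if k ≤ i then z i ^ 4 else 0) = 1) ∧
      ∑ i ∈ Finset.range n, (if k ≤ i then z i ^ 4 else 0) = z k ^ 4 +
      ∑ i ∈ Finset.range n, (if k < i then z i ^ 4 else 0) := by
    intro z hz
    constructor
    · rw [← hz, ← Finset.sum_add_distrib]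
      refine Finset.sum_congr rfl fun i _ => ?_
      by_cases h : i < k
      · rw [if_pos h, if_neg (by omega), add_zero]
      · rw [if_neg h, if_pos (by omega), zero_add]
    · have : z k ^ 4 = ∑ i ∈ Finset.range n, (if i = k then z i ^ 4 else 0) := by
        rw [Finset.sum_ite_eq', if_pos hk]
      rw [this, ← Finset.sum_add_distrib]
      refine Finset.sum_congr rfl fun i _ => ?_
      rcases lt_trichotomy i k with h | h | h
      · rw [if_neg (by omega), if_neg (by omega), if_neg (by omega), add_zero]
      · rw [if_pos (by omega), if_pos h, if_neg (by omega), add_zero]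
      · rw [if_pos (by omega), if_neg (by omega), if_pos h, zero_add]
  obtain ⟨sp1, sp2⟩ := split ξ sξ
  obtain ⟨sp3, sp4⟩ := split η sη
  rw [← eu, ← ex] at sp1
  rw [← eu', ← ex] at sp2
  rw [← ev, ← ey] at sp3
  rw [← ev', ← ey] at sp4
  have p4 : ∀ z : ℝ, 1 - 1 / 10000 ≤ z → 1 - 4 / 10000 ≤ z ^ 4 := by
    intro z hz
    calc (1 : ℝ) - 4 / 10000 ≤ (1 - 1 / 10000) ^ 4 := by norm_num
      _ ≤ _ := by gcongr
  have hU : u ^ 4 + u' ^ 4 ≤ 4 / 10000 := by have := p4 _ hξk; linarith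
  have hV : v ^ 4 + v' ^ 4 ≤ 4 / 10000 := by have := p4 _ hηk; linarith
  set G : ℝ := if k = 0 then 1 else γ ^ 2 with hGdef
  have hG0 : 0 ≤ G := by rw [hGdef]; split_ifs <;> positivity
  have hG1 : G ≤ 1 := by
    rw [hGdef]; split_ifs
    · exact le_rfl
    · exact pow_le_one₀ hγ0 hγ1
  have hG : (u = 0 ∧ v = 0) ∨ G ≤ 1 - ρ ^ 4 / 2 := by
    by_cases hk0 : k = 0
    · left
      subst hk0
      simp at eu ev
      exact ⟨eu, ev⟩
    · right
      rw [hGdef, if_neg hk0]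
      by_contra hcon
      push Not at hcon
      nlinarith
  have hρ' : (0 : ℝ) < 1 - ρ := by linarith
  have hA : ρ / (1 - ρ) ≤ ρ / (1 - ρ) ^ 2 := by
    gcongr; nlinarith
  set A := ρ / (1 - ρ) ^ 2 with hAdef
  have hA0 : 0 < A := by positivity
  set D : ℕ → ℕ → ℝ := fun i j => if min i j = k then (if i = j then 1 else 1 + ε) * b i j else 0
    with hD
  set Mid := ∑ i ∈ Finset.range n, ∑ j ∈ Finset.range n, D i j with hMid
  have cube : ∀ s t : ℝ, 0 ≤ t → s ≤ t → 0 ≤ s → s ^ 3 ≤ t ^ 3 := fun s t _ h hs => by gcongr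
  -- terms in the row and the column of `k`
  set O : ℕ → ℕ → ℝ := fun i j =>
    (if i = k then (if k < j then ρ ^ (j - k) else 0) * v' ^ 3 else 0) +
    (if j = k then (if k < i then ρ ^ (i - k) else 0) * u' ^ 3 else 0) with hO
  have hOsum : ∑ i ∈ Finset.range n, ∑ j ∈ Finset.range n, O i j ≤ A * (u' ^ 3 + v' ^ 3) := by
    simp only [hO, Finset.sum_add_distrib]
    rw [sum_sum_ite_eq_left hk (fun j => (if k < j then ρ ^ (j - k) else 0) * v' ^ 3),
      sum_sum_ite_eq_right hk (fun j => (if k < j then ρ ^ (j - k) else 0) * u' ^ 3),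
      ← Finset.sum_mul, ← Finset.sum_mul]
    have := (sum_pow_sub_right_lt_le h0.le (by linarith) n k).trans hA
    have e1 := mul_le_mul_of_nonneg_right this (pow_nonneg hu' 3)
    have e2 := mul_le_mul_of_nonneg_right this (pow_nonneg hv' 3)
    linarith only [e1, e2]
  have hbO : ∀ i ∈ Finset.range n, ∀ j ∈ Finset.range n, min i j = k → i ≠ j → b i j ≤ O i j := by
    intro i hi j hj hm hij
    refine (hbc i j).trans ?_
    rcases lt_or_gt_of_ne hij with h | h
    · obtain rfl : i = k := by omega
      have e1 := le_of_fourth_pow_eq_sum hv' ev' hj h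
      simp only [hO, hc]
      rw [if_pos trivial, if_pos h, if_neg (by omega), add_zero, show i - j + (j - i) = j - i by omega]
      refine mul_le_mul_of_nonneg_left ?_ (by positivity)
      calc ξ i ^ 3 * η j ^ 3 ≤ 1 * v' ^ 3 := by
            refine mul_le_mul (pow_le_one₀ (hξ i) (hξ1 i hi)) (cube _ _ hv' e1 (hη j))
              (pow_nonneg (hη j) 3) zero_le_one
        _ = _ := one_mul _
    · obtain rfl : j = k := by omega
      have e1 := le_of_fourth_pow_eq_sum hu' eu' hi h
      simp only [hO, hc]
      rw [if_neg (by omega), if_pos trivial, if_pos h, zero_add, show i - j + (j - i) = i - j by omega]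
      refine mul_le_mul_of_nonneg_left ?_ (by positivity)
      calc ξ i ^ 3 * η j ^ 3 ≤ u' ^ 3 * 1 := by
            refine mul_le_mul (cube _ _ hu' e1 (hξ i)) (pow_le_one₀ (hη j) (hη1 j hj))
              (pow_nonneg (hη j) 3) (by positivity)
        _ = _ := mul_one _
  have hO0 : ∀ i j, 0 ≤ O i j := by
    intro i j
    simp only [hO]
    split_ifs <;> positivity
  have hm1 : Mid ≤ G * ((1 - 3 / 4 * u ^ 4) * (1 - 3 / 4 * v ^ 4)) +
      ε * A * (u' ^ 3 + v' ^ 3) := by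
    have e1 : Mid ≤ ∑ i ∈ Finset.range n, ∑ j ∈ Finset.range n,
        ((if min i j = k then b i j else 0) + ε * O i j) := by
      refine Finset.sum_le_sum fun i hi => Finset.sum_le_sum fun j hj => ?_
      have h3 := mul_nonneg he0 (hO0 i j)
      simp only [hD]
      by_cases hm : min i j = k
      · rw [if_pos hm, if_pos hm]
        by_cases hij : i = j
        · rw [if_pos hij, one_mul]; linarith
        · rw [if_neg hij]
          have := mul_le_mul_of_nonneg_left (hbO i hi j hj hm hij) he0
          linarith
      · rw [if_neg hm, if_neg hm, zero_add]; exact h3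
    simp only [Finset.sum_add_distrib, ← Finset.mul_sum] at e1
    have e2 := H3 k x y hx hy ex ey
    have e3 : x ^ 3 * y ^ 3 ≤ (1 - 3 / 4 * u ^ 4) * (1 - 3 / 4 * v ^ 4) := by
      have a1 := cube_le_of_fourth hx (t := u ^ 4) (by linarith)
      have a2 := cube_le_of_fourth hy (t := v ^ 4) (by linarith)
      refine mul_le_mul a1 a2 (by positivity) (le_trans (by positivity) a1)
    have e4 := mul_le_mul_of_nonneg_left e3 hG0
    have e5 := mul_le_mul_of_nonneg_left hOsum he0
    linarith
  have hm2 : Mid ≤ G * ((1 - 3 / 4 * (u ^ 4 + u' ^ 4)) * (1 - 3 / 4 * (v ^ 4 + v' ^ 4))) +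
      (1 + ε) * A * (u' ^ 3 + v' ^ 3) := by
    have e1 : Mid ≤ ∑ i ∈ Finset.range n, ∑ j ∈ Finset.range n,
        ((if i = k then (if j = k then G * (ξ k ^ 3 * η k ^ 3) else 0) else 0) +
          (1 + ε) * O i j) := by
      refine Finset.sum_le_sum fun i hi => Finset.sum_le_sum fun j hj => ?_
      have h3 := mul_nonneg (show 0 ≤ 1 + ε by linarith) (hO0 i j)
      simp only [hD]
      by_cases hm : min i j = k
      · rw [if_pos hm]
        by_cases hij : i = j
        · subst hij
          obtain rfl : i = k := by simpa using hm
          rw [if_pos rfl, if_pos rfl, if_pos rfl, one_mul]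
          have h4 := H1 i i
          have : (if i = 0 then 1 else γ) * (if i = 0 then 1 else γ) = G := by
            rw [hGdef]; split_ifs <;> ring
          rw [this] at h4
          simp at h4
          linarith
        · rw [if_neg hij]
          have := mul_le_mul_of_nonneg_left (hbO i hi j hj hm hij) (show 0 ≤ 1 + ε by linarith)
          have h6 : (0:ℝ) ≤ (if i = k then (if j = k then G * (ξ k ^ 3 * η k ^ 3) else 0) else 0) := by
            have := hξ k; have := hη k
            split_ifs <;> positivity
          linarith
      · rw [if_neg hm]
        have h6 : (0:ℝ) ≤ (if i = k then (if j = k then G * (ξ k ^ 3 * η k ^ 3) else 0) else 0) := by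
          have := hξ k; have := hη k
          split_ifs <;> positivity
        linarith
    simp only [Finset.sum_add_distrib, ← Finset.mul_sum] at e1
    rw [sum_sum_ite_eq_left hk (fun j => if j = k then G * (ξ k ^ 3 * η k ^ 3) else 0),
      Finset.sum_ite_eq', if_pos hk] at e1
    have e3 : ξ k ^ 3 * η k ^ 3 ≤
        (1 - 3 / 4 * (u ^ 4 + u' ^ 4)) * (1 - 3 / 4 * (v ^ 4 + v' ^ 4)) := by
      have := hξ k; have := hη k
      have a1 := cube_le_of_fourth (hξ k) (t := u ^ 4 + u' ^ 4) (by linarith)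
      have a2 := cube_le_of_fourth (hη k) (t := v ^ 4 + v' ^ 4) (by linarith)
      refine mul_le_mul a1 a2 (by positivity) (le_trans (by positivity) a1)
    have e4 := mul_le_mul_of_nonneg_left e3 hG0
    have e5 := mul_le_mul_of_nonneg_left hOsum (show 0 ≤ 1 + ε by linarith)
    linarith
  have main := numerical_bound h0 hsmall he0 he hu hv hu' hv' hU hV hG1 hG hm1 hm2
  -- the four remaining blocks
  have B1 := sum_cross_le h0.le (by linarith) n k (fun i => ξ i ^ 3) (fun i => η i ^ 3)
    (B := u ^ 3) (by positivity) (fun i _ => pow_nonneg (hη i) 3)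
    (fun i hi hik => cube _ _ hu (le_of_fourth_pow_eq_sum hu eu hi hik) (hξ i))
    (fun i hi => pow_le_one₀ (hη i) (hη1 i hi))
  have B2 := sum_cross_le h0.le (by linarith) n k (fun i => η i ^ 3) (fun i => ξ i ^ 3)
    (B := v ^ 3) (by positivity) (fun i _ => pow_nonneg (hξ i) 3)
    (fun i hi hik => cube _ _ hv (le_of_fourth_pow_eq_sum hv ev hi hik) (hη i))
    (fun i hi => pow_le_one₀ (hξ i) (hξ1 i hi))
  rw [Finset.sum_comm] at B2
  have B3 := sum_dist_mul_le h0.le (by linarith) n (fun i => if i < k then ξ i ^ 3 else 0)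
    (fun i => if i < k then η i ^ 3 else 0)
  have B4 := sum_dist_mul_le h0.le (by linarith) n (fun i => if k < i then ξ i ^ 3 else 0)
    (fun i => if k < i then η i ^ 3 else 0)
  have S1 := sum_sixth_le hξ hu eu
  have S2 := sum_sixth_le hξ hu' eu'
  have S3 := sum_sixth_le hη hv ev
  have S4 := sum_sixth_le hη hv' ev'
  have total : ∑ i ∈ Finset.range n, ∑ j ∈ Finset.range n, (if i = j then 1 else 1 + ε) * b i j ≤
      ∑ i ∈ Finset.range n, ∑ j ∈ Finset.range n, (D i j + ((1 + ε) *
        (if i < k ∧ k ≤ j then ρ ^ ((i - j) + (j - i)) * (ξ i ^ 3 * η j ^ 3) else 0) + (1 + ε) *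
        (if j < k ∧ k ≤ i then ρ ^ ((j - i) + (i - j)) * (η j ^ 3 * ξ i ^ 3) else 0) + (1 + ε) *
        (ρ ^ ((i - j) + (j - i)) *
          ((if i < k then ξ i ^ 3 else 0) * (if j < k then η j ^ 3 else 0))) + (1 + ε) *
        (ρ ^ ((i - j) + (j - i)) *
          ((if k < i then ξ i ^ 3 else 0) * (if k < j then η j ^ 3 else 0))))) := by
    refine Finset.sum_le_sum fun i hi => Finset.sum_le_sum fun j hj => ?_
    have hw : (if i = j then 1 else 1 + ε) * b i j ≤ (1 + ε) * c i j := by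
      refine mul_le_mul ?_ (hbc i j) (hb i j) (by linarith)
      split_ifs <;> linarith
    simp only [hD]
    simp only [hc] at hw
    have x0 := pow_nonneg (hξ i) 3
    have y0 := pow_nonneg (hη j) 3
    by_cases hm : min i j = k
    · rw [if_pos hm]
      have : 0 ≤ 1 + ε := by linarith
      refine le_add_of_nonneg_right ?_
      refine add_nonneg (add_nonneg (add_nonneg ?_ ?_) ?_) ?_ <;>
      · refine mul_nonneg this ?_
        split_ifs <;> positivity
    · rw [if_neg hm, zero_add]
      by_cases h1 : i < k
      · by_cases h2 : j < k
        · have e1 : ¬ k ≤ i := by omega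
          have e2 : ¬ k ≤ j := by omega
          have e3 : ¬ k < i := by omega
          simp only [h1, h2, e1, e2, e3, and_false, if_true, if_false, mul_zero, zero_mul,
            add_zero, zero_add]
          exact hw
        · have e1 : ¬ k ≤ i := by omega
          have e2 : k ≤ j := by omega
          have e3 : ¬ k < i := by omega
          simp only [h1, h2, e1, e2, e3, and_true, and_false, if_true, if_false, mul_zero,
            zero_mul, add_zero]
          exact hw
      · by_cases h2 : j < k
        · have e1 : k ≤ i := by omega
          have e2 : ¬ k ≤ j := by omega
          have e3 : ¬ k < j := by omega
          rw [add_comm (j - i), mul_comm (η j ^ 3)]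
          simp only [h1, h2, e1, e2, e3, and_true, and_false, if_true, if_false, mul_zero,
            zero_mul, add_zero, zero_add]
          exact hw
        · have e1 : k < i := by omega
          have e2 : k < j := by omega
          have e3 : k ≤ i := by omega
          simp only [h1, h2, e1, e2, e3, and_true, false_and, if_true, if_false, mul_zero,
            add_zero, zero_add]
          exact hw
  simp only [Finset.sum_add_distrib, ← Finset.mul_sum] at total
  have r1 : 1 / (1 - ρ) ≤ 5 / 3 := by
    rw [div_le_iff₀ (by linarith)]; linarith
  have r2 : ∀ X Y s t : ℝ, X ≤ 1 / (1 - ρ) * Y → Y ≤ s ^ 6 + t ^ 6 →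
      (1 + ε) * X ≤ 5 * (s ^ 6 + t ^ 6) := by
    intro X Y s t hX hY
    have q : 0 ≤ s ^ 6 + t ^ 6 := by positivity
    have r0 : 0 ≤ 1 / (1 - ρ) := by positivity
    have c1 := mul_le_mul_of_nonneg_left hY r0
    have c2 := mul_le_mul_of_nonneg_right r1 q
    have c3 := mul_le_mul_of_nonneg_left (hX.trans (c1.trans c2)) (show 0 ≤ 1 + ε by linarith)
    have c4 := mul_le_mul_of_nonneg_right (show 1 + ε ≤ 3 by linarith)
      (show 0 ≤ 5 / 3 * (s ^ 6 + t ^ 6) by positivity)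
    linarith only [c3, c4]
  have B3' := r2 _ _ u v B3 (add_le_add S1 S3)
  have B4' := r2 _ _ u' v' B4 (add_le_add S2 S4)
  have B1' := mul_le_mul_of_nonneg_left B1 (show 0 ≤ 1 + ε by linarith)
  have B2' := mul_le_mul_of_nonneg_left B2 (show 0 ≤ 1 + ε by linarith)
  linarith only [main, total, B1', B2', B3', B4', hρ5, hερ]

/-! ### Bipartite graphs with a divisibility structure -/

lemma sum_le_of_dvd_of_le {m : ℕ → ℝ} {S : Finset ℕ} {a v : ℕ} {c : ℝ}
    (hc : 0 ≤ c) (hS : ∀ s ∈ S, 0 < s ∧ a ∣ s ∧ s ≤ v) (hm : ∀ s ∈ S, m s ≤ c) :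
    ∑ s ∈ S, m s ≤ v / a * c := by
  have h1 : S ⊆ (Finset.Ioc 0 v).filter (a ∣ ·) := by
    intro s hs
    obtain ⟨p, q, r⟩ := hS s hs
    simp [p, q, r]
  have h2 := Finset.card_le_card h1
  rw [Nat.Ioc_filter_dvd_card_eq_div] at h2
  calc ∑ s ∈ S, m s ≤ ∑ s ∈ S, c := Finset.sum_le_sum hm
    _ = S.card * c := by rw [Finset.sum_const, nsmul_eq_mul]
    _ ≤ ((v / a : ℕ) : ℝ) * c := by gcongr
    _ ≤ v / a * c := by gcongr; exact Nat.cast_div_le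

/-- A dense bipartite graph contains a vertex pair of large degree, maximal in both coordinates. -/
lemma sq_edge_sum_le_of_pos {m : ℕ → ℝ} {V W : Finset ℕ} {E : ℕ → ℕ → Prop}
    [∀ v w, Decidable (E v w)] {a b : ℕ} {A B : ℝ} (ha : 0 < a) (hb : 0 < b)
    (hA0 : 0 ≤ A) (hB0 : 0 ≤ B)
    (hmV : ∀ v ∈ V, 0 < m v) (hmW : ∀ w ∈ W, 0 < m w)
    (hV : ∀ v ∈ V, 0 < v ∧ a ∣ v) (hW : ∀ w ∈ W, 0 < w ∧ b ∣ w)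
    (hA : ∀ v ∈ V, ∀ w ∈ W, E v w → m v * w ≤ A) (hB : ∀ v ∈ V, ∀ w ∈ W, E v w → m w * v ≤ B) :
    (∑ v ∈ V, ∑ w ∈ W, if E v w then m v * m w else 0) ^ 2 ≤
      9 * (A / a * (B / b)) * ((∑ v ∈ V, m v) * ∑ w ∈ W, m w) := by
  set M := ∑ v ∈ V, ∑ w ∈ W, (if E v w then m v * m w else 0) with hM
  have hM0 : 0 ≤ M := Finset.sum_nonneg fun v hv => Finset.sum_nonneg fun w hw => by
    have := hmV v hv; have := hmW w hw
    split_ifs <;> positivity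
  rcases hM0.eq_or_lt with h0 | hMpos
  · have : 0 ≤ ∑ v ∈ V, m v := Finset.sum_nonneg fun v hv => (hmV v hv).le
    have : 0 ≤ ∑ v ∈ W, m v := Finset.sum_nonneg fun v hv => (hmW v hv).le
    have h3 : 0 ≤ 9 * (A / a * (B / b)) * ((∑ v ∈ V, m v) * ∑ w ∈ W, m w) := by positivity
    rw [← h0]; simpa using h3
  have hVpos : 0 < ∑ v ∈ V, m v := by
    refine Finset.sum_pos hmV ?_
    by_contra h
    rw [Finset.not_nonempty_iff_eq_empty] at h
    simp [hM, h] at hMpos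
  have hWpos : 0 < ∑ w ∈ W, m w := by
    refine Finset.sum_pos hmW ?_
    by_contra h
    rw [Finset.not_nonempty_iff_eq_empty] at h
    simp [hM, h] at hMpos
  set α := M / (3 * ∑ v ∈ V, m v) with hα
  set β := M / (3 * ∑ w ∈ W, m w) with hβ
  have hαpos : 0 < α := by positivity
  have hβpos : 0 < β := by positivity
  let Φ : Finset ℕ × Finset ℕ → ℝ := fun P =>
    ∑ v ∈ P.1, ∑ w ∈ P.2, (if E v w then m v * m w else 0) - α * ∑ v ∈ P.1, m v -
      β * ∑ w ∈ P.2, m w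
  obtain ⟨⟨V', W'⟩, hmem, hmax⟩ := Finset.exists_max_image (V.powerset ×ˢ W.powerset) Φ
    ⟨(V, W), by simp⟩
  simp only [Finset.mem_product, Finset.mem_powerset] at hmem hmax
  obtain ⟨hV', hW'⟩ := hmem
  have hfull := hmax (V, W) ⟨subset_rfl, subset_rfl⟩
  have hfullval : Φ (V, W) = M / 3 := by
    simp only [Φ, ← hM, hα, hβ]
    field_simp; ring
  have hne : W'.Nonempty := by
    by_contra h
    rw [Finset.not_nonempty_iff_eq_empty] at h
    have : 0 ≤ ∑ v ∈ V', m v := Finset.sum_nonneg fun v hv => (hmV v (hV' hv)).le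
    have h2 := mul_nonneg hαpos.le this
    simp only [hfullval] at hfull
    simp only [Φ, h, Finset.sum_empty, Finset.sum_const_zero, mul_zero] at hfull
    linarith
  have degV : ∀ v ∈ V', α ≤ ∑ w ∈ W', if E v w then m w else 0 := by
    intro v hv
    have h1 := hmax (V'.erase v, W') ⟨(Finset.erase_subset _ _).trans hV', hW'⟩
    simp only [Φ] at h1
    rw [← Finset.add_sum_erase V' _ hv, ← Finset.add_sum_erase V' m hv] at h1
    have h2 : ∑ w ∈ W', (if E v w then m v * m w else 0) =
        m v * ∑ w ∈ W', if E v w then m w else 0 := by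
      rw [Finset.mul_sum]
      refine Finset.sum_congr rfl fun w _ => ?_
      split_ifs <;> simp
    rw [h2] at h1
    have h3 : m v * α ≤ m v * ∑ w ∈ W', if E v w then m w else 0 := by linarith
    exact le_of_mul_le_mul_left h3 (hmV v (hV' hv))
  have degW : ∀ w ∈ W', β ≤ ∑ v ∈ V', if E v w then m v else 0 := by
    intro w hw
    have h1 := hmax (V', W'.erase w) ⟨hV', (Finset.erase_subset _ _).trans hW'⟩
    simp only [Φ] at h1
    rw [← Finset.add_sum_erase W' m hw] at h1
    have h2 : ∑ v ∈ V', ∑ w ∈ W', (if E v w then m v * m w else 0) =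
        m w * (∑ v ∈ V', if E v w then m v else 0) +
          ∑ v ∈ V', ∑ w ∈ W'.erase w, (if E v w then m v * m w else 0) := by
      rw [Finset.mul_sum, ← Finset.sum_add_distrib]
      refine Finset.sum_congr rfl fun v _ => ?_
      rw [← Finset.add_sum_erase W' _ hw]
      congr 1
      split_ifs <;> ring
    rw [h2] at h1
    have h3 : m w * β ≤ m w * ∑ v ∈ V', if E v w then m v else 0 := by linarith
    exact le_of_mul_le_mul_left h3 (hmW w (hW' hw))
  set w := W'.max' hne with hw
  have hwW : w ∈ W' := Finset.max'_mem _ _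
  have d1 := degW w hwW
  rw [← Finset.sum_filter] at d1
  have hneV : (V'.filter (E · w)).Nonempty := by
    by_contra h
    rw [Finset.not_nonempty_iff_eq_empty] at h
    rw [h] at d1; simp at d1; linarith
  set v := (V'.filter (E · w)).max' hneV with hv
  have hvV : v ∈ V'.filter (E · w) := Finset.max'_mem _ _
  have hvV' : v ∈ V' := (Finset.mem_filter.mp hvV).1
  have hvw : E v w := (Finset.mem_filter.mp hvV).2
  have d2 := degV v hvV'
  rw [← Finset.sum_filter] at d2
  have hw0 : (0 : ℝ) < w := by exact_mod_cast (hW w (hW' hwW)).1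
  have hv0 : (0 : ℝ) < v := by exact_mod_cast (hV v (hV' hvV')).1
  have b1 : β ≤ v / a * (A / w) := d1.trans <| sum_le_of_dvd_of_le (by positivity)
    (fun s hs => ⟨(hV s (hV' (Finset.mem_filter.mp hs).1)).1,
      (hV s (hV' (Finset.mem_filter.mp hs).1)).2, Finset.le_max' _ _ hs⟩)
    (fun s hs => by
      rw [le_div_iff₀ hw0]
      exact hA s (hV' (Finset.mem_filter.mp hs).1) w (hW' hwW) (Finset.mem_filter.mp hs).2)
  have b2 : α ≤ w / b * (B / v) := d2.trans <| sum_le_of_dvd_of_le (by positivity)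
    (fun s hs => ⟨(hW s (hW' (Finset.mem_filter.mp hs).1)).1,
      (hW s (hW' (Finset.mem_filter.mp hs).1)).2, Finset.le_max' _ _ (Finset.mem_filter.mp hs).1⟩)
    (fun s hs => by
      rw [le_div_iff₀ hv0]
      exact hB v (hV' hvV') s (hW' (Finset.mem_filter.mp hs).1) (Finset.mem_filter.mp hs).2)
  have b3 : β * α ≤ A / a * (B / b) := by
    calc β * α ≤ (v / a * (A / w)) * (w / b * (B / v)) := by gcongr
      _ = _ := by field_simp
  have b4 : M ^ 2 = 9 * (β * α) * ((∑ v ∈ V, m v) * ∑ w ∈ W, m w) := by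
    rw [hα, hβ]; field_simp; ring
  rw [b4]
  gcongr

lemma sq_edge_sum_le {m : ℕ → ℝ} {V W : Finset ℕ} {E : Finset (ℕ × ℕ)} {a b : ℕ} {A B : ℝ}
    (ha : 0 < a) (hb : 0 < b) (hA0 : 0 ≤ A) (hB0 : 0 ≤ B) (hm : ∀ v, 0 ≤ m v)
    (hE : E ⊆ V ×ˢ W) (hV : ∀ v ∈ V, 0 < v ∧ a ∣ v) (hW : ∀ w ∈ W, 0 < w ∧ b ∣ w)
    (hA : ∀ e ∈ E, m e.1 * e.2 ≤ A) (hB : ∀ e ∈ E, m e.2 * e.1 ≤ B) :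
    (∑ e ∈ E, m e.1 * m e.2) ^ 2 ≤
      9 * (A / a * (B / b)) * ((∑ v ∈ V, m v) * ∑ w ∈ W, m w) := by
  have key := sq_edge_sum_le_of_pos (m := m) (V := V.filter (0 < m ·)) (W := W.filter (0 < m ·))
    (E := fun v w => (v, w) ∈ E) ha hb hA0 hB0 (by simp) (by simp)
    (fun v hv => hV v (Finset.mem_filter.mp hv).1) (fun v hv => hW v (Finset.mem_filter.mp hv).1)
    (fun v _ w _ e => hA (v, w) e) (fun v _ w _ e => hB (v, w) e)
  have e0 : ∀ S : Finset ℕ, ∑ v ∈ S.filter (0 < m ·), m v = ∑ v ∈ S, m v := by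
    intro S
    refine Finset.sum_subset (Finset.filter_subset _ _) fun v hv hv' => ?_
    simp only [Finset.mem_filter, not_and, not_lt] at hv'
    exact le_antisymm (hv' hv) (hm v)
  rw [e0, e0] at key
  convert key using 2
  have e1 : ∑ e ∈ E, m e.1 * m e.2 =
      ∑ e ∈ V ×ˢ W, if e ∈ E then m e.1 * m e.2 else 0 := by
    rw [← Finset.sum_filter]
    congr 1
    ext e
    simp only [Finset.mem_filter]
    exact ⟨fun h => ⟨hE h, h⟩, fun h => h.2⟩
  rw [e1, ← Finset.sum_product']
  symm
  refine Finset.sum_subset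
    (Finset.product_subset_product (Finset.filter_subset _ _) (Finset.filter_subset _ _))
    fun e he he' => ?_
  simp only [Finset.mem_product, Finset.mem_filter] at he he'
  split_ifs
  · by_cases h1 : 0 < m e.1
    · have : m e.2 = 0 := by
        by_contra h2
        exact he' ⟨⟨he.1, h1⟩, he.2, lt_of_le_of_ne (hm _) (Ne.symm h2)⟩
      rw [this, mul_zero]
    · rw [le_antisymm (not_lt.mp h1) (hm _), zero_mul]
  · rfl

/-! ### The ratio `φ(n) / n` -/

/-- The ratio `φ(n) / n`. -/
noncomputable def totientRatio (n : ℕ) : ℝ := (n.totient : ℝ) / n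

lemma totientRatio_eq_prod {n : ℕ} (hn : 0 < n) :
    totientRatio n = ∏ p ∈ n.primeFactors, (1 - (p : ℝ)⁻¹) := by
  have h : ((n.totient : ℚ) : ℝ) = ((n * ∏ p ∈ n.primeFactors, (1 - (p : ℚ)⁻¹) : ℚ) : ℝ) := by
    rw [Nat.totient_eq_mul_prod_factors]
  push_cast at h
  rw [totientRatio, h]
  field_simp

lemma one_sub_inv_prime_pos {p : ℕ} (hp : p.Prime) : 0 < 1 - (p : ℝ)⁻¹ := by
  have : (1 : ℝ) < p := by exact_mod_cast hp.one_lt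
  have := inv_lt_one_of_one_lt₀ this
  linarith

lemma one_sub_inv_natCast_le_one (p : ℕ) : 1 - (p : ℝ)⁻¹ ≤ 1 := by
  have : (0 : ℝ) ≤ (p : ℝ)⁻¹ := by positivity
  linarith

lemma totientRatio_nonneg (n : ℕ) : 0 ≤ totientRatio n := by
  rw [totientRatio]; positivity

lemma totientRatio_pos {n : ℕ} (hn : 0 < n) : 0 < totientRatio n := by
  have := Nat.totient_pos.mpr hn
  rw [totientRatio]; positivity

lemma totientRatio_le_one (n : ℕ) : totientRatio n ≤ 1 := by
  rw [totientRatio]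
  exact div_le_one_of_le₀ (by exact_mod_cast n.totient_le) (by positivity)

lemma totientRatio_le_of_dvd {a v : ℕ} (hv : 0 < v) (h : a ∣ v) :
    totientRatio v ≤ totientRatio a := by
  rw [totientRatio_eq_prod hv, totientRatio_eq_prod (Nat.pos_of_dvd_of_pos h hv)]
  have hs := Nat.primeFactors_mono h hv.ne'
  rw [← Finset.prod_sdiff hs]
  refine mul_le_of_le_one_left (Finset.prod_nonneg fun p hp =>
    (one_sub_inv_prime_pos (Nat.prime_of_mem_primeFactors hp)).le)
    (Finset.prod_le_one (fun p hp => (one_sub_inv_prime_pos (Nat.prime_of_mem_primeFactors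
      (Finset.mem_sdiff.mp hp).1)).le) fun p _ => one_sub_inv_natCast_le_one p)

lemma totientRatio_mul_prime_pow {a p : ℕ} (hp : p.Prime) (h : ¬ p ∣ a) (k : ℕ) :
    totientRatio (a * p ^ k) = totientRatio a * (if k = 0 then 1 else 1 - (p : ℝ)⁻¹) := by
  rcases k.eq_zero_or_pos with rfl | hk
  · simp
  have hc : a.Coprime (p ^ k) := ((Nat.Prime.coprime_iff_not_dvd hp).mpr h).symm.pow_right k
  have hp0 : (0 : ℝ) < p := by exact_mod_cast hp.pos
  rw [totientRatio, Nat.totient_mul hc, Nat.totient_prime_pow hp hk, if_neg hk.ne', totientRatio]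
  obtain ⟨j, rfl⟩ := Nat.exists_eq_add_of_lt hk
  push_cast [Nat.cast_sub hp.one_lt.le]
  simp only [zero_add]
  rcases Nat.eq_zero_or_pos a with rfl | ha
  · simp
  field_simp
  ring

/-! ### Regrouping sums over edges -/

lemma sum_edges_fiberwise {E : Finset (ℕ × ℕ)} {f : ℕ → ℕ} {n : ℕ}
    (hf : ∀ e ∈ E, f e.1 < n ∧ f e.2 < n) (c : ℕ → ℕ → ℝ) (G : ℕ × ℕ → ℝ) :
    ∑ e ∈ E, c (f e.1) (f e.2) * G e = ∑ i ∈ Finset.range n, ∑ j ∈ Finset.range n,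
      c i j * ∑ e ∈ E.filter (fun e => f e.1 = i ∧ f e.2 = j), G e := by
  rw [← Finset.sum_product']
  rw [← Finset.sum_fiberwise_of_maps_to (s := E) (t := Finset.range n ×ˢ Finset.range n)
    (g := fun e => (f e.1, f e.2)) (fun e he => by simpa using hf e he)]
  refine Finset.sum_congr rfl fun ⟨i, j⟩ _ => ?_
  rw [Finset.mul_sum]
  simp only [Prod.mk.injEq]
  refine Finset.sum_congr rfl fun e he => ?_
  obtain ⟨_, h1, h2⟩ := Finset.mem_filter.mp he
  rw [h1, h2]

lemma sum_filter_fiberwise {V : Finset ℕ} {f : ℕ → ℕ} {n : ℕ} (hf : ∀ v ∈ V, f v < n)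
    (P : ℕ → Prop) [DecidablePred P] (m : ℕ → ℝ) :
    ∑ i ∈ Finset.range n, (if P i then ∑ v ∈ V.filter (f · = i), m v else 0) =
      ∑ v ∈ V.filter (fun v => P (f v)), m v := by
  rw [Finset.sum_filter, ← Finset.sum_fiberwise_of_maps_to (s := V) (t := Finset.range n)
    (g := f) (fun e he => by simpa using hf e he)]
  refine Finset.sum_congr rfl fun i _ => ?_
  split_ifs with h
  · refine Finset.sum_congr rfl fun v hv => ?_
    rw [if_pos]; rw [(Finset.mem_filter.mp hv).2]; exact h
  · symm
    refine Finset.sum_eq_zero fun v hv => ?_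
    rw [if_neg]; rw [(Finset.mem_filter.mp hv).2]; exact h

/-! ### The weighted edge count -/

lemma edge_sum_le_of_gcd_eq {ψ : ℕ → ℝ} (hψ : ∀ n, 0 ≤ ψ n) {T : ℝ} (hT : 0 < T)
    {a b g : ℕ} {V W : Finset ℕ} {E : Finset (ℕ × ℕ)} (ha : 0 < a) (hb : 0 < b)
    (hE : E ⊆ V ×ˢ W) (hV : ∀ v ∈ V, 0 < v ∧ a ∣ v) (hW : ∀ w ∈ W, 0 < w ∧ b ∣ w)
    (hgcd : ∀ e ∈ E, Nat.gcd e.1 e.2 = g)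
    (hD : ∀ e ∈ E, ψ e.1 * e.2 ≤ T * Nat.gcd e.1 e.2 ∧ ψ e.2 * e.1 ≤ T * Nat.gcd e.1 e.2)
    {x y κ : ℝ} (hx : 0 ≤ x) (hy : 0 ≤ y) (hκ : 0 ≤ κ)
    (hxV : x ^ 4 = ∑ v ∈ V, ψ v * totientRatio v)
    (hyW : y ^ 4 = ∑ w ∈ W, ψ w * totientRatio w)
    (hκe : κ ^ 4 = 9 * T ^ 2 * (g : ℝ) ^ 2 * totientRatio a * totientRatio b / (a * b)) :
    ∑ e ∈ E, (ψ e.1 * totientRatio e.1) * (ψ e.2 * totientRatio e.2) ≤ κ * x ^ 3 * y ^ 3 := by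
  have hm : ∀ v, 0 ≤ ψ v * totientRatio v := fun v => mul_nonneg (hψ v) (totientRatio_nonneg v)
  have key := sq_edge_sum_le (m := fun v => ψ v * totientRatio v) (V := V) (W := W) (E := E)
    (A := T * g * totientRatio a) (B := T * g * totientRatio b) ha hb
    (by have := totientRatio_nonneg a; positivity) (by have := totientRatio_nonneg b; positivity)
    hm hE hV hW ?_ ?_
  · set M := ∑ e ∈ E, (ψ e.1 * totientRatio e.1) * (ψ e.2 * totientRatio e.2) with hM
    have hM0 : 0 ≤ M := Finset.sum_nonneg fun e _ => mul_nonneg (hm _) (hm _)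
    have h1 : M ≤ x ^ 4 * y ^ 4 := by
      rw [hxV, hyW, Finset.sum_mul_sum, ← Finset.sum_product']
      exact Finset.sum_le_sum_of_subset_of_nonneg hE fun e _ _ => mul_nonneg (hm _) (hm _)
    have h2 : M ^ 2 ≤ κ ^ 4 * (x ^ 4 * y ^ 4) := by
      rw [hκe, hxV, hyW]
      refine key.trans (le_of_eq ?_)
      congr 1
      ring
    refine le_of_pow_le_pow_left₀ (n := 4) (by norm_num) (by positivity) ?_
    calc M ^ 4 = M ^ 2 * M ^ 2 := by ring
      _ ≤ (κ ^ 4 * (x ^ 4 * y ^ 4)) * (x ^ 4 * y ^ 4) ^ 2 := by gcongr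
      _ = _ := by ring
  · intro e he
    obtain ⟨h1, h2⟩ := Finset.mem_product.mp (hE he)
    have h3 := (hD e he).1
    rw [hgcd e he] at h3
    calc ψ e.1 * totientRatio e.1 * e.2 = (ψ e.1 * e.2) * totientRatio e.1 := by ring
      _ ≤ (T * g) * totientRatio a := by
        gcongr
        · exact totientRatio_nonneg _
        · exact totientRatio_le_of_dvd (hV _ h1).1 (hV _ h1).2
  · intro e he
    obtain ⟨h1, h2⟩ := Finset.mem_product.mp (hE he)
    have h3 := (hD e he).2
    rw [hgcd e he] at h3
    calc ψ e.2 * totientRatio e.2 * e.1 = (ψ e.2 * e.1) * totientRatio e.2 := by ring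
      _ ≤ (T * g) * totientRatio b := by
        gcongr
        · exact totientRatio_nonneg _
        · exact totientRatio_le_of_dvd (hW _ h2).1 (hW _ h2).2

lemma gcd_eq_of_forall_prime {v w g : ℕ} (hv : v ≠ 0) (hw : w ≠ 0) (hg : g ≠ 0)
    (h : ∀ r, r.Prime → min (v.factorization r) (w.factorization r) = g.factorization r) :
    Nat.gcd v w = g := by
  refine Nat.eq_of_factorization_eq (Nat.gcd_ne_zero_left hv) hg fun r => ?_
  rw [Nat.factorization_gcd hv hw, Finsupp.inf_apply]
  by_cases hr : r.Prime
  · exact h r hr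
  · simp [Nat.factorization_eq_zero_of_not_prime _ hr]

lemma kappa_pow_mul {a b g p i j : ℕ} (ha : 0 < a) (hb : 0 < b) (hp : p.Prime)
    (hpa : ¬ p ∣ a) (hpb : ¬ p ∣ b) {T κ ρ γ : ℝ} (hρ : ρ ^ 4 = (p : ℝ)⁻¹) (hγ : γ ^ 4 = 1 - ρ ^ 4)
    (hκe : κ ^ 4 = 9 * T ^ 2 * (g : ℝ) ^ 2 * totientRatio a * totientRatio b / (a * b)) :
    (κ * ρ ^ ((i - j) + (j - i)) * ((if i = 0 then 1 else γ) * (if j = 0 then 1 else γ))) ^ 4 =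
      9 * T ^ 2 * ((g * p ^ min i j : ℕ) : ℝ) ^ 2 * totientRatio (a * p ^ i) *
        totientRatio (b * p ^ j) / ((a * p ^ i : ℕ) * (b * p ^ j : ℕ)) := by
  have hc : ∀ k : ℕ, (if k = 0 then (1:ℝ) else γ) ^ 4 = if k = 0 then 1 else 1 - (p : ℝ)⁻¹ := by
    intro k; split_ifs
    · simp
    · rw [hγ, hρ]
  rw [mul_pow, mul_pow, mul_pow, hc, hc, hκe, totientRatio_mul_prime_pow hp hpa,
    totientRatio_mul_prime_pow hp hpb, ← pow_mul, mul_comm _ 4, pow_mul, hρ]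
  have hp0 : (p : ℝ) ≠ 0 := by exact_mod_cast hp.ne_zero
  have e : (p : ℝ) ^ i * (p : ℝ) ^ j = (p : ℝ) ^ ((i - j) + (j - i)) * ((p : ℝ) ^ min i j) ^ 2 := by
    rw [← pow_mul, ← pow_add, ← pow_add]; congr 1; omega
  have ha' : (a : ℝ) ≠ 0 := by exact_mod_cast ha.ne'
  have hb' : (b : ℝ) ≠ 0 := by exact_mod_cast hb.ne'
  push_cast
  have e2 : (a : ℝ) * (p : ℝ) ^ i * (b * (p : ℝ) ^ j) =
      a * b * ((p : ℝ) ^ ((i - j) + (j - i)) * ((p : ℝ) ^ min i j) ^ 2) := by rw [← e]; ring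
  rw [e2, inv_pow]
  field_simp

lemma factorization_mul_prime_pow_apply {g p k r : ℕ} (hg : g ≠ 0) (hp : p.Prime) :
    (g * p ^ k).factorization r = g.factorization r + if r = p then k else 0 := by
  rw [Nat.factorization_mul hg (pow_ne_zero _ hp.ne_zero), Nat.Prime.factorization_pow hp,
    Finsupp.add_apply, Finsupp.single_apply]
  congr 1
  simp [eq_comm]

/-- The weight of an edge: a factor `1 + ε p` for every `p ∈ U` at which the valuations of the
two endpoints differ. -/
noncomputable def edgeWeight (ε : ℕ → ℝ) (U : Finset ℕ) (e : ℕ × ℕ) : ℝ :=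
  ∏ p ∈ U, if e.1.factorization p = e.2.factorization p then 1 else 1 + ε p

lemma edgeWeight_nonneg {ε : ℕ → ℝ} (h : ∀ p, 0 ≤ ε p) (U : Finset ℕ) (e : ℕ × ℕ) :
    0 ≤ edgeWeight ε U e :=
  Finset.prod_nonneg fun p _ => by
    have := h p
    split_ifs <;> linarith

lemma dvd_of_factorization_ge {a p k v : ℕ} (hp : p.Prime) (hpa : ¬ p ∣ a) (hv : 0 < v ∧ a ∣ v)
    (hk : k ≤ v.factorization p) : 0 < v ∧ a * p ^ k ∣ v := by
  refine ⟨hv.1, Nat.Coprime.mul_dvd_of_dvd_of_dvd ?_ hv.2 ?_⟩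
  · exact ((Nat.Prime.coprime_iff_not_dvd hp).mpr hpa).symm.pow_right k
  · exact (Nat.Prime.pow_dvd_iff_le_factorization hp hv.1.ne').mpr hk

set_option maxHeartbeats 4000000 in
theorem weighted_edge_sum_le {ψ : ℕ → ℝ} (hψ : ∀ n, 0 ≤ ψ n) {T : ℝ} (hT : 0 < T) {ε ρ : ℕ → ℝ}
    (he0 : ∀ p, 0 ≤ ε p) (he2 : ∀ p, ε p ≤ 2) (hρ0 : ∀ p, p.Prime → 0 < ρ p)
    (hρ : ∀ p, p.Prime → ρ p ^ 4 = (p : ℝ)⁻¹) (U : Finset ℕ) :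
    (∀ p ∈ U, p.Prime) → ∀ (a b g : ℕ) (V W : Finset ℕ) (E : Finset (ℕ × ℕ)),
    0 < a → 0 < b → 0 < g → E ⊆ V ×ˢ W → (∀ p ∈ U, ¬ p ∣ a ∧ ¬ p ∣ b ∧ ¬ p ∣ g) →
    (∀ v ∈ V, 0 < v ∧ a ∣ v) → (∀ w ∈ W, 0 < w ∧ b ∣ w) →
    (∀ e ∈ E, ∀ r, r.Prime → r ∉ U →
      min (e.1.factorization r) (e.2.factorization r) = g.factorization r) →
    (∀ e ∈ E, ψ e.1 * e.2 ≤ T * Nat.gcd e.1 e.2 ∧ ψ e.2 * e.1 ≤ T * Nat.gcd e.1 e.2) →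
    ∀ x y κ : ℝ, 0 ≤ x → 0 ≤ y → 0 ≤ κ →
    x ^ 4 = ∑ v ∈ V, ψ v * totientRatio v → y ^ 4 = ∑ w ∈ W, ψ w * totientRatio w →
    κ ^ 4 = 9 * T ^ 2 * (g : ℝ) ^ 2 * totientRatio a * totientRatio b / (a * b) →
    ∑ e ∈ E, (ψ e.1 * totientRatio e.1) * (ψ e.2 * totientRatio e.2) * edgeWeight ε U e ≤
      (∏ p ∈ U, (1 + 10 ^ 27 * (ρ p ^ 5 + ε p * ρ p ^ 4))) * (κ * x ^ 3 * y ^ 3) := by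
  induction U using Finset.induction_on with
  | empty =>
    intro _ a b g V W E ha hb hg hE _ hV hW hE2 hD x y κ hx hy hκ hxV hyW hκe
    simp only [edgeWeight, Finset.prod_empty, mul_one, one_mul]
    refine edge_sum_le_of_gcd_eq hψ hT ha hb hE hV hW (fun e he => ?_) hD hx hy hκ hxV hyW hκe
    obtain ⟨h1, h2⟩ := Finset.mem_product.mp (hE he)
    exact gcd_eq_of_forall_prime (hV _ h1).1.ne' (hW _ h2).1.ne' hg.ne'
      fun r hr => hE2 e he r hr (by simp)
  | insert p U hpU IH =>
    intro hU a b g V W E ha hb hg hE hUdvd hV hW hE2 hD x y κ hx hy hκ hxV hyW hκe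
    have hp : p.Prime := hU p (by simp)
    have hUp : ∀ q ∈ U, q.Prime := fun q hq => hU q (Finset.mem_insert_of_mem hq)
    replace IH := IH hUp
    obtain ⟨hpa, hpb, hpg⟩ := hUdvd p (by simp)
    have hm : ∀ v, 0 ≤ ψ v * totientRatio v :=
      fun v => mul_nonneg (hψ v) (totientRatio_nonneg v)
    set m : ℕ → ℝ := fun v => ψ v * totientRatio v with hmdef
    set P : ℝ := ∏ p ∈ U, (1 + 10 ^ 27 * (ρ p ^ 5 + ε p * ρ p ^ 4)) with hP
    have hPpos : 0 < P := Finset.prod_pos fun q hq => by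
      have h1 := hρ0 q (hUp q hq)
      have h2 := he0 q
      positivity
    have hρp := hρ0 p hp
    have hεp := he0 p
    have hRHS : 0 ≤ 1 + 10 ^ 27 * (ρ p ^ 5 + ε p * ρ p ^ 4) := by positivity
    rw [Finset.prod_insert hpU, ← hP]
    -- degenerate cases
    rcases hx.eq_or_lt with hx0 | hxpos
    · have h0 : ∀ v ∈ V, m v = 0 := by
        rw [← hx0] at hxV
        exact (Finset.sum_eq_zero_iff_of_nonneg fun v _ => hm v).mp (by rw [← hxV]; norm_num)
      rw [Finset.sum_eq_zero]
      · positivity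
      · intro e he
        have h1 := h0 _ (Finset.mem_product.mp (hE he)).1
        simp only [hmdef] at h1
        rw [h1]; ring
    rcases hy.eq_or_lt with hy0 | hypos
    · have h0 : ∀ v ∈ W, m v = 0 := by
        rw [← hy0] at hyW
        exact (Finset.sum_eq_zero_iff_of_nonneg fun v _ => hm v).mp (by rw [← hyW]; norm_num)
      rw [Finset.sum_eq_zero]
      · positivity
      · intro e he
        have h1 := h0 _ (Finset.mem_product.mp (hE he)).2
        simp only [hmdef] at h1
        rw [h1]; ring
    have hκpos : 0 < κ := by
      refine lt_of_le_of_ne hκ fun h => ?_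
      have h1 : 0 < 9 * T ^ 2 * (g : ℝ) ^ 2 * totientRatio a * totientRatio b / (a * b) := by
        have := totientRatio_pos ha
        have := totientRatio_pos hb
        positivity
      rw [← hκe, ← h] at h1
      norm_num at h1
    -- the parameter `γ`
    have hp2 : (2 : ℝ) ≤ p := by exact_mod_cast hp.two_le
    have hρhalf : ρ p ^ 4 ≤ 1 / 2 := by
      rw [hρ p hp, one_div]; exact inv_anti₀ (by norm_num) hp2
    obtain ⟨γ, hγ0, hγ⟩ := exists_fourth_root (t := 1 - ρ p ^ 4) (by linarith)
    set c : ℕ → ℝ := fun i => if i = 0 then 1 else γ with hc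
    have hc0 : ∀ i, 0 ≤ c i := fun i => by simp only [hc]; split_ifs <;> linarith
    set f : ℕ → ℕ := fun v => v.factorization p with hf
    set G : ℕ × ℕ → ℝ := fun e => m e.1 * m e.2 * edgeWeight ε U e with hG
    have hG0 : ∀ e, 0 ≤ G e := fun e =>
      mul_nonneg (mul_nonneg (hm _) (hm _)) (edgeWeight_nonneg he0 U e)
    -- the induction hypothesis on pieces
    have IH' : ∀ (i j : ℕ) (V' W' : Finset ℕ) (E' : Finset (ℕ × ℕ)), V' ⊆ V → W' ⊆ W → E' ⊆ E →
        E' ⊆ V' ×ˢ W' → (∀ v ∈ V', i ≤ f v) → (∀ w ∈ W', j ≤ f w) →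
        (∀ e ∈ E', min (f e.1) (f e.2) = min i j) → ∀ x' y' : ℝ, 0 ≤ x' → 0 ≤ y' →
        x' ^ 4 = ∑ v ∈ V', m v → y' ^ 4 = ∑ w ∈ W', m w →
        ∑ e ∈ E', G e ≤
          P * (κ * ρ p ^ ((i - j) + (j - i)) * (c i * c j) * x' ^ 3 * y' ^ 3) := by
      intro i j V' W' E' hV' hW' hE' hEVW hfi hfj hmin x' y' hx' hy' hxV' hyW'
      refine IH (a * p ^ i) (b * p ^ j) (g * p ^ min i j) V' W' E'
        (Nat.mul_pos ha (pow_pos hp.pos _)) (Nat.mul_pos hb (pow_pos hp.pos _))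
        (Nat.mul_pos hg (pow_pos hp.pos _)) hEVW ?_ ?_ ?_ ?_ (fun e he => hD e (hE' he)) x' y' _
        hx' hy' ?_ hxV' hyW' ?_
      · intro q hq
        obtain ⟨h1, h2, h3⟩ := hUdvd q (Finset.mem_insert_of_mem hq)
        have hqp : ∀ k, ¬ q ∣ p ^ k := fun k h => by
          have := (Nat.prime_dvd_prime_iff_eq (hUp q hq) hp).mp ((hUp q hq).dvd_of_dvd_pow h)
          exact hpU (this ▸ hq)
        refine ⟨fun h => ?_, fun h => ?_, fun h => ?_⟩
        · exact ((hUp q hq).dvd_mul.mp h).elim h1 (hqp _)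
        · exact ((hUp q hq).dvd_mul.mp h).elim h2 (hqp _)
        · exact ((hUp q hq).dvd_mul.mp h).elim h3 (hqp _)
      · exact fun v hv => dvd_of_factorization_ge hp hpa (hV v (hV' hv)) (hfi v hv)
      · exact fun v hv => dvd_of_factorization_ge hp hpb (hW v (hW' hv)) (hfj v hv)
      · intro e he r hr hrU
        rw [factorization_mul_prime_pow_apply hg.ne' hp]
        by_cases hrp : r = p
        · subst hrp
          rw [if_pos rfl, Nat.factorization_eq_zero_of_not_dvd hpg, zero_add]
          exact hmin e he
        · rw [if_neg hrp, add_zero]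
          exact hE2 e (hE' he) r hr (by simp [hrp, hrU])
      · have := hc0 i
        have := hc0 j
        positivity
      · exact kappa_pow_mul ha hb hp hpa hpb (hρ p hp) hγ hκe
    -- normalised sequences
    obtain ⟨n, hnV⟩ : ∃ n, ∀ e ∈ V ∪ W, f e < n :=
      ⟨(V ∪ W).sup f + 1, fun e he => Nat.lt_succ_of_le (Finset.le_sup he)⟩
    have hfE : ∀ e ∈ E, f e.1 < n ∧ f e.2 < n := fun e he => by
      obtain ⟨h1, h2⟩ := Finset.mem_product.mp (hE he)
      exact ⟨hnV _ (Finset.mem_union_left _ h1), hnV _ (Finset.mem_union_right _ h2)⟩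
    have hx4 : 0 < x ^ 4 := by positivity
    have hy4 : 0 < y ^ 4 := by positivity
    choose ξ hξ0 hξ using fun i : ℕ => exists_fourth_root
      (t := (∑ v ∈ V.filter (f · = i), m v) / x ^ 4)
      (div_nonneg (Finset.sum_nonneg fun v _ => hm v) hx4.le)
    choose η hη0 hη using fun i : ℕ => exists_fourth_root
      (t := (∑ v ∈ W.filter (f · = i), m v) / y ^ 4)
      (div_nonneg (Finset.sum_nonneg fun v _ => hm v) hy4.le)
    have sumV : ∀ (Q : ℕ → Prop) [DecidablePred Q],
        ∑ i ∈ Finset.range n, (if Q i then ξ i ^ 4 else 0) =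
          (∑ v ∈ V.filter (fun v => Q (f v)), m v) / x ^ 4 := by
      intro Q _
      rw [← sum_filter_fiberwise (n := n) (fun v hv => hnV v (Finset.mem_union_left _ hv)),
        Finset.sum_div]
      refine Finset.sum_congr rfl fun i _ => ?_
      split_ifs
      · exact hξ i
      · simp
    have sumW : ∀ (Q : ℕ → Prop) [DecidablePred Q],
        ∑ i ∈ Finset.range n, (if Q i then η i ^ 4 else 0) =
          (∑ v ∈ W.filter (fun v => Q (f v)), m v) / y ^ 4 := by
      intro Q _
      rw [← sum_filter_fiberwise (n := n) (fun v hv => hnV v (Finset.mem_union_right _ hv)),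
        Finset.sum_div]
      refine Finset.sum_congr rfl fun i _ => ?_
      split_ifs
      · exact hη i
      · simp
    set K : ℝ := P * (κ * x ^ 3 * y ^ 3) with hK
    have hKpos : 0 < K := by positivity
    set S : ℕ → ℕ → ℝ := fun i j =>
      ∑ e ∈ E.filter (fun e => f e.1 = i ∧ f e.2 = j), G e with hS
    have key := two_sequence_bound hρp hρhalf hεp (he2 p) n (fun i j => S i j / K) ξ η hξ0 hη0
      ?_ ?_ hγ0 hγ ?_ ?_ ?_
    · have e1 : ∑ e ∈ E, (ψ e.1 * totientRatio e.1) * (ψ e.2 * totientRatio e.2) *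
          edgeWeight ε (insert p U) e =
          ∑ e ∈ E, (if f e.1 = f e.2 then 1 else 1 + ε p) * G e := by
        refine Finset.sum_congr rfl fun e _ => ?_
        simp only [hG, edgeWeight, Finset.prod_insert hpU, hf, hmdef]
        ring
      rw [e1, sum_edges_fiberwise hfE (fun i j => if i = j then 1 else 1 + ε p)]
      have e2 : ∑ i ∈ Finset.range n, ∑ j ∈ Finset.range n,
          (if i = j then 1 else 1 + ε p) * (S i j / K) =
          (∑ i ∈ Finset.range n, ∑ j ∈ Finset.range n,
            (if i = j then 1 else 1 + ε p) * S i j) / K := by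
        simp only [Finset.sum_div, mul_div_assoc]
      rw [e2, div_le_iff₀ hKpos] at key
      rw [mul_assoc]
      exact key
    · have := sumV (fun _ => True)
      simp only [if_true, Finset.filter_true] at this
      rw [this, ← hxV, div_self hx4.ne']
    · have := sumW (fun _ => True)
      simp only [if_true, Finset.filter_true] at this
      rw [this, ← hyW, div_self hy4.ne']
    · exact fun i j => div_nonneg (Finset.sum_nonneg fun e _ => hG0 e) hKpos.le
    · intro i j
      rw [div_le_iff₀ hKpos]
      have h1 := IH' i j (V.filter (f · = i)) (W.filter (f · = j))
        (E.filter (fun e => f e.1 = i ∧ f e.2 = j)) (Finset.filter_subset _ _)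
        (Finset.filter_subset _ _) (Finset.filter_subset _ _) ?_
        (fun v hv => (Finset.mem_filter.mp hv).2.ge) (fun v hv => (Finset.mem_filter.mp hv).2.ge)
        ?_ (ξ i * x) (η j * y) (mul_nonneg (hξ0 i) hx) (mul_nonneg (hη0 j) hy) ?_ ?_
      · refine h1.trans (le_of_eq ?_)
        simp only [hK]
        ring
      · intro e he
        obtain ⟨h1, h2, h3⟩ := Finset.mem_filter.mp he
        obtain ⟨h4, h5⟩ := Finset.mem_product.mp (hE h1)
        simp [h4, h5, h2, h3]
      · intro e he
        obtain ⟨h1, h2, h3⟩ := Finset.mem_filter.mp he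
        rw [h2, h3]
      · rw [mul_pow, hξ, div_mul_cancel₀ _ hx4.ne']
      · rw [mul_pow, hη, div_mul_cancel₀ _ hy4.ne']
    · intro k x' y' hx' hy' hxk hyk
      rw [sumV] at hxk
      rw [sumW] at hyk
      have h1 := IH' k k (V.filter (fun v => k ≤ f v)) (W.filter (fun v => k ≤ f v))
        (E.filter (fun e => min (f e.1) (f e.2) = k)) (Finset.filter_subset _ _)
        (Finset.filter_subset _ _) (Finset.filter_subset _ _) ?_
        (fun v hv => (Finset.mem_filter.mp hv).2) (fun v hv => (Finset.mem_filter.mp hv).2)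
        (fun e he => by rw [(Finset.mem_filter.mp he).2, min_self])
        (x' * x) (y' * y) (mul_nonneg hx' hx) (mul_nonneg hy' hy) ?_ ?_
      · have e1 : ∑ i ∈ Finset.range n, ∑ j ∈ Finset.range n,
            (if min i j = k then S i j / K else 0) =
            (∑ e ∈ E.filter (fun e => min (f e.1) (f e.2) = k), G e) / K := by
          have h2 := sum_edges_fiberwise hfE
            (fun i j => if min i j = k then (1 : ℝ) else 0) G
          rw [Finset.sum_filter]
          simp only [ite_mul, one_mul, zero_mul] at h2
          rw [h2]
          simp only [Finset.sum_div]
          refine Finset.sum_congr rfl fun i _ => Finset.sum_congr rfl fun j _ => ?_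
          split_ifs
          · simp only [hS, Finset.sum_div]
          · simp
        rw [e1, div_le_iff₀ hKpos]
        refine h1.trans (le_of_eq ?_)
        have e2 : c k * c k = if k = 0 then 1 else γ ^ 2 := by
          simp only [hc]; split_ifs <;> ring
        rw [e2]
        simp only [hK, Nat.sub_self, add_zero, pow_zero]
        ring
      · intro e he
        obtain ⟨h1, h2⟩ := Finset.mem_filter.mp he
        obtain ⟨h4, h5⟩ := Finset.mem_product.mp (hE h1)
        simp only [Finset.mem_product, Finset.mem_filter]
        exact ⟨⟨h4, h2 ▸ min_le_left _ _⟩, h5, h2 ▸ min_le_right _ _⟩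
      · rw [mul_pow, hxk, div_mul_cancel₀ _ hx4.ne']
      · rw [mul_pow, hyk, div_mul_cancel₀ _ hy4.ne']

/-! ### Pairs whose quotient has many medium-sized prime factors -/

/-- The primes at which the valuations of `q` and `r` differ. -/
noncomputable def diffPrimes (q r : ℕ) : Finset ℕ :=
  (q * r).primeFactors.filter fun p => q.factorization p ≠ r.factorization p

lemma sum_inv_sq_le (U : Finset ℕ) (j : ℕ) :
    ∑ p ∈ U.filter (j < ·), (j : ℝ) / (p : ℝ) ^ 2 ≤ 2 := by
  rcases j.eq_zero_or_pos with rfl | hj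
  · simp
  have h1 : U.filter (j < ·) ⊆ Finset.Ioc j (U.sup id + j + 1) := by
    intro p hp
    obtain ⟨h1, h2⟩ := Finset.mem_filter.mp hp
    have : p ≤ U.sup id := Finset.le_sup (f := id) h1
    simp only [Finset.mem_Ioc]
    omega
  have hj0 : (0 : ℝ) < j := by exact_mod_cast hj
  calc ∑ p ∈ U.filter (j < ·), (j : ℝ) / (p : ℝ) ^ 2
      ≤ ∑ p ∈ Finset.Ioc j (U.sup id + j + 1), (j : ℝ) / (p : ℝ) ^ 2 :=
        Finset.sum_le_sum_of_subset_of_nonneg h1 fun p _ _ => by positivity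
    _ = j * ∑ p ∈ Finset.Ioc j (U.sup id + j + 1), ((p : ℝ) ^ 2)⁻¹ := by
        rw [Finset.mul_sum]; rfl
    _ ≤ j * ((j : ℝ)⁻¹ - ((U.sup id + j + 1 : ℕ) : ℝ)⁻¹) := by
        gcongr
        exact sum_Ioc_inv_sq_le_sub hj.ne' (by omega)
    _ ≤ j * (j : ℝ)⁻¹ := by
        gcongr
        have : (0 : ℝ) ≤ ((U.sup id + j + 1 : ℕ) : ℝ)⁻¹ := by positivity
        linarith
    _ ≤ 2 := by rw [mul_inv_cancel₀ hj0.ne']; norm_num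

theorem exists_bad_pairs_bound : ∃ C : ℝ, 0 < C ∧ ∀ (ψ : ℕ → ℝ) (Q : Finset ℕ) (j : ℕ)
    (E : Finset (ℕ × ℕ)), (∀ n, 0 ≤ ψ n) → (∀ q ∈ Q, 0 < q) →
    ∑ q ∈ Q, ψ q * totientRatio q ≤ 2 → E ⊆ Q ×ˢ Q →
    (∀ e ∈ E, ψ e.1 * e.2 ≤ 4 ^ j * Nat.gcd e.1 e.2 ∧ ψ e.2 * e.1 ≤ 4 ^ j * Nat.gcd e.1 e.2) →
    (∀ e ∈ E, 2 ≤ ∑ p ∈ (diffPrimes e.1 e.2).filter (j < ·), (p : ℝ)⁻¹) →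
    ∑ e ∈ E, (ψ e.1 * totientRatio e.1) * (ψ e.2 * totientRatio e.2) ≤
      C * (2 * Real.exp (-2)) ^ j := by
  set ρ : ℕ → ℝ := fun p => (p : ℝ) ^ (-(1 / 4) : ℝ) with hρdef
  have hsum : Summable fun p : ℕ => ρ p ^ 5 := by
    have h : (fun p : ℕ => ρ p ^ 5) = fun p : ℕ => (p : ℝ) ^ (-(5 / 4) : ℝ) := by
      funext p
      simp only [hρdef]
      rw [← Real.rpow_mul_natCast (by positivity)]
      norm_num
    rw [h]
    exact Real.summable_nat_rpow.mpr (by norm_num)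
  set S := ∑' p : ℕ, ρ p ^ 5 with hS
  refine ⟨6 * Real.exp (10 ^ 27 * (S + 4)), by positivity, ?_⟩
  intro ψ Q j E hψ hQ hQ2 hE hD hE2
  set ε : ℕ → ℝ := fun p => if j < p then Real.exp (j / p) - 1 else 0 with hε
  have hjp : ∀ p : ℕ, j < p → |(j : ℝ) / p| ≤ 1 ∧ 0 ≤ (j : ℝ) / p := by
    intro p hp
    have h1 : (j : ℝ) ≤ p := by exact_mod_cast hp.le
    have h2 : (0 : ℝ) ≤ (j : ℝ) / p := by positivity
    exact ⟨by rw [abs_of_nonneg h2]; exact div_le_one_of_le₀ h1 (by positivity), h2⟩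
  have he0 : ∀ p, 0 ≤ ε p := by
    intro p
    simp only [hε]
    split_ifs with h
    · have := Real.one_le_exp (hjp p h).2
      linarith
    · exact le_rfl
  have hej : ∀ p, j < p → ε p ≤ 2 * (j / p) := by
    intro p h
    simp only [hε, if_pos h]
    have h1 := Real.abs_exp_sub_one_le (hjp p h).1
    rw [abs_of_nonneg (hjp p h).2] at h1
    exact (le_abs_self _).trans h1
  have he2 : ∀ p, ε p ≤ 2 := by
    intro p
    by_cases h : j < p
    · have h1 := hej p h
      have h2 := (hjp p h).1
      rw [abs_of_nonneg (hjp p h).2] at h2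
      linarith
    · simp [hε, if_neg h]
  have hρ0 : ∀ p, p.Prime → 0 < ρ p := fun p hp =>
    Real.rpow_pos_of_pos (by exact_mod_cast hp.pos) _
  have hρ4 : ∀ p, p.Prime → ρ p ^ 4 = (p : ℝ)⁻¹ := fun p hp => by
    simp only [hρdef]
    rw [← Real.rpow_mul_natCast (by positivity)]
    norm_num [Real.rpow_neg_one]
  set U := Q.biUnion Nat.primeFactors with hU
  have hUp : ∀ p ∈ U, p.Prime := fun p hp => by
    obtain ⟨q, _, h⟩ := Finset.mem_biUnion.mp hp
    exact Nat.prime_of_mem_primeFactors h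
  have hμ0 : 0 ≤ ∑ q ∈ Q, ψ q * totientRatio q :=
    Finset.sum_nonneg fun q _ => mul_nonneg (hψ q) (totientRatio_nonneg q)
  obtain ⟨x, hx0, hx⟩ := exists_fourth_root hμ0
  obtain ⟨κ, hκ0, hκ⟩ := exists_fourth_root (t := 9 * ((4 : ℝ) ^ j) ^ 2) (by positivity)
  have key := weighted_edge_sum_le hψ (T := 4 ^ j) (by positivity) he0 he2 hρ0 hρ4 U hUp 1 1 1 Q Q E
    one_pos one_pos one_pos hE
    (fun p hp => by simp [(hUp p hp).ne_one])
    (fun q hq => ⟨hQ q hq, one_dvd _⟩) (fun q hq => ⟨hQ q hq, one_dvd _⟩)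
    (fun e he r hr hrU => by
      have h1 := (Finset.mem_product.mp (hE he)).1
      have h2 : ¬ r ∣ e.1 := fun h => hrU
        (Finset.mem_biUnion.mpr ⟨_, h1, Nat.mem_primeFactors.mpr ⟨hr, h, (hQ _ h1).ne'⟩⟩)
      rw [Nat.factorization_eq_zero_of_not_dvd h2]
      simp)
    hD x x κ hx0 hx0 hκ0 hx hx (by rw [hκ]; simp [totientRatio])
  -- bound for the Euler product
  have hprod : ∏ p ∈ U, (1 + 10 ^ 27 * (ρ p ^ 5 + ε p * ρ p ^ 4)) ≤
      Real.exp (10 ^ 27 * (S + 4)) := by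
    calc ∏ p ∈ U, (1 + 10 ^ 27 * (ρ p ^ 5 + ε p * ρ p ^ 4))
        ≤ ∏ p ∈ U, Real.exp (10 ^ 27 * (ρ p ^ 5 + ε p * ρ p ^ 4)) := by
          refine Finset.prod_le_prod (fun p hp => ?_) fun p _ => ?_
          · have := hρ0 p (hUp p hp)
            have := he0 p
            positivity
          · rw [add_comm]; exact Real.add_one_le_exp _
      _ = Real.exp (10 ^ 27 * (∑ p ∈ U, ρ p ^ 5 + ∑ p ∈ U, ε p * ρ p ^ 4)) := by
          rw [← Real.exp_sum, ← Finset.mul_sum, Finset.sum_add_distrib]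
      _ ≤ _ := by
          have h1 : ∑ p ∈ U, ρ p ^ 5 ≤ S :=
            hsum.sum_le_tsum _ fun p _ => by simp only [hρdef]; positivity
          have h2 : ∑ p ∈ U, ε p * ρ p ^ 4 ≤ 2 * ∑ p ∈ U.filter (j < ·), (j : ℝ) / (p : ℝ) ^ 2 := by
            rw [Finset.mul_sum, Finset.sum_filter]
            refine Finset.sum_le_sum fun p hp => ?_
            rw [hρ4 p (hUp p hp)]
            split_ifs with h
            · calc ε p * (p : ℝ)⁻¹ ≤ 2 * (j / p) * (p : ℝ)⁻¹ := by
                    gcongr; exact hej p h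
                _ = _ := by rw [sq, div_mul_eq_div_div, div_eq_mul_inv _ (p : ℝ)]; ring
            · simp [hε, if_neg h]
          have h3 := sum_inv_sq_le U j
          gcongr
          linarith
  -- lower bound for the weights
  have hw : ∀ e ∈ E, Real.exp 2 ^ j ≤ edgeWeight ε U e := by
    intro e he
    obtain ⟨h1, h2⟩ := Finset.mem_product.mp (hE he)
    have hfil : (diffPrimes e.1 e.2).filter (j < ·) =
        (U.filter fun p => ¬ e.1.factorization p = e.2.factorization p).filter (j < ·) := by
      ext p
      simp only [diffPrimes, Finset.mem_filter, and_congr_left_iff, Nat.mem_primeFactors]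
      intro _ hne
      constructor
      · rintro ⟨hp, hd, _⟩
        rcases hp.dvd_mul.mp hd with h | h
        · exact Finset.mem_biUnion.mpr ⟨_, h1, Nat.mem_primeFactors.mpr ⟨hp, h, (hQ _ h1).ne'⟩⟩
        · exact Finset.mem_biUnion.mpr ⟨_, h2, Nat.mem_primeFactors.mpr ⟨hp, h, (hQ _ h2).ne'⟩⟩
      · intro hp
        refine ⟨hUp p hp, ?_, mul_ne_zero (hQ _ h1).ne' (hQ _ h2).ne'⟩
        by_contra hd
        rw [(hUp p hp).dvd_mul, not_or] at hd
        rw [Nat.factorization_eq_zero_of_not_dvd hd.1,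
          Nat.factorization_eq_zero_of_not_dvd hd.2] at hne
        exact hne rfl
    have hE2e := hE2 e he
    rw [hfil] at hE2e
    have e1 : edgeWeight ε U e = Real.exp (j *
        ∑ p ∈ (U.filter fun p => ¬ e.1.factorization p = e.2.factorization p).filter (j < ·),
          (p : ℝ)⁻¹) := by
      rw [edgeWeight, Finset.mul_sum, Real.exp_sum, Finset.prod_filter, Finset.prod_filter]
      refine Finset.prod_congr rfl fun p _ => ?_
      simp only [hε]
      split_ifs <;> simp_all [div_eq_mul_inv]
    rw [e1, ← Real.exp_nat_mul]
    gcongr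
  have hsum2 : Real.exp 2 ^ j * ∑ e ∈ E, (ψ e.1 * totientRatio e.1) * (ψ e.2 * totientRatio e.2) ≤
      Real.exp (10 ^ 27 * (S + 4)) * (κ * x ^ 3 * x ^ 3) := by
    refine le_trans ?_ (key.trans (mul_le_mul_of_nonneg_right hprod (by positivity)))
    rw [Finset.mul_sum]
    refine Finset.sum_le_sum fun e he => ?_
    rw [mul_comm]
    exact mul_le_mul_of_nonneg_left (hw e he) (mul_nonneg
      (mul_nonneg (hψ _) (totientRatio_nonneg _)) (mul_nonneg (hψ _) (totientRatio_nonneg _)))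
  have hκle : κ ≤ 2 * 2 ^ j := by
    refine le_of_pow_le_pow_left₀ (n := 4) (by norm_num) (by positivity) ?_
    rw [hκ]
    have : (4 : ℝ) ^ j = (2 ^ j) ^ 2 := by rw [← pow_mul, mul_comm, pow_mul]; norm_num
    rw [this]
    have h1 : (0:ℝ) ≤ (2 ^ j) ^ 4 := by positivity
    nlinarith
  have hxle : x ^ 3 * x ^ 3 ≤ 3 := by
    rw [← hx] at hQ2
    have h1 : (x ^ 3 * x ^ 3) ^ 2 ≤ 9 := by
      calc (x ^ 3 * x ^ 3) ^ 2 = (x ^ 4) ^ 3 := by ring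
        _ ≤ 2 ^ 3 := by gcongr
        _ ≤ 9 := by norm_num
    nlinarith [pow_nonneg hx0 3]
  have hexp : 0 < Real.exp 2 ^ j := by positivity
  have hinv : (2 * Real.exp (-2)) ^ j = 2 ^ j / Real.exp 2 ^ j := by
    rw [mul_pow, Real.exp_neg, inv_pow]; rfl
  rw [hinv, ← mul_div_assoc, le_div_iff₀ hexp, mul_comm]
  refine hsum2.trans ?_
  calc Real.exp (10 ^ 27 * (S + 4)) * (κ * x ^ 3 * x ^ 3)
      = Real.exp (10 ^ 27 * (S + 4)) * (κ * (x ^ 3 * x ^ 3)) := by ring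
    _ ≤ Real.exp (10 ^ 27 * (S + 4)) * (2 * 2 ^ j * 3) := by gcongr
    _ = _ := by ring

/-! ### Sums of products of periodic functions -/

lemma sum_range_mul_of_coprime {m n : ℕ} (hm : 0 < m) (hn : 0 < n) (h : m.Coprime n) {u v : ℕ → ℝ}
    (hu : Function.Periodic u m) (hv : Function.Periodic v n) :
    ∑ k ∈ Finset.range (m * n), u k * v k =
      (∑ k ∈ Finset.range m, u k) * ∑ k ∈ Finset.range n, v k := by
  rw [Finset.sum_mul_sum, ← Finset.sum_product']
  refine Finset.sum_nbij' (fun k => (k % m, k % n)) (fun x => Nat.chineseRemainder h x.1 x.2)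
    ?_ ?_ ?_ ?_ ?_
  · intro k _
    simp [Nat.mod_lt _ hm, Nat.mod_lt _ hn]
  · intro x _
    simpa using Nat.chineseRemainder_lt_mul h x.1 x.2 hm.ne' hn.ne'
  · intro k hk
    have h1 := (Nat.chineseRemainder h (k % m) (k % n)).prop
    refine Nat.ModEq.eq_of_lt_of_lt ?_ (Nat.chineseRemainder_lt_mul h _ _ hm.ne' hn.ne')
      (Finset.mem_range.mp hk)
    rw [← Nat.modEq_and_modEq_iff_modEq_mul h]
    exact ⟨h1.1.trans (Nat.mod_modEq _ _), h1.2.trans (Nat.mod_modEq _ _)⟩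
  · intro x hx
    simp only [Finset.mem_product, Finset.mem_range] at hx
    have h1 := (Nat.chineseRemainder h x.1 x.2).prop
    exact Prod.ext (Nat.mod_eq_of_modEq h1.1 hx.1) (Nat.mod_eq_of_modEq h1.2 hx.2)
  · intro k _
    simp only
    rw [hu.map_mod_nat, hv.map_mod_nat]

lemma sum_range_mul_periodic {m : ℕ} {u : ℕ → ℝ} (hu : Function.Periodic u m) (t : ℕ) :
    ∑ k ∈ Finset.range (m * t), u k = t * ∑ k ∈ Finset.range m, u k := by
  induction t with
  | zero => simp
  | succ t ih =>
    rw [Nat.mul_succ, Finset.sum_range_add, ih]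
    have : ∀ k, u (m * t + k) = u k := fun k => by
      rw [add_comm, mul_comm]; exact hu.nat_mul t k
    simp only [this]
    push_cast
    ring

lemma periodic_prod {S : Finset ℕ} {w : ℕ → ℕ → ℝ} (hw : ∀ p ∈ S, Function.Periodic (w p) p) :
    Function.Periodic (fun k => ∏ p ∈ S, w p k) (∏ p ∈ S, p) := by
  intro k
  refine Finset.prod_congr rfl fun p hp => ?_
  obtain ⟨c, hc⟩ := Finset.dvd_prod_of_mem (fun p => p) hp
  rw [hc, mul_comm]
  exact (hw p hp).nat_mul c k

lemma sum_range_prod_periodic {S : Finset ℕ} {w : ℕ → ℕ → ℝ} (hS : ∀ p ∈ S, p.Prime)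
    (hw : ∀ p ∈ S, Function.Periodic (w p) p) :
    ∑ k ∈ Finset.range (∏ p ∈ S, p), ∏ p ∈ S, w p k = ∏ p ∈ S, ∑ k ∈ Finset.range p, w p k := by
  induction S using Finset.induction_on with
  | empty => simp
  | insert p S hp ih =>
    have hS' : ∀ q ∈ S, q.Prime := fun q hq => hS q (Finset.mem_insert_of_mem hq)
    have hw' : ∀ q ∈ S, Function.Periodic (w q) q := fun q hq => hw q (Finset.mem_insert_of_mem hq)
    have hpp := hS p (Finset.mem_insert_self _ _)
    simp only [Finset.prod_insert hp]
    rw [sum_range_mul_of_coprime hpp.pos (Finset.prod_pos fun q hq => (hS' q hq).pos) ?_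
      (hw p (Finset.mem_insert_self _ _)) (periodic_prod hw'), ih hS' hw']
    refine Nat.Coprime.prod_right fun q hq => ?_
    exact (Nat.coprime_primes hpp (hS' q hq)).mpr fun h => hp (h ▸ hq)

/-- The average of a product of functions with distinct prime periods is the product of the
averages. -/
lemma sum_range_prod_eq_mul_prod_avg {S : Finset ℕ} {w : ℕ → ℕ → ℝ} (hS : ∀ p ∈ S, p.Prime)
    (hw : ∀ p ∈ S, Function.Periodic (w p) p) {g : ℕ} (hg : ∏ p ∈ S, p ∣ g) :
    ∑ k ∈ Finset.range g, ∏ p ∈ S, w p k =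
      g * ∏ p ∈ S, ((∑ k ∈ Finset.range p, w p k) / p) := by
  obtain ⟨t, rfl⟩ := hg
  rw [sum_range_mul_periodic (periodic_prod hw), sum_range_prod_periodic hS hw,
    Finset.prod_div_distrib]
  have : ∏ p ∈ S, (p : ℝ) ≠ 0 :=
    Finset.prod_ne_zero_iff.mpr fun p hp => by exact_mod_cast (hS p hp).ne_zero
  push_cast
  field_simp

/-- A non-degenerate linear congruence modulo a prime has exactly one solution. -/
lemma exists_unique_linear_root {p : ℕ} (hp : p.Prime) {a : ℕ} (ha : ¬ p ∣ a) (m : ℤ) :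
    ∃ k0 ∈ Finset.range p, ∀ k ∈ Finset.range p, ((p : ℤ) ∣ m + a * k ↔ k = k0) := by
  have hpi : Prime (p : ℤ) := Nat.prime_iff_prime_int.mp hp
  have inj : ∀ k ∈ Finset.range p, ∀ l ∈ Finset.range p, (p : ℤ) ∣ m + a * k →
      (p : ℤ) ∣ m + a * l → k = l := by
    intro k hk l hl h1 h2
    have h3 : (p : ℤ) ∣ a * ((k : ℤ) - l) := by
      have := dvd_sub h1 h2
      rwa [show m + a * k - (m + a * l) = (a : ℤ) * ((k : ℤ) - l) by ring] at this
    have h4 : (p : ℤ) ∣ (k : ℤ) - l :=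
      (hpi.dvd_or_dvd h3).resolve_left fun h => ha (by exact_mod_cast h)
    have h5 : (l : ℤ) ≡ k [ZMOD p] := (Int.modEq_iff_dvd).mpr h4
    have h6 : l ≡ k [MOD p] := (Int.natCast_modEq_iff).mp h5
    exact (Nat.ModEq.eq_of_lt_of_lt h6 (Finset.mem_range.mp hl) (Finset.mem_range.mp hk)).symm
  obtain ⟨k, hk, hd⟩ : ∃ k ∈ Finset.range p, (p : ℤ) ∣ m + a * k := by
    have hc : IsCoprime (a : ℤ) p :=
      Nat.isCoprime_iff_coprime.mpr ((Nat.Prime.coprime_iff_not_dvd hp).mpr ha).symm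
    obtain ⟨u, v, huv⟩ := hc
    have hp0 : (0 : ℤ) < p := by exact_mod_cast hp.pos
    refine ⟨((-m * u) % p).toNat, ?_, ?_⟩
    · rw [Finset.mem_range]
      have := Int.emod_lt_of_pos (-m * u) hp0
      have := Int.emod_nonneg (-m * u) hp0.ne'
      omega
    · rw [Int.toNat_of_nonneg (Int.emod_nonneg _ hp0.ne'), Int.emod_def]
      exact ⟨m * v - a * (-m * u / p), by linear_combination (-m) * huv⟩
  exact ⟨k, hk, fun l hl => ⟨fun h => inj l hl k hk h hd, fun h => h ▸ hd⟩⟩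

/-! ### Counting coprime residues with a prescribed difference -/

lemma sum_range_avoid_roots_le {p a b : ℕ} (hp : p.Prime) (hab : a.Coprime b) {m n h : ℤ}
    (hmn : (p : ℤ) ∣ m * b - n * a - h) :
    (∑ k ∈ Finset.range p,
      (if (p : ℤ) ∣ m + a * k ∨ (p : ℤ) ∣ n + b * k then (0 : ℝ) else 1)) / p ≤
      if p ∣ a ∨ p ∣ b ∨ (p : ℤ) ∣ h then 1 - (p : ℝ)⁻¹ else (1 - (p : ℝ)⁻¹) ^ 2 := by
  have hp0 : (0 : ℝ) < p := by exact_mod_cast hp.pos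
  have e1 : ∑ k ∈ Finset.range p,
      (if (p : ℤ) ∣ m + a * k ∨ (p : ℤ) ∣ n + b * k then (0 : ℝ) else 1) =
      p - ((Finset.range p).filter
        fun k : ℕ => (p : ℤ) ∣ m + a * k ∨ (p : ℤ) ∣ n + b * k).card := by
    have h2 : ∀ k ∈ Finset.range p,
        (if (p : ℤ) ∣ m + a * k ∨ (p : ℤ) ∣ n + b * k then (0 : ℝ) else 1) =
        1 - (if (p : ℤ) ∣ m + a * k ∨ (p : ℤ) ∣ n + b * k then (1 : ℝ) else 0) := by
      intro k _; split_ifs <;> norm_num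
    rw [Finset.sum_congr rfl h2, Finset.sum_sub_distrib, Finset.sum_boole]
    simp
  rw [e1, sub_div, div_self hp0.ne']
  set B := (Finset.range p).filter fun k : ℕ => (p : ℤ) ∣ m + a * k ∨ (p : ℤ) ∣ n + b * k with hB
  have hone : (p : ℝ)⁻¹ ≤ B.card / p := by
    rw [inv_eq_one_div]
    gcongr
    have : 0 < B.card := by
      rw [Finset.card_pos]
      by_cases ha : p ∣ a
      · have hb : ¬ p ∣ b := fun hb => hp.one_lt.ne' (Nat.dvd_one.mp (hab ▸ Nat.dvd_gcd ha hb))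
        obtain ⟨k, hk, hk'⟩ := exists_unique_linear_root hp hb n
        exact ⟨k, Finset.mem_filter.mpr ⟨hk, Or.inr ((hk' k hk).mpr rfl)⟩⟩
      · obtain ⟨k, hk, hk'⟩ := exists_unique_linear_root hp ha m
        exact ⟨k, Finset.mem_filter.mpr ⟨hk, Or.inl ((hk' k hk).mpr rfl)⟩⟩
    exact_mod_cast this
  split_ifs with hc
  · linarith
  · push Not at hc
    obtain ⟨ha, hb, hh⟩ := hc
    obtain ⟨k, hk, hk'⟩ := exists_unique_linear_root hp ha m
    obtain ⟨l, hl, hl'⟩ := exists_unique_linear_root hp hb n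
    have hkl : k ≠ l := by
      rintro rfl
      apply hh
      have h1 := (hk' k hk).mpr rfl
      have h2 := (hl' k hl).mpr rfl
      have h3 := dvd_sub (dvd_sub (dvd_mul_of_dvd_left h1 b) (dvd_mul_of_dvd_left h2 a)) hmn
      have h4 : (m + a * k) * b - (n + b * k) * a - (m * b - n * a - h) = h := by ring
      rwa [h4] at h3
    have h2 : ({k, l} : Finset ℕ) ⊆ B := by
      intro x hx
      simp only [Finset.mem_insert, Finset.mem_singleton] at hx
      rcases hx with rfl | rfl
      · exact Finset.mem_filter.mpr ⟨hk, Or.inl ((hk' x hk).mpr rfl)⟩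
      · exact Finset.mem_filter.mpr ⟨hl, Or.inr ((hl' x hl).mpr rfl)⟩
    have h3 := Finset.card_le_card h2
    rw [Finset.card_pair hkl] at h3
    have h4 : 2 * (p : ℝ)⁻¹ ≤ B.card / p := by
      rw [← div_eq_mul_inv]
      gcongr
      exact_mod_cast h3
    nlinarith [sq_nonneg (p : ℝ)⁻¹]

/-- The product `∏ (1 - 1/p)` over a finite set. -/
noncomputable def eulerProd (S : Finset ℕ) : ℝ := ∏ p ∈ S, (1 - (p : ℝ)⁻¹)

lemma eulerProd_pos {S : Finset ℕ} (hS : ∀ p ∈ S, p.Prime) : 0 < eulerProd S :=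
  Finset.prod_pos fun p hp => one_sub_inv_prime_pos (hS p hp)

lemma eulerProd_eq_of_subset {S Z : Finset ℕ} (h : S ⊆ Z) :
    eulerProd S = ∏ p ∈ Z, if p ∈ S then 1 - (p : ℝ)⁻¹ else 1 := by
  rw [Finset.prod_ite_mem, Finset.inter_eq_right.mpr h, eulerProd]

lemma prod_local_factor_le {a b g h : ℕ} (ha : 0 < a) (hb : 0 < b) (hg : 0 < g) (hh : 0 < h)
    (hab : a.Coprime b) :
    ∏ p ∈ g.primeFactors,
      (if p ∣ a ∨ p ∣ b ∨ p ∣ h then 1 - (p : ℝ)⁻¹ else (1 - (p : ℝ)⁻¹) ^ 2) ≤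
      totientRatio (g * a) * totientRatio (g * b) * (eulerProd (a * b).primeFactors)⁻¹ *
        (eulerProd h.primeFactors)⁻¹ := by
  have hpr : ∀ n : ℕ, ∀ p ∈ n.primeFactors, p.Prime :=
    fun n p hp => Nat.prime_of_mem_primeFactors hp
  rw [← div_eq_mul_inv, ← div_eq_mul_inv, le_div_iff₀ (eulerProd_pos (hpr _)),
    le_div_iff₀ (eulerProd_pos (hpr _)), totientRatio_eq_prod (Nat.mul_pos hg ha),
    totientRatio_eq_prod (Nat.mul_pos hg hb)]
  change _ ≤ eulerProd _ * eulerProd _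
  set Z := g.primeFactors ∪ a.primeFactors ∪ b.primeFactors ∪ h.primeFactors with hZ
  rw [Nat.primeFactors_mul hg.ne' ha.ne', Nat.primeFactors_mul hg.ne' hb.ne',
    Nat.primeFactors_mul ha.ne' hb.ne']
  have s0 : g.primeFactors ⊆ Z := by intro p; simp only [hZ, Finset.mem_union]; tauto
  rw [eulerProd_eq_of_subset (S := h.primeFactors) (Z := Z)
      (by intro p; simp only [hZ, Finset.mem_union]; tauto),
    eulerProd_eq_of_subset (S := a.primeFactors ∪ b.primeFactors) (Z := Z)
      (by intro p; simp only [hZ, Finset.mem_union]; tauto),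
    eulerProd_eq_of_subset (S := g.primeFactors ∪ a.primeFactors) (Z := Z)
      (by intro p; simp only [hZ, Finset.mem_union]; tauto),
    eulerProd_eq_of_subset (S := g.primeFactors ∪ b.primeFactors) (Z := Z)
      (by intro p; simp only [hZ, Finset.mem_union]; tauto),
    ← Finset.inter_eq_right.mpr s0, ← Finset.prod_ite_mem, Finset.inter_eq_right.mpr s0,
    ← Finset.prod_mul_distrib, ← Finset.prod_mul_distrib, ← Finset.prod_mul_distrib]
  have hpZ : ∀ p ∈ Z, p.Prime := by
    intro p hp
    simp only [hZ, Finset.mem_union] at hp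
    rcases hp with ((hp | hp) | hp) | hp <;> exact hpr _ p hp
  refine Finset.prod_le_prod (fun p hp => ?_) fun p hp => ?_
  · have := one_sub_inv_prime_pos (hpZ p hp)
    split_ifs <;> positivity
  · have h0 := one_sub_inv_prime_pos (hpZ p hp)
    have h1 := one_sub_inv_natCast_le_one p
    have hpp := hpZ p hp
    simp only [Finset.mem_union, Nat.mem_primeFactors, hpp, ha.ne', hb.ne', hg.ne', hh.ne',
      true_and, ne_eq, not_false_eq_true, and_true]
    have hnot : ¬ (p ∣ a ∧ p ∣ b) := fun ⟨h1, h2⟩ =>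
      hpp.one_lt.ne' (Nat.dvd_one.mp (hab ▸ Nat.dvd_gcd h1 h2))
    set u := 1 - (p : ℝ)⁻¹ with hu
    have u1 : u * u ≤ u := by nlinarith
    have u2 : u * u * u ≤ u * u := by nlinarith [mul_pos h0 h0]
    by_cases c1 : p ∣ g <;> by_cases c2 : p ∣ a <;> by_cases c3 : p ∣ b <;>
      by_cases c4 : p ∣ h <;> simp only [c1, c2, c3, c4, if_true, if_false, or_true,
        or_false, mul_one, one_mul, or_self, and_self, not_true_eq_false] at hnot ⊢ <;>
      nlinarith

theorem card_coprime_residues_le {a b g : ℕ} (ha : 0 < a) (hb : 0 < b) (hg : 0 < g)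
    (hab : a.Coprime b) {h : ℤ} (hh : h ≠ 0) :
    (((Finset.range (g * a) ×ˢ Finset.range (g * b)).filter fun x : ℕ × ℕ =>
      x.1.Coprime (g * a) ∧ x.2.Coprime (g * b) ∧
        ((g * a * b : ℕ) : ℤ) ∣ x.1 * b - x.2 * a - h).card : ℝ) ≤
      g * (totientRatio (g * a) * totientRatio (g * b) * (eulerProd (a * b).primeFactors)⁻¹ *
        (eulerProd h.natAbs.primeFactors)⁻¹) := by
  set X := (Finset.range (g * a) ×ˢ Finset.range (g * b)).filter fun x : ℕ × ℕ =>
      x.1.Coprime (g * a) ∧ x.2.Coprime (g * b) ∧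
        ((g * a * b : ℕ) : ℤ) ∣ x.1 * b - x.2 * a - h with hX
  have hloc := prod_local_factor_le ha hb hg (Int.natAbs_pos.mpr hh) hab
  rcases X.eq_empty_or_nonempty with hem | ⟨⟨m, n⟩, hmn⟩
  · rw [hem]
    simp only [Finset.card_empty, Nat.cast_zero]
    refine mul_nonneg (by positivity) (le_trans ?_ hloc)
    refine Finset.prod_nonneg fun p hp => ?_
    have := one_sub_inv_prime_pos (Nat.prime_of_mem_primeFactors hp)
    split_ifs <;> positivity
  have ha0 : (a : ℤ) ≠ 0 := by exact_mod_cast ha.ne'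
  have hb0 : (b : ℤ) ≠ 0 := by exact_mod_cast hb.ne'
  have hg0 : (0 : ℤ) < g := by exact_mod_cast hg
  simp only [hX, Finset.mem_filter, Finset.mem_product, Finset.mem_range] at hmn
  obtain ⟨⟨hm, hn⟩, hmc, hnc, hd⟩ := hmn
  have hpar : ∀ x ∈ X, ∃ k l : ℤ, (x.1 : ℤ) = m + a * k ∧ (x.2 : ℤ) = n + b * l ∧
      (g : ℤ) ∣ k - l := by
    intro x hx
    obtain ⟨_, _, _, hxd⟩ := Finset.mem_filter.mp hx
    have h1 := dvd_sub hxd hd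
    have h2 : (x.1 * b - x.2 * a - h : ℤ) - (m * b - n * a - h) =
      (x.1 - m) * b - (x.2 - n) * a := by ring
    rw [h2] at h1
    have hcop : IsCoprime (a : ℤ) b := Nat.isCoprime_iff_coprime.mpr hab
    have d1 : (a : ℤ) ∣ x.1 - m := by
      have h3 : (a : ℤ) ∣ (x.1 - m) * b - (x.2 - n) * a :=
        dvd_trans ⟨g * b, by push_cast; ring⟩ h1
      have h4 : (a : ℤ) ∣ (x.1 - m) * b := (dvd_sub_left (dvd_mul_left _ _)).mp h3
      exact hcop.dvd_of_dvd_mul_right h4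
    have d2 : (b : ℤ) ∣ x.2 - n := by
      have h3 : (b : ℤ) ∣ (x.1 - m) * b - (x.2 - n) * a :=
        dvd_trans ⟨g * a, by push_cast; ring⟩ h1
      have h4 : (b : ℤ) ∣ (x.2 - n) * a := (dvd_sub_right (dvd_mul_left _ _)).mp h3
      exact hcop.symm.dvd_of_dvd_mul_right h4
    obtain ⟨k, hk⟩ := d1
    obtain ⟨l, hl⟩ := d2
    refine ⟨k, l, by linarith, by linarith, ?_⟩
    rw [hk, hl] at h1
    have h5 : (a : ℤ) * k * b - b * l * a = (k - l) * (a * b) := by ring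
    rw [h5] at h1
    push_cast at h1
    rw [mul_assoc] at h1
    exact (mul_dvd_mul_iff_right (mul_ne_zero ha0 hb0)).mp h1
  choose! kf lf hkf hlf hkl using hpar
  set w : ℕ → ℕ → ℝ := fun p k =>
    if (p : ℤ) ∣ m + a * k ∨ (p : ℤ) ∣ n + b * k then (0 : ℝ) else 1 with hw
  set Y := (Finset.range g).filter fun k : ℕ => ∀ p ∈ g.primeFactors,
    ¬ ((p : ℤ) ∣ m + a * k ∨ (p : ℤ) ∣ n + b * k) with hY
  have hmap : X.card ≤ Y.card := by
    refine Finset.card_le_card_of_injOn (fun x => ((kf x) % g).toNat) ?_ ?_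
    · intro x hx
      have hx : x ∈ X := hx
      obtain ⟨_, hc1, hc2, _⟩ := Finset.mem_filter.mp hx
      have l1 := Int.emod_lt_of_pos (kf x) hg0
      have l2 := Int.emod_nonneg (kf x) hg0.ne'
      simp only [hY, Finset.coe_filter, Finset.mem_range, Set.mem_ofPred_eq]
      refine ⟨by omega, fun p hp => ?_⟩
      have hpg := Nat.dvd_of_mem_primeFactors hp
      have hpp := Nat.prime_of_mem_primeFactors hp
      have hpg' : (p : ℤ) ∣ g := by exact_mod_cast hpg
      rw [Int.toNat_of_nonneg l2]
      have hk : (p : ℤ) ∣ kf x % g - kf x := by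
        rw [Int.emod_def]
        exact hpg'.trans ⟨-(kf x / g), by ring⟩
      rintro (h1 | h1)
      · have h2 : (p : ℤ) ∣ x.1 := by
          rw [hkf x hx]
          have := dvd_sub h1 (dvd_mul_of_dvd_right hk a)
          rwa [show (m : ℤ) + a * (kf x % g) - a * (kf x % g - kf x) = m + a * kf x by ring] at this
        have h3 : p ∣ x.1 := by exact_mod_cast h2
        have := Nat.dvd_gcd h3 (hpg.trans (Nat.dvd_mul_right g a))
        rw [hc1] at this
        exact hpp.one_lt.ne' (Nat.dvd_one.mp this)
      · have h2 : (p : ℤ) ∣ x.2 := by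
          rw [hlf x hx]
          have := dvd_sub h1 (dvd_mul_of_dvd_right (dvd_add hk (hpg'.trans (hkl x hx))) b)
          rwa [show (n : ℤ) + b * (kf x % g) - b * (kf x % g - kf x + (kf x - lf x)) =
            n + b * lf x by ring] at this
        have h3 : p ∣ x.2 := by exact_mod_cast h2
        have := Nat.dvd_gcd h3 (hpg.trans (Nat.dvd_mul_right g b))
        rw [hc2] at this
        exact hpp.one_lt.ne' (Nat.dvd_one.mp this)
    · intro x hx y hy hxy
      have hx : x ∈ X := hx
      have hy : y ∈ X := hy
      simp only at hxy
      have e1 : kf x % g = kf y % g := by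
        have := Int.emod_nonneg (kf x) hg0.ne'
        have := Int.emod_nonneg (kf y) hg0.ne'
        omega
      have e2 : (g : ℤ) ∣ kf x - kf y := Int.ModEq.dvd (show kf y % g = kf x % g from e1.symm)
      have e3 : (g : ℤ) ∣ lf x - lf y := by
        have := dvd_add (dvd_sub e2 (hkl x hx)) (hkl y hy)
        rwa [show kf x - kf y - (kf x - lf x) + (kf y - lf y) = lf x - lf y by ring] at this
      obtain ⟨hx1, _⟩ := Finset.mem_filter.mp hx
      obtain ⟨hy1, _⟩ := Finset.mem_filter.mp hy
      rw [Finset.mem_product, Finset.mem_range, Finset.mem_range] at hx1 hy1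
      have f1 : x.1 = y.1 := by
        have : (y.1 : ℤ) ≡ x.1 [ZMOD (g * a : ℕ)] := by
          rw [Int.modEq_iff_dvd, hkf x hx, hkf y hy]
          obtain ⟨c, hc⟩ := e2
          exact ⟨c, by push_cast; linear_combination a * hc⟩
        exact (Nat.ModEq.eq_of_lt_of_lt (Int.natCast_modEq_iff.mp this) hy1.1 hx1.1).symm
      have f2 : x.2 = y.2 := by
        have : (y.2 : ℤ) ≡ x.2 [ZMOD (g * b : ℕ)] := by
          rw [Int.modEq_iff_dvd, hlf x hx, hlf y hy]
          obtain ⟨c, hc⟩ := e3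
          exact ⟨c, by push_cast; linear_combination b * hc⟩
        exact (Nat.ModEq.eq_of_lt_of_lt (Int.natCast_modEq_iff.mp this) hy1.2 hx1.2).symm
      exact Prod.ext f1 f2
  have hYsum : (Y.card : ℝ) = ∑ k ∈ Finset.range g, ∏ p ∈ g.primeFactors, w p k := by
    rw [hY, Finset.card_filter]
    push_cast
    refine Finset.sum_congr rfl fun k _ => ?_
    split_ifs with hc
    · refine (Finset.prod_eq_one fun p hp => ?_).symm
      simp only [hw, if_neg (hc p hp)]
    · push Not at hc
      obtain ⟨p, hp, hc⟩ := hc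
      refine (Finset.prod_eq_zero hp ?_).symm
      simp only [hw, if_pos hc]
  have hper : ∀ p ∈ g.primeFactors, Function.Periodic (w p) p := by
    intro p _ k
    simp only [hw]
    have i1 : (p : ℤ) ∣ m + a * ((k + p : ℕ) : ℤ) ↔ (p : ℤ) ∣ m + a * k := by
      rw [show (m : ℤ) + a * ((k + p : ℕ) : ℤ) = (m + a * k) + a * p by push_cast; ring]
      exact dvd_add_left (dvd_mul_left _ _)
    have i2 : (p : ℤ) ∣ n + b * ((k + p : ℕ) : ℤ) ↔ (p : ℤ) ∣ n + b * k := by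
      rw [show (n : ℤ) + b * ((k + p : ℕ) : ℤ) = (n + b * k) + b * p by push_cast; ring]
      exact dvd_add_left (dvd_mul_left _ _)
    simp only [i1, i2]
  calc (X.card : ℝ) ≤ Y.card := by exact_mod_cast hmap
    _ = g * ∏ p ∈ g.primeFactors, ((∑ k ∈ Finset.range p, w p k) / p) := by
        rw [hYsum, sum_range_prod_eq_mul_prod_avg
          (fun p hp => Nat.prime_of_mem_primeFactors hp) hper (Nat.prod_primeFactors_dvd g)]
    _ ≤ g * ∏ p ∈ g.primeFactors,
          (if p ∣ a ∨ p ∣ b ∨ p ∣ h.natAbs then 1 - (p : ℝ)⁻¹ else (1 - (p : ℝ)⁻¹) ^ 2) := by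
        gcongr with p hp
        · have := sum_range_avoid_roots_le (Nat.prime_of_mem_primeFactors hp) hab
            (m := m) (n := n) (h := h) (dvd_trans (by
              have := (Nat.dvd_of_mem_primeFactors hp).trans
                ((Nat.dvd_mul_right g a).trans (Nat.dvd_mul_right (g * a) b))
              exact_mod_cast this) hd)
          simpa only [hw, Int.natCast_dvd] using this
    _ ≤ _ := by gcongr

/-! ### Averages of `h / φ(h)` over integers coprime to a given one -/

lemma inv_eulerProd_large_primes_le {y h : ℕ} (hy : 0 < y) (hh : 0 < h) (hlt : h < 4 ^ y) :
    (eulerProd (h.primeFactors.filter (y < ·)))⁻¹ ≤ Real.exp 2 := by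
  set S := h.primeFactors.filter (y < ·) with hS
  have hSp : ∀ p ∈ S, p.Prime := fun p hp => Nat.prime_of_mem_primeFactors (Finset.mem_filter.mp hp).1
  have hy0 : (0 : ℝ) < y := by exact_mod_cast hy
  have hcard : S.card ≤ 2 * y := by
    have h1 : 2 ^ S.card ≤ ∏ p ∈ S, p := by
      rw [← Finset.prod_const]
      exact Finset.prod_le_prod' fun p hp => (hSp p hp).two_le
    have h2 : ∏ p ∈ S, p ≤ ∏ p ∈ h.primeFactors, p :=
      Finset.prod_le_prod_of_subset_of_one_le' (Finset.filter_subset _ _)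
        fun p hp _ => (Nat.prime_of_mem_primeFactors hp).one_lt.le
    have h3 : ∏ p ∈ h.primeFactors, p ≤ h := Nat.le_of_dvd hh (Nat.prod_primeFactors_dvd h)
    have h4 : 2 ^ S.card < 2 ^ (2 * y) := by
      rw [pow_mul]
      exact (h1.trans (h2.trans h3)).trans_lt hlt
    exact ((Nat.pow_lt_pow_iff_right (by norm_num)).mp h4).le
  rw [eulerProd, ← Finset.prod_inv_distrib]
  calc ∏ p ∈ S, (1 - (p : ℝ)⁻¹)⁻¹ ≤ ∏ p ∈ S, Real.exp ((y : ℝ)⁻¹) := by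
        refine Finset.prod_le_prod (fun p hp => ?_) fun p hp => ?_
        · have := one_sub_inv_prime_pos (hSp p hp)
          positivity
        · have h1 : (y : ℝ) + 1 ≤ p := by exact_mod_cast (Finset.mem_filter.mp hp).2
          have h2 : (p : ℝ)⁻¹ ≤ ((y : ℝ) + 1)⁻¹ := inv_anti₀ (by positivity) h1
          have h3 : (1 - (p : ℝ)⁻¹)⁻¹ ≤ (1 - ((y : ℝ) + 1)⁻¹)⁻¹ := by
            apply inv_anti₀ _ (by linarith)
            have : ((y : ℝ) + 1)⁻¹ < 1 := inv_lt_one_of_one_lt₀ (by linarith)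
            linarith
          have h4 : (1 - ((y : ℝ) + 1)⁻¹)⁻¹ = (y : ℝ)⁻¹ + 1 := by
            rw [show 1 - ((y : ℝ) + 1)⁻¹ = y / (y + 1) by field_simp; ring, inv_div]
            field_simp; ring
          rw [h4] at h3
          exact h3.trans (Real.add_one_le_exp _)
    _ = Real.exp (S.card * (y : ℝ)⁻¹) := by rw [Finset.prod_const, Real.exp_nat_mul]
    _ ≤ Real.exp 2 := by
        gcongr
        rw [← div_eq_mul_inv, div_le_iff₀ hy0]
        exact_mod_cast hcard

/-- The local weight at `p` used to bound `h / φ(h)` on integers `h` coprime to `n`. -/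
noncomputable def localWeight (n p h : ℕ) : ℝ :=
  if p ∣ n then (if p ∣ h then 0 else 1) else if p ∣ h then (1 - (p : ℝ)⁻¹)⁻¹ else 1

lemma localWeight_nonneg {n p : ℕ} (hp : p.Prime) (h : ℕ) : 0 ≤ localWeight n p h := by
  have := one_sub_inv_prime_pos hp
  rw [localWeight]
  split_ifs <;> positivity

lemma localWeight_periodic (n p : ℕ) : Function.Periodic (localWeight n p) p := by
  intro k
  simp only [localWeight, Nat.dvd_add_self_right]

lemma localWeight_avg_le {n p : ℕ} (hp : p.Prime) :
    (∑ k ∈ Finset.range p, localWeight n p k) / p ≤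
      (if p ∣ n then 1 - (p : ℝ)⁻¹ else 1) * (1 + 2 * (1 / (p : ℝ) ^ 2)) := by
  have hu := one_sub_inv_prime_pos hp
  have hp2 : (2 : ℝ) ≤ p := by exact_mod_cast hp.two_le
  obtain ⟨q, rfl⟩ : ∃ q, p = q + 1 := ⟨p - 1, by have := hp.pos; omega⟩
  have h1 : ∀ k ∈ Finset.range q, localWeight n (q + 1) (k + 1) = 1 := by
    intro k hk
    have : ¬ q + 1 ∣ k + 1 := Nat.not_dvd_of_pos_of_lt (by omega)
      (by have := Finset.mem_range.mp hk; omega)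
    simp [localWeight, this]
  rw [Finset.sum_range_succ', Finset.sum_congr rfl h1]
  simp only [Finset.sum_const, Finset.card_range, nsmul_eq_mul, mul_one, localWeight, dvd_zero,
    if_true]
  push_cast at *
  have hq : (0 : ℝ) < q := by linarith
  split_ifs with hd
  · have e : ((q : ℝ) + 0) / (q + 1) = 1 - ((q : ℝ) + 1)⁻¹ := by field_simp; ring
    rw [e]
    have : 0 ≤ 2 * (1 / ((q : ℝ) + 1) ^ 2) := by positivity
    nlinarith
  · have e : (1 - ((q : ℝ) + 1)⁻¹)⁻¹ = (q + 1) / q := by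
      rw [show 1 - ((q : ℝ) + 1)⁻¹ = q / (q + 1) by field_simp; ring, inv_div]
    rw [e, one_mul, div_le_iff₀ (by positivity)]
    have e2 : (1 + 2 * (1 / ((q : ℝ) + 1) ^ 2)) * (q + 1) = q + 1 + 2 / (q + 1) := by field_simp
    rw [e2]
    have e3 : ((q : ℝ) + 1) / q = 1 + 1 / q := by field_simp
    rw [e3]
    have : 1 / (q : ℝ) ≤ 2 / (q + 1) := by
      rw [div_le_div_iff₀ hq (by positivity)]; linarith
    linarith

lemma inv_eulerProd_le_localWeight {n y h : ℕ} (hy : 0 < y) (hh : 0 < h) (hlt : h < 4 ^ y)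
    (hc : h.Coprime n) :
    (eulerProd h.primeFactors)⁻¹ ≤
      Real.exp 2 * ∏ p ∈ (Finset.range (y + 1)).filter Nat.Prime, localWeight n p h := by
  have hpr : ∀ p ∈ h.primeFactors, p.Prime := fun p hp => Nat.prime_of_mem_primeFactors hp
  have e1 : eulerProd h.primeFactors = eulerProd (h.primeFactors.filter (y < ·)) *
      eulerProd (h.primeFactors.filter (¬ y < ·)) :=
    (Finset.prod_filter_mul_prod_filter_not _ _ _).symm
  have e2 : (eulerProd (h.primeFactors.filter (¬ y < ·)))⁻¹ =
      ∏ p ∈ (Finset.range (y + 1)).filter Nat.Prime, localWeight n p h := by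
    have e3 : h.primeFactors.filter (¬ y < ·) =
        ((Finset.range (y + 1)).filter Nat.Prime).filter (· ∣ h) := by
      ext p
      simp only [Finset.mem_filter, Nat.mem_primeFactors, Finset.mem_range, not_lt]
      constructor
      · rintro ⟨⟨h1, h2, _⟩, h3⟩; exact ⟨⟨by omega, h1⟩, h2⟩
      · rintro ⟨⟨h1, h2⟩, h3⟩; exact ⟨⟨h2, h3, hh.ne'⟩, by omega⟩
    rw [eulerProd, ← Finset.prod_inv_distrib, e3, Finset.prod_filter]
    refine Finset.prod_congr rfl fun p hp => ?_
    have hpp := (Finset.mem_filter.mp hp).2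
    rw [localWeight]
    by_cases c1 : p ∣ h
    · have c2 : ¬ p ∣ n := fun c2 => hpp.one_lt.ne' (Nat.dvd_one.mp (hc ▸ Nat.dvd_gcd c1 c2))
      rw [if_pos c1, if_neg c2]
    · rw [if_neg c1]; simp [c1]
  rw [e1, mul_inv, e2]
  gcongr
  · exact Finset.prod_nonneg fun p hp => localWeight_nonneg (Finset.mem_filter.mp hp).2 h
  · exact inv_eulerProd_large_primes_le hy hh hlt

theorem sum_inv_eulerProd_le {n y : ℕ} {H : ℝ} (hn : 0 < n) (hy : 0 < y) (hH : 0 < H)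
    (hyH : (4 : ℝ) ^ y ≤ 4 * H) (hHy : H < 4 ^ y) :
    ∑ h ∈ (Finset.range ⌈H⌉₊).filter (fun h => 0 < h ∧ h.Coprime n), (eulerProd h.primeFactors)⁻¹ ≤
      5 * Real.exp 6 * H * eulerProd (n.primeFactors.filter (· ≤ y)) := by
  set P := (Finset.range (y + 1)).filter Nat.Prime with hP
  have hPp : ∀ p ∈ P, p.Prime := fun p hp => (Finset.mem_filter.mp hp).2
  set Y := ∏ p ∈ P, p with hY
  have hYpos : 0 < Y := Finset.prod_pos fun p hp => (hPp p hp).pos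
  have hYr : (0 : ℝ) < Y := by exact_mod_cast hYpos
  have hY4 : (Y : ℝ) ≤ 4 * H := by
    have : Y ≤ 4 ^ y := primorial_le_four_pow y
    have : (Y : ℝ) ≤ 4 ^ y := by exact_mod_cast this
    linarith
  set L := Y * (⌊H / Y⌋₊ + 1) with hL
  have hL1 : ⌈H⌉₊ ≤ L := by
    rw [Nat.ceil_le, hL]
    push_cast
    have := (Nat.lt_floor_add_one (H / Y)).le
    rw [div_le_iff₀ hYr] at this
    linarith
  have hL2 : (L : ℝ) ≤ 5 * H := by
    rw [hL]
    push_cast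
    have := Nat.floor_le (show 0 ≤ H / Y by positivity)
    rw [le_div_iff₀ hYr] at this
    linarith
  calc ∑ h ∈ (Finset.range ⌈H⌉₊).filter (fun h => 0 < h ∧ h.Coprime n), (eulerProd h.primeFactors)⁻¹
      ≤ ∑ h ∈ (Finset.range ⌈H⌉₊).filter (fun h => 0 < h ∧ h.Coprime n),
          Real.exp 2 * ∏ p ∈ P, localWeight n p h := by
        refine Finset.sum_le_sum fun h hh => ?_
        obtain ⟨h1, h2, h3⟩ := Finset.mem_filter.mp hh
        refine inv_eulerProd_le_localWeight hy h2 ?_ h3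
        have h4 : (h : ℝ) < H := Nat.lt_ceil.mp (Finset.mem_range.mp h1)
        exact_mod_cast h4.trans hHy
    _ ≤ ∑ h ∈ Finset.range L, Real.exp 2 * ∏ p ∈ P, localWeight n p h := by
        refine Finset.sum_le_sum_of_subset_of_nonneg ?_ fun h _ _ => ?_
        · refine (Finset.filter_subset _ _).trans fun h hh => ?_
          rw [Finset.mem_range] at *
          omega
        · exact mul_nonneg (Real.exp_pos _).le
            (Finset.prod_nonneg fun p hp => localWeight_nonneg (hPp p hp) h)
    _ = Real.exp 2 * (L * ∏ p ∈ P, ((∑ k ∈ Finset.range p, localWeight n p k) / p)) := by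
        rw [← Finset.mul_sum, sum_range_prod_eq_mul_prod_avg hPp
          (fun p _ => localWeight_periodic n p) (Dvd.intro _ rfl)]
    _ ≤ Real.exp 2 * (5 * H * ∏ p ∈ P,
          ((if p ∣ n then 1 - (p : ℝ)⁻¹ else 1) * (1 + 2 * (1 / (p : ℝ) ^ 2)))) := by
        have h0 : ∀ p ∈ P, 0 ≤ (∑ k ∈ Finset.range p, localWeight n p k) / p := fun p hp =>
          div_nonneg (Finset.sum_nonneg fun k _ => localWeight_nonneg (hPp p hp) k) (by positivity)
        have h1 := Finset.prod_le_prod h0 fun p hp => localWeight_avg_le (n := n) (hPp p hp)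
        have h2 := Finset.prod_nonneg h0
        gcongr
    _ = Real.exp 2 * (5 * H * (eulerProd (n.primeFactors.filter (· ≤ y)) *
          ∏ p ∈ P, (1 + 2 * (1 / (p : ℝ) ^ 2)))) := by
        rw [Finset.prod_mul_distrib, eulerProd, ← Finset.prod_filter]
        congr 4
        ext p
        simp only [hP, Finset.mem_filter, Nat.mem_primeFactors, Finset.mem_range]
        constructor
        · rintro ⟨⟨h1, h2⟩, h3⟩; exact ⟨⟨h2, h3, hn.ne'⟩, by omega⟩
        · rintro ⟨⟨h1, h2, _⟩, h3⟩; exact ⟨⟨by omega, h1⟩, h2⟩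
    _ ≤ Real.exp 2 * (5 * H * (eulerProd (n.primeFactors.filter (· ≤ y)) * Real.exp 4)) := by
        have h0 : 0 ≤ eulerProd (n.primeFactors.filter (· ≤ y)) :=
          (eulerProd_pos fun p hp => Nat.prime_of_mem_primeFactors (Finset.mem_filter.mp hp).1).le
        have h1 : ∏ p ∈ P, (1 + 2 * (1 / (p : ℝ) ^ 2)) ≤ Real.exp 4 := by
          calc ∏ p ∈ P, (1 + 2 * (1 / (p : ℝ) ^ 2))
              ≤ ∏ p ∈ P, Real.exp (2 * (1 / (p : ℝ) ^ 2)) := by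
                refine Finset.prod_le_prod (fun p _ => by positivity) fun p _ => ?_
                rw [add_comm]; exact Real.add_one_le_exp _
            _ = Real.exp (2 * ∑ p ∈ P.filter (1 < ·), ((1 : ℕ) : ℝ) / (p : ℝ) ^ 2) := by
                rw [← Real.exp_sum, Finset.mul_sum, Finset.filter_true_of_mem
                  fun p hp => (hPp p hp).one_lt]
                simp
            _ ≤ Real.exp 4 := by
                have := sum_inv_sq_le P 1
                gcongr
                linarith
        gcongr
    _ = _ := by
        rw [show (6 : ℝ) = 2 + 4 by norm_num, Real.exp_add]; ring

/-! ### Counting close pairs of reduced fractions -/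

/-- The number of pairs of reduced fractions `m / q`, `n / r` modulo `1` at distance less
than `Δ`. -/
noncomputable def nearPairs (q r : ℕ) (Δ : ℝ) : Finset (ℕ × ℕ) :=
  haveI := Classical.decPred fun x : ℕ × ℕ =>
    x.1.Coprime q ∧ x.2.Coprime r ∧ ∃ k : ℤ, |(x.1 : ℝ) / q - x.2 / r - k| < Δ
  (Finset.range q ×ˢ Finset.range r).filter fun x =>
    x.1.Coprime q ∧ x.2.Coprime r ∧ ∃ k : ℤ, |(x.1 : ℝ) / q - x.2 / r - k| < Δ

lemma mem_nearPairs {q r : ℕ} {Δ : ℝ} {x : ℕ × ℕ} : x ∈ nearPairs q r Δ ↔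
    (x.1 < q ∧ x.2 < r) ∧ x.1.Coprime q ∧ x.2.Coprime r ∧
      ∃ k : ℤ, |(x.1 : ℝ) / q - x.2 / r - k| < Δ := by
  simp [nearPairs]

lemma exists_difference_of_mem_nearPairs {a b g : ℕ} (ha : 0 < a) (hb : 0 < b) (hg : 0 < g)
    (hab : a.Coprime b) (hab1 : a * b ≠ 1) {Δ : ℝ} {x : ℕ × ℕ}
    (hx : x ∈ nearPairs (g * a) (g * b) Δ) :
    ∃ h : ℤ, h ≠ 0 ∧ h.natAbs.Coprime (a * b) ∧ (h.natAbs : ℝ) < Δ * (g * a * b) ∧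
      ((g * a * b : ℕ) : ℤ) ∣ x.1 * b - x.2 * a - h := by
  obtain ⟨_, hc1, hc2, k, hk⟩ := mem_nearPairs.mp hx
  set h : ℤ := x.1 * b - x.2 * a - k * (g * a * b : ℕ) with hh
  have hcop : h.natAbs.Coprime (a * b) := by
    refine Nat.coprime_of_dvd fun p hp hph hpab => ?_
    have hph' : (p : ℤ) ∣ h := Int.natCast_dvd.mpr hph
    rcases hp.dvd_mul.mp hpab with hpa | hpb
    · have hpb : ¬ p ∣ b := fun hpb => hp.one_lt.ne' (Nat.dvd_one.mp (hab ▸ Nat.dvd_gcd hpa hpb))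
      have hpa' : (p : ℤ) ∣ a := by exact_mod_cast hpa
      have h1 := dvd_add hph' (dvd_mul_of_dvd_left hpa' (x.2 + k * (g * b)))
      rw [show h + a * (x.2 + k * (g * b)) = x.1 * b by rw [hh]; push_cast; ring] at h1
      have h2 : p ∣ x.1 * b := by exact_mod_cast h1
      have h3 := (hp.dvd_mul.mp h2).resolve_right hpb
      have h4 := Nat.dvd_gcd h3 (hpa.trans (Nat.dvd_mul_left a g))
      rw [hc1] at h4
      exact hp.one_lt.ne' (Nat.dvd_one.mp h4)
    · have hpa : ¬ p ∣ a := fun hpa => hp.one_lt.ne' (Nat.dvd_one.mp (hab ▸ Nat.dvd_gcd hpa hpb))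
      have hpb' : (p : ℤ) ∣ b := by exact_mod_cast hpb
      have h1 := dvd_sub (dvd_mul_of_dvd_left hpb' (x.1 - k * (g * a))) hph'
      rw [show b * (x.1 - k * (g * a)) - h = x.2 * a by rw [hh]; push_cast; ring] at h1
      have h2 : p ∣ x.2 * a := by exact_mod_cast h1
      have h3 := (hp.dvd_mul.mp h2).resolve_right hpa
      have h4 := Nat.dvd_gcd h3 (hpb.trans (Nat.dvd_mul_left b g))
      rw [hc2] at h4
      exact hp.one_lt.ne' (Nat.dvd_one.mp h4)
  have ha0 : (0 : ℝ) < a := by exact_mod_cast ha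
  have hb0 : (0 : ℝ) < b := by exact_mod_cast hb
  have hg0 : (0 : ℝ) < g := by exact_mod_cast hg
  refine ⟨h, ?_, hcop, ?_, k, by rw [hh]; ring⟩
  · intro h0
    rw [h0] at hcop
    exact hab1 (by simpa using hcop)
  · have e : ((h.natAbs : ℕ) : ℝ) =
        |(x.1 : ℝ) / (g * a : ℕ) - x.2 / (g * b : ℕ) - k| * (g * a * b) := by
      rw [Nat.cast_natAbs, Int.cast_abs, ← abs_of_pos (show (0 : ℝ) < g * a * b by positivity),
        ← abs_mul, hh]
      push_cast
      congr 1
      field_simp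
    rw [e]
    exact mul_lt_mul_of_pos_right hk (by positivity)

lemma nearPairs_eq_empty {a b g : ℕ} (ha : 0 < a) (hb : 0 < b) (hg : 0 < g)
    (hab : a.Coprime b) (hab1 : a * b ≠ 1) {Δ : ℝ} (hH : Δ * (g * a * b) ≤ 1) :
    nearPairs (g * a) (g * b) Δ = ∅ := by
  by_contra hne
  obtain ⟨x, hx⟩ := Finset.nonempty_iff_ne_empty.mpr hne
  obtain ⟨h, h0, _, h2, _⟩ := exists_difference_of_mem_nearPairs ha hb hg hab hab1 hx
  have h3 : (h.natAbs : ℝ) < 1 := h2.trans_le hH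
  have h4 : h.natAbs < 1 := by exact_mod_cast h3
  omega

theorem card_nearPairs_le {a b g : ℕ} (ha : 0 < a) (hb : 0 < b) (hg : 0 < g)
    (hab : a.Coprime b) (hab1 : a * b ≠ 1) {Δ H : ℝ} (hΔ : H = Δ * (g * a * b)) (hH : 0 < H)
    {y : ℕ} (hy : 0 < y) (hyH : (4 : ℝ) ^ y ≤ 4 * H) (hHy : H < 4 ^ y) :
    ((nearPairs (g * a) (g * b) Δ).card : ℝ) ≤ 10 * Real.exp 6 * g * H *
      (totientRatio (g * a) * totientRatio (g * b)) *
        (eulerProd ((a * b).primeFactors.filter (y < ·)))⁻¹ := by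
  have hpr : ∀ p ∈ (a * b).primeFactors, p.Prime :=
    fun p hp => Nat.prime_of_mem_primeFactors hp
  set T := (Finset.range ⌈H⌉₊).filter (fun h => 0 < h ∧ h.Coprime (a * b)) with hT
  let N : ℤ → Finset (ℕ × ℕ) := fun h =>
    (Finset.range (g * a) ×ˢ Finset.range (g * b)).filter fun x : ℕ × ℕ =>
      x.1.Coprime (g * a) ∧ x.2.Coprime (g * b) ∧
        ((g * a * b : ℕ) : ℤ) ∣ x.1 * b - x.2 * a - h
  set K : ℝ := totientRatio (g * a) * totientRatio (g * b) with hK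
  have hK0 : 0 ≤ K := mul_nonneg (totientRatio_nonneg _) (totientRatio_nonneg _)
  set e1 := eulerProd ((a * b).primeFactors.filter (y < ·)) with he1
  set e2 := eulerProd ((a * b).primeFactors.filter (· ≤ y)) with he2
  have hpos1 : 0 < e1 := eulerProd_pos fun p hp => hpr p (Finset.mem_filter.mp hp).1
  have hpos2 : 0 < e2 := eulerProd_pos fun p hp => hpr p (Finset.mem_filter.mp hp).1
  have he : eulerProd (a * b).primeFactors = e1 * e2 := by
    rw [he1, he2, eulerProd, eulerProd, eulerProd, ← Finset.prod_filter_mul_prod_filter_not _ (y < ·)]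
    simp only [not_lt]
  have hcov : nearPairs (g * a) (g * b) Δ ⊆ T.biUnion fun h => N h ∪ N (-h) := by
    intro x hx
    obtain ⟨h, h0, h1, h2, h3⟩ := exists_difference_of_mem_nearPairs ha hb hg hab hab1 hx
    obtain ⟨⟨l1, l2⟩, c1, c2, _⟩ := mem_nearPairs.mp hx
    rw [← hΔ] at h2
    refine Finset.mem_biUnion.mpr ⟨h.natAbs, Finset.mem_filter.mpr
      ⟨Finset.mem_range.mpr (Nat.lt_ceil.mpr h2), Int.natAbs_pos.mpr h0, h1⟩, ?_⟩
    have hN : x ∈ N h := Finset.mem_filter.mpr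
      ⟨Finset.mem_product.mpr ⟨Finset.mem_range.mpr l1, Finset.mem_range.mpr l2⟩, c1, c2, h3⟩
    rw [Finset.mem_union]
    rcases Int.natAbs_eq h with hh | hh
    · left; rw [← hh]; exact hN
    · right
      have : -((h.natAbs : ℕ) : ℤ) = h := hh.symm
      rw [this]; exact hN
  have hNle : ∀ h ∈ T, (((N h ∪ N (-h)).card : ℕ) : ℝ) ≤
      2 * g * K * (e1 * e2)⁻¹ * (eulerProd h.primeFactors)⁻¹ := by
    intro h hh
    obtain ⟨_, h0, _⟩ := Finset.mem_filter.mp hh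
    have p1 := card_coprime_residues_le ha hb hg hab (h := (h : ℤ)) (by exact_mod_cast h0.ne')
    have p2 := card_coprime_residues_le ha hb hg hab (h := -(h : ℤ))
      (by rw [neg_ne_zero]; exact_mod_cast h0.ne')
    rw [Int.natAbs_natCast] at p1
    rw [Int.natAbs_neg, Int.natAbs_natCast] at p2
    rw [he, ← hK] at p1 p2
    have h3 : (((N h ∪ N (-h)).card : ℕ) : ℝ) ≤ (N h).card + (N (-h)).card := by
      exact_mod_cast Finset.card_union_le _ _
    refine h3.trans ((add_le_add p1 p2).trans (le_of_eq ?_))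
    ring
  calc ((nearPairs (g * a) (g * b) Δ).card : ℝ)
      ≤ ((T.biUnion fun h => N h ∪ N (-h)).card : ℝ) := by
        exact_mod_cast Finset.card_le_card hcov
    _ ≤ ∑ h ∈ T, (((N h ∪ N (-h)).card : ℕ) : ℝ) := by
        exact_mod_cast Finset.card_biUnion_le
    _ ≤ ∑ h ∈ T, 2 * g * K * (e1 * e2)⁻¹ * (eulerProd h.primeFactors)⁻¹ :=
        Finset.sum_le_sum hNle
    _ = 2 * g * K * (e1 * e2)⁻¹ * ∑ h ∈ T, (eulerProd h.primeFactors)⁻¹ := by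
        rw [Finset.mul_sum]
    _ ≤ 2 * g * K * (e1 * e2)⁻¹ * (5 * Real.exp 6 * H * e2) := by
        gcongr
        exact sum_inv_eulerProd_le (Nat.mul_pos ha hb) hy hH hyH hHy
    _ = _ := by field_simp; ring

lemma diffPrimes_eq {a b g : ℕ} (ha : 0 < a) (hb : 0 < b) (hg : 0 < g) (hab : a.Coprime b) :
    diffPrimes (g * a) (g * b) = (a * b).primeFactors := by
  ext p
  simp only [diffPrimes, Finset.mem_filter, Nat.mem_primeFactors]
  rw [Nat.factorization_mul hg.ne' ha.ne', Nat.factorization_mul hg.ne' hb.ne']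
  simp only [Finsupp.add_apply, ne_eq, Nat.add_left_cancel_iff]
  constructor
  · rintro ⟨⟨hp, _, _⟩, hne⟩
    refine ⟨hp, ?_, (Nat.mul_pos ha hb).ne'⟩
    by_contra hd
    rw [hp.dvd_mul, not_or] at hd
    rw [Nat.factorization_eq_zero_of_not_dvd hd.1,
      Nat.factorization_eq_zero_of_not_dvd hd.2] at hne
    exact hne rfl
  · rintro ⟨hp, hd, _⟩
    refine ⟨⟨hp, hd.trans ⟨g * g, by ring⟩, by positivity⟩, ?_⟩
    rcases hp.dvd_mul.mp hd with h1 | h1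
    · have h2 : ¬ p ∣ b := fun h2 => hp.one_lt.ne' (Nat.dvd_one.mp (hab ▸ Nat.dvd_gcd h1 h2))
      rw [Nat.factorization_eq_zero_of_not_dvd h2]
      exact (hp.factorization_pos_of_dvd ha.ne' h1).ne'
    · have h2 : ¬ p ∣ a := fun h2 => hp.one_lt.ne' (Nat.dvd_one.mp (hab ▸ Nat.dvd_gcd h2 h1))
      rw [Nat.factorization_eq_zero_of_not_dvd h2]
      exact (hp.factorization_pos_of_dvd hb.ne' h1).ne

lemma prod_Ioc_inv_one_sub_inv {y J : ℕ} (hy : 0 < y) (hJ : y ≤ J) :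
    ∏ n ∈ Finset.Ioc y J, (1 - (n : ℝ)⁻¹)⁻¹ = J / y := by
  have hy0 : (y : ℝ) ≠ 0 := by exact_mod_cast hy.ne'
  induction J, hJ using Nat.le_induction with
  | base => simp [hy0]
  | succ J hJ ih =>
    have hJ0 : (0 : ℝ) < J := by exact_mod_cast hy.trans_le hJ
    rw [← Finset.insert_Ioc_right_eq_Ioc_add_one hJ, Finset.prod_insert (by simp), ih]
    push_cast
    rw [show 1 - ((J : ℝ) + 1)⁻¹ = J / (J + 1) by field_simp; ring, inv_div]
    field_simp

lemma inv_eulerProd_filter_le {S : Finset ℕ} (hS : ∀ p ∈ S, p.Prime) {y J : ℕ} (hy : 0 < y)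
    (hJ : y ≤ J) (hsum : ∑ p ∈ S.filter (J < ·), (p : ℝ)⁻¹ ≤ 2) :
    (eulerProd (S.filter (y < ·)))⁻¹ ≤ Real.exp 4 * (J / y) := by
  have hfac : eulerProd (S.filter (y < ·)) =
      eulerProd (S.filter (J < ·)) * eulerProd (S.filter fun p => y < p ∧ p ≤ J) := by
    rw [eulerProd, eulerProd, eulerProd, ← Finset.prod_filter_mul_prod_filter_not _ (J < ·),
      Finset.filter_filter, Finset.filter_filter]
    congr 1
    · refine Finset.prod_congr (Finset.filter_congr fun p _ => ?_) fun _ _ => rfl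
      constructor
      · exact fun h => h.2
      · exact fun h => ⟨by omega, h⟩
    · simp only [not_lt]
  rw [hfac, mul_inv]
  gcongr
  · exact inv_nonneg.mpr (eulerProd_pos fun p hp => hS p (Finset.mem_filter.mp hp).1).le
  · rw [eulerProd, ← Finset.prod_inv_distrib]
    calc ∏ p ∈ S.filter (J < ·), (1 - (p : ℝ)⁻¹)⁻¹
        ≤ ∏ p ∈ S.filter (J < ·), Real.exp (2 * (p : ℝ)⁻¹) := by
          refine Finset.prod_le_prod (fun p hp => ?_) fun p hp => ?_
          · have := one_sub_inv_prime_pos (hS p (Finset.mem_filter.mp hp).1)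
            positivity
          · have hpp := hS p (Finset.mem_filter.mp hp).1
            have h0 := one_sub_inv_prime_pos hpp
            have hp2 : (2 : ℝ) ≤ p := by exact_mod_cast hpp.two_le
            have h1 : (p : ℝ)⁻¹ ≤ 2⁻¹ := inv_anti₀ (by norm_num) hp2
            have h2 : 0 < (p : ℝ)⁻¹ := by positivity
            rw [inv_le_comm₀ h0 (Real.exp_pos _), ← Real.exp_neg]
            have h3 := Real.exp_bound_div_one_sub_of_interval (x := (p : ℝ)⁻¹) h2.le (by linarith)
            have h4 : 2 * (p : ℝ)⁻¹ + 1 ≤ Real.exp (2 * (p : ℝ)⁻¹) := Real.add_one_le_exp _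
            have h5 : (1 - (p : ℝ)⁻¹)⁻¹ ≤ 2 * (p : ℝ)⁻¹ + 1 := by
              rw [inv_le_iff_one_le_mul₀ h0]; nlinarith
            rw [Real.exp_neg, inv_le_comm₀ (Real.exp_pos _) h0]
            linarith
      _ = Real.exp (2 * ∑ p ∈ S.filter (J < ·), (p : ℝ)⁻¹) := by
          rw [← Real.exp_sum, Finset.mul_sum]
      _ ≤ Real.exp 4 := by gcongr; linarith
  · rw [← prod_Ioc_inv_one_sub_inv hy hJ, eulerProd, ← Finset.prod_inv_distrib]
    have hsub : (S.filter fun p => y < p ∧ p ≤ J) ⊆ Finset.Ioc y J := by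
      intro p hp
      have := (Finset.mem_filter.mp hp).2
      rwa [Finset.mem_Ioc]
    have hone : ∀ n : ℕ, y < n → 1 ≤ (1 - (n : ℝ)⁻¹)⁻¹ := by
      intro n hn
      have h1 : (1 : ℝ) < n := by exact_mod_cast (show 1 < n by omega)
      have h2 := inv_lt_one_of_one_lt₀ h1
      have h3 : 0 < (n : ℝ)⁻¹ := by positivity
      exact (one_le_inv₀ (by linarith)).mpr (by linarith)
    rw [← Finset.prod_sdiff hsub]
    refine le_mul_of_one_le_left (Finset.prod_nonneg fun p hp => ?_) ?_
    · have := hone p (Finset.mem_filter.mp hp).2.1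
      linarith
    · refine Finset.one_le_prod fun p hp => ?_
      exact hone p (Finset.mem_Ioc.mp (Finset.mem_sdiff.mp hp).1).1

/-- The measure (up to a factor `2`) of the overlap of two families of intervals around the
reduced fractions with denominators `q` and `r`. -/
noncomputable def overlap (ψ : ℕ → ℝ) (q r : ℕ) : ℝ :=
  min (ψ q / q) (ψ r / r) * (nearPairs q r (ψ q / q + ψ r / r)).card

lemma min_mul_add_le {x y : ℝ} (hx : 0 ≤ x) (hy : 0 ≤ y) : min x y * (x + y) ≤ 2 * (x * y) := by
  rcases le_total x y with h | h
  · rw [min_eq_left h]; nlinarith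
  · rw [min_eq_right h]; nlinarith

theorem overlap_le {ψ : ℕ → ℝ} (hψ : ∀ n, 0 ≤ ψ n) {q r : ℕ} (hq : 0 < q) (hr : 0 < r)
    (hne : q ≠ r) :
    overlap ψ q r ≤ 20 * Real.exp 10 * ((ψ q * totientRatio q) * (ψ r * totientRatio r)) ∨
    ∃ j : ℕ, (ψ q * r ≤ 4 ^ j * Nat.gcd q r ∧ ψ r * q ≤ 4 ^ j * Nat.gcd q r) ∧
      2 ≤ ∑ p ∈ (diffPrimes q r).filter (j < ·), (p : ℝ)⁻¹ ∧
      overlap ψ q r ≤ 20 * Real.exp 10 * (j + 1) *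
        ((ψ q * totientRatio q) * (ψ r * totientRatio r)) := by
  obtain ⟨g, a, b, hg, hab, rfl, rfl⟩ := Nat.exists_coprime' (Nat.gcd_pos_of_pos_left r hq)
  rw [mul_comm a g] at *
  rw [mul_comm b g] at *
  have ha : 0 < a := Nat.pos_of_mul_pos_left hq
  have hb : 0 < b := Nat.pos_of_mul_pos_left hr
  have hab1 : a * b ≠ 1 := by
    intro h
    obtain ⟨rfl, rfl⟩ := mul_eq_one.mp h
    exact hne rfl
  have ha0 : (0 : ℝ) < a := by exact_mod_cast ha
  have hb0 : (0 : ℝ) < b := by exact_mod_cast hb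
  have hg0 : (0 : ℝ) < g := by exact_mod_cast hg
  set x := ψ (g * a) with hx
  set y' := ψ (g * b) with hy'
  have hx0 : 0 ≤ x := hψ _
  have hy0 : 0 ≤ y' := hψ _
  set M := (x * totientRatio (g * a)) * (y' * totientRatio (g * b)) with hM
  have hM0 : 0 ≤ M := mul_nonneg (mul_nonneg hx0 (totientRatio_nonneg _))
    (mul_nonneg hy0 (totientRatio_nonneg _))
  set Δ := x / (g * a : ℕ) + y' / (g * b : ℕ) with hΔ
  by_cases hH1 : Δ * (g * a * b) ≤ 1
  · left
    rw [overlap, nearPairs_eq_empty ha hb hg hab hab1 hH1]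
    simp only [Finset.card_empty, Nat.cast_zero, mul_zero]
    positivity
  push Not at hH1
  set H := Δ * (g * a * b) with hH
  obtain ⟨n, hn1, hn2⟩ := exists_nat_pow_near hH1.le (show (1 : ℝ) < 4 by norm_num)
  set S := (a * b).primeFactors with hS
  have hSp : ∀ p ∈ S, p.Prime := fun p hp => Nat.prime_of_mem_primeFactors hp
  have hcard := card_nearPairs_le ha hb hg hab hab1 hH (by linarith) (Nat.succ_pos n)
    (by rw [pow_succ]; linarith) hn2
  have hw : overlap ψ (g * a) (g * b) ≤
      20 * Real.exp 6 * M * (eulerProd (S.filter (n + 1 < ·)))⁻¹ := by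
    have hE : 0 < eulerProd (S.filter (n + 1 < ·)) :=
      eulerProd_pos fun p hp => hSp p (Finset.mem_filter.mp hp).1
    have hmin : 0 ≤ min (x / (g * a : ℕ)) (y' / (g * b : ℕ)) := le_min (by positivity) (by positivity)
    have h1 := mul_le_mul_of_nonneg_left hcard hmin
    have h2 := min_mul_add_le (show 0 ≤ x / (g * a : ℕ) by positivity)
      (show 0 ≤ y' / (g * b : ℕ) by positivity)
    have h3 : min (x / (g * a : ℕ)) (y' / (g * b : ℕ)) * (g * H) ≤ 2 * (x * y') := by
      have h4 := mul_le_mul_of_nonneg_right h2 (show 0 ≤ (g * a : ℝ) * (g * b) by positivity)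
      have h5 : 2 * (x / (g * a : ℕ) * (y' / (g * b : ℕ))) * ((g * a : ℝ) * (g * b)) =
          2 * (x * y') := by push_cast; field_simp
      rw [h5] at h4
      refine le_trans (le_of_eq ?_) h4
      rw [hH, hΔ]; ring
    have h6 := mul_le_mul_of_nonneg_right h3 (show 0 ≤ 10 * Real.exp 6 *
      (totientRatio (g * a) * totientRatio (g * b)) * (eulerProd (S.filter (n + 1 < ·)))⁻¹ from
      mul_nonneg (mul_nonneg (by positivity) (mul_nonneg (totientRatio_nonneg _)
        (totientRatio_nonneg _))) (inv_nonneg.mpr hE.le))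
    refine h1.trans (le_trans (le_of_eq ?_) (h6.trans (le_of_eq ?_)))
    · simp only [Nat.succ_eq_add_one]; ring
    · rw [hM]; ring
  have hfin : ∀ J : ℕ, n + 1 ≤ J → ∑ p ∈ S.filter (J < ·), (p : ℝ)⁻¹ ≤ 2 →
      overlap ψ (g * a) (g * b) ≤ 20 * Real.exp 10 * (J / (n + 1 : ℕ)) * M := by
    intro J hJ hs
    have h1 := inv_eulerProd_filter_le hSp (Nat.succ_pos n) hJ hs
    have h2 := mul_le_mul_of_nonneg_left h1 (show 0 ≤ 20 * Real.exp 6 * M by positivity)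
    refine hw.trans (h2.trans (le_of_eq ?_))
    rw [show (10 : ℝ) = 6 + 4 by norm_num, Real.exp_add]; ring
  have hex : ∃ J, n + 1 ≤ J ∧ ∑ p ∈ S.filter (J < ·), (p : ℝ)⁻¹ ≤ 2 := by
    refine ⟨n + 1 + S.sup id, by omega, ?_⟩
    rw [Finset.filter_eq_empty_iff.mpr]
    · simp
    · intro p hp
      have := Finset.le_sup (f := id) hp
      simp only [id] at this
      omega
  classical
  obtain ⟨hJ1, hJ2⟩ := Nat.find_spec hex
  have hmin := fun m (hm : m < Nat.find hex) => Nat.find_min hex hm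
  set J := Nat.find hex with hJ
  rcases hJ1.eq_or_lt with h | h
  · left
    have := hfin J hJ1 hJ2
    rw [← h, div_self (by positivity), mul_one] at this
    exact this
  · right
    obtain ⟨j, hj⟩ : ∃ j, J = j + 1 := ⟨J - 1, by omega⟩
    have hnj : n + 1 ≤ j := by omega
    have hgcd : Nat.gcd (g * a) (g * b) = g := by
      rw [Nat.gcd_mul_left, hab, mul_one]
    have h4 : H ≤ 4 ^ j := hn2.le.trans (pow_le_pow_right₀ (by norm_num) hnj)
    have h4' := mul_le_mul_of_nonneg_right h4 hg0.le
    have e : H * g = x * (g * b : ℕ) + y' * (g * a : ℕ) := by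
      rw [hH, hΔ]; push_cast; field_simp
    refine ⟨j, ?_, ?_, ?_⟩
    · rw [hgcd]
      have e1 : 0 ≤ x * (g * b : ℕ) := by positivity
      have e2 : 0 ≤ y' * (g * a : ℕ) := by positivity
      constructor <;> linarith
    · rw [diffPrimes_eq ha hb hg hab]
      have := hmin j (by omega)
      push Not at this
      exact (this hnj).le
    · refine (hfin J hJ1 hJ2).trans ?_
      refine mul_le_mul_of_nonneg_right ?_ hM0
      refine mul_le_mul_of_nonneg_left ?_ (by positivity)
      rw [hj]
      push_cast
      exact div_le_self (by positivity) (by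
        have : (0 : ℝ) ≤ n := by positivity
        linarith)

theorem exists_sum_overlap_le : ∃ C : ℝ, 0 < C ∧ ∀ (ψ : ℕ → ℝ) (Q : Finset ℕ),
    (∀ n, 0 ≤ ψ n) → (∀ q ∈ Q, 0 < q) → ∑ q ∈ Q, ψ q * totientRatio q ≤ 2 →
    ∑ e ∈ (Q ×ˢ Q).filter (fun e => e.1 ≠ e.2), overlap ψ e.1 e.2 ≤ C := by
  obtain ⟨C, hC, hb⟩ := exists_bad_pairs_bound
  set ρ : ℝ := 2 * Real.exp (-2) with hρ
  have hρ0 : 0 < ρ := by positivity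
  have hρ1 : ρ < 1 := by
    have h1 : Real.exp (-2) * Real.exp 2 = 1 := by rw [← Real.exp_add]; simp
    have h2 : (2 : ℝ) < Real.exp 2 := by
      have := Real.add_one_lt_exp (show (2 : ℝ) ≠ 0 by norm_num)
      linarith
    nlinarith [Real.exp_pos (-2)]
  have hsum : Summable fun j : ℕ => ((j : ℝ) + 1) * ρ ^ j := by
    have h1 : Summable fun j : ℕ => (j : ℝ) ^ 1 * ρ ^ j :=
      summable_pow_mul_geometric_of_norm_lt_one 1 (by rwa [Real.norm_of_nonneg hρ0.le])
    have h2 := summable_geometric_of_lt_one hρ0.le hρ1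
    refine (h1.add h2).congr fun j => ?_
    ring
  set T := ∑' j : ℕ, ((j : ℝ) + 1) * ρ ^ j with hT
  have hT0 : 0 ≤ T := tsum_nonneg fun j => by positivity
  refine ⟨20 * Real.exp 10 * (4 + C * T), by positivity, fun ψ Q hψ hQ hμ => ?_⟩
  set μ : ℕ → ℝ := fun q => ψ q * totientRatio q with hμd
  have hμ0 : ∀ q, 0 ≤ μ q := fun q => mul_nonneg (hψ q) (totientRatio_nonneg q)
  classical
  set P := (Q ×ˢ Q).filter (fun e => e.1 ≠ e.2) with hP
  set K := 20 * Real.exp 10 with hK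
  have hK0 : 0 < K := by positivity
  let G : ℕ × ℕ → ℕ → Prop := fun e j =>
    (ψ e.1 * e.2 ≤ 4 ^ j * Nat.gcd e.1 e.2 ∧ ψ e.2 * e.1 ≤ 4 ^ j * Nat.gcd e.1 e.2) ∧
      2 ≤ ∑ p ∈ (diffPrimes e.1 e.2).filter (j < ·), (p : ℝ)⁻¹
  have hstep : ∀ e : ℕ × ℕ, ∃ j : ℕ, e ∈ P → overlap ψ e.1 e.2 ≤ K * (μ e.1 * μ e.2) ∨
      (G e j ∧ overlap ψ e.1 e.2 ≤ K * (j + 1) * (μ e.1 * μ e.2)) := by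
    intro e
    by_cases he : e ∈ P
    · obtain ⟨he1, he2⟩ := Finset.mem_filter.mp he
      obtain ⟨hq, hr⟩ := Finset.mem_product.mp he1
      rcases overlap_le hψ (hQ _ hq) (hQ _ hr) he2 with h | ⟨j, h1, h2, h3⟩
      · exact ⟨0, fun _ => Or.inl h⟩
      · exact ⟨j, fun _ => Or.inr ⟨⟨h1, h2⟩, h3⟩⟩
    · exact ⟨0, fun h => absurd h he⟩
  choose J hJ using hstep
  set L := P.sup J + 1 with hL
  let E : ℕ → Finset (ℕ × ℕ) := fun j => P.filter fun e => G e j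
  have hPE : ∀ e ∈ P, overlap ψ e.1 e.2 ≤ K * (μ e.1 * μ e.2) +
      ∑ j ∈ Finset.range L, K * (j + 1) * (if e ∈ E j then μ e.1 * μ e.2 else (0 : ℝ)) := by
    intro e he
    have hnn : ∀ j ∈ Finset.range L,
        0 ≤ K * (j + 1) * (if e ∈ E j then μ e.1 * μ e.2 else (0 : ℝ)) := by
      intro j _
      have : 0 ≤ (if e ∈ E j then μ e.1 * μ e.2 else (0 : ℝ)) := by
        split_ifs
        · exact mul_nonneg (hμ0 _) (hμ0 _)
        · exact le_rfl
      positivity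
    rcases hJ e he with h | ⟨h1, h2⟩
    · linarith only [h, Finset.sum_nonneg hnn]
    · have hm : J e ∈ Finset.range L := by
        rw [Finset.mem_range, hL]
        exact Nat.lt_succ_of_le (Finset.le_sup he)
      have h3 := Finset.single_le_sum hnn hm
      rw [if_pos (Finset.mem_filter.mpr ⟨he, h1⟩)] at h3
      have h4 : 0 ≤ K * (μ e.1 * μ e.2) := mul_nonneg hK0.le (mul_nonneg (hμ0 _) (hμ0 _))
      linarith only [h2, h3, h4]
  have hPsub : P ⊆ Q ×ˢ Q := Finset.filter_subset _ _
  have hEb : ∀ j, ∑ e ∈ E j, μ e.1 * μ e.2 ≤ C * ρ ^ j := fun j =>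
    hb ψ Q j (E j) hψ hQ hμ ((Finset.filter_subset _ _).trans hPsub)
      (fun e he => (Finset.mem_filter.mp he).2.1) (fun e he => (Finset.mem_filter.mp he).2.2)
  have hPm : ∑ e ∈ P, μ e.1 * μ e.2 ≤ 4 := by
    calc ∑ e ∈ P, μ e.1 * μ e.2 ≤ ∑ e ∈ Q ×ˢ Q, μ e.1 * μ e.2 :=
          Finset.sum_le_sum_of_subset_of_nonneg hPsub
            fun e _ _ => mul_nonneg (hμ0 _) (hμ0 _)
      _ = (∑ q ∈ Q, μ q) * ∑ q ∈ Q, μ q := by rw [Finset.sum_mul_sum, Finset.sum_product]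
      _ ≤ 2 * 2 := mul_le_mul hμ hμ (Finset.sum_nonneg fun q _ => hμ0 q) (by norm_num)
      _ = 4 := by norm_num
  calc ∑ e ∈ P, overlap ψ e.1 e.2 ≤ ∑ e ∈ P, (K * (μ e.1 * μ e.2) +
        ∑ j ∈ Finset.range L, K * (j + 1) * (if e ∈ E j then μ e.1 * μ e.2 else (0 : ℝ))) :=
        Finset.sum_le_sum hPE
    _ = K * ∑ e ∈ P, μ e.1 * μ e.2 +
        ∑ j ∈ Finset.range L, K * (j + 1) * ∑ e ∈ E j, μ e.1 * μ e.2 := by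
      rw [Finset.sum_add_distrib, Finset.mul_sum, Finset.sum_comm]
      congr 1
      refine Finset.sum_congr rfl fun j _ => ?_
      rw [← Finset.mul_sum, ← Finset.sum_filter]
      congr 2
      ext e
      simp only [E, Finset.mem_filter, and_self_left]
    _ ≤ K * 4 + ∑ j ∈ Finset.range L, K * (j + 1) * (C * ρ ^ j) := by
      refine add_le_add (mul_le_mul_of_nonneg_left hPm hK0.le)
        (Finset.sum_le_sum fun j _ => mul_le_mul_of_nonneg_left (hEb j) (by positivity))
    _ = K * 4 + K * C * ∑ j ∈ Finset.range L, ((j : ℝ) + 1) * ρ ^ j := by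
      rw [Finset.mul_sum]
      congr 1
      exact Finset.sum_congr rfl fun j _ => by ring
    _ ≤ K * 4 + K * C * T := by
      have := hsum.sum_le_tsum (Finset.range L) fun j _ => by positivity
      exact add_le_add le_rfl (mul_le_mul_of_nonneg_left this (by positivity))
    _ = K * (4 + C * T) := by ring

/-! ### The Duffin–Schaeffer theorem -/

lemma le_measureReal_biUnion {Ω ι : Type*} [MeasurableSpace Ω] {μ : Measure Ω}
    [IsProbabilityMeasure μ] (I : Finset ι) {B : ι → Set Ω} (hB : ∀ i ∈ I, MeasurableSet (B i))
    (t : ℝ) :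
    2 * t * ∑ i ∈ I, μ.real (B i) - t ^ 2 * ∑ i ∈ I, ∑ j ∈ I, μ.real (B i ∩ B j) ≤
      μ.real (⋃ i ∈ I, B i) := by
  classical
  have hIntg : ∀ s : Set Ω, MeasurableSet s → Integrable (s.indicator (1 : Ω → ℝ)) μ :=
    fun s hs => (integrable_const (1 : ℝ)).indicator hs
  have hU : MeasurableSet (⋃ i ∈ I, B i) := Finset.measurableSet_biUnion I hB
  have h1 : ∀ s : Set Ω, MeasurableSet s → ∫ x, s.indicator (1 : Ω → ℝ) x ∂μ = μ.real s :=
    fun s hs => integral_indicator_one hs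
  rw [← h1 _ hU]
  have e1 : ∑ i ∈ I, μ.real (B i) = ∫ x, ∑ i ∈ I, (B i).indicator (1 : Ω → ℝ) x ∂μ := by
    rw [integral_finsetSum _ fun i hi => hIntg _ (hB i hi)]
    exact Finset.sum_congr rfl fun i hi => (h1 _ (hB i hi)).symm
  have e2 : ∑ i ∈ I, ∑ j ∈ I, μ.real (B i ∩ B j) =
      ∫ x, ∑ i ∈ I, ∑ j ∈ I, (B i ∩ B j).indicator (1 : Ω → ℝ) x ∂μ := by
    rw [integral_finsetSum _ fun i hi => integrable_finsetSum _ fun j hj =>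
      hIntg _ ((hB i hi).inter (hB j hj))]
    refine Finset.sum_congr rfl fun i hi => ?_
    rw [integral_finsetSum _ fun j hj => hIntg _ ((hB i hi).inter (hB j hj))]
    exact Finset.sum_congr rfl fun j hj => (h1 _ ((hB i hi).inter (hB j hj))).symm
  have i1 : Integrable (fun x => ∑ i ∈ I, (B i).indicator (1 : Ω → ℝ) x) μ :=
    integrable_finsetSum _ fun i hi => hIntg _ (hB i hi)
  have i2 : Integrable (fun x => ∑ i ∈ I, ∑ j ∈ I, (B i ∩ B j).indicator (1 : Ω → ℝ) x) μ :=
    integrable_finsetSum _ fun i hi => integrable_finsetSum _ fun j hj =>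
      hIntg _ ((hB i hi).inter (hB j hj))
  rw [e1, e2, ← integral_const_mul, ← integral_const_mul,
    ← integral_sub (i1.const_mul _) (i2.const_mul _)]
  refine integral_mono ((i1.const_mul _).sub (i2.const_mul _)) (hIntg _ hU) fun x => ?_
  have hsq : ∑ i ∈ I, ∑ j ∈ I, (B i ∩ B j).indicator (1 : Ω → ℝ) x =
      (∑ i ∈ I, (B i).indicator (1 : Ω → ℝ) x) ^ 2 := by
    rw [sq, Finset.sum_mul_sum]
    refine Finset.sum_congr rfl fun i _ => Finset.sum_congr rfl fun j _ => ?_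
    rw [Set.inter_indicator_one, Pi.mul_apply]
  simp only [hsq]
  by_cases hx : x ∈ ⋃ i ∈ I, B i
  · rw [Set.indicator_of_mem hx, Pi.one_apply]
    nlinarith [sq_nonneg (t * (∑ i ∈ I, (B i).indicator (1 : Ω → ℝ) x) - 1)]
  · rw [Set.indicator_of_notMem hx, Finset.sum_eq_zero]
    · simp
    · intro i hi
      refine Set.indicator_of_notMem (fun h => hx ?_) _
      exact Set.mem_biUnion hi h

lemma measureReal_ball_unitAddCircle (x : UnitAddCircle) {ε : ℝ} (h0 : 0 ≤ ε) (h1 : 2 * ε ≤ 1) :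
    volume.real (Metric.ball x ε) = 2 * ε := by
  rw [measureReal_def, ← measure_congr AddCircle.closedBall_ae_eq_ball,
    AddCircle.volume_closedBall, min_eq_right h1, ENNReal.toReal_ofReal (by positivity)]

lemma exists_int_of_ball_inter_nonempty {x y δ ε : ℝ}
    (h : (Metric.ball (x : UnitAddCircle) δ ∩ Metric.ball (y : UnitAddCircle) ε).Nonempty) :
    ∃ k : ℤ, |x - y - k| < δ + ε := by
  obtain ⟨z, hz1, hz2⟩ := h
  have h1 : dist (x : UnitAddCircle) y < δ + ε :=
    (dist_triangle_left _ _ z).trans_lt (add_lt_add hz1 hz2)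
  rw [dist_eq_norm, ← AddCircle.coe_sub, UnitAddCircle.norm_eq] at h1
  exact ⟨_, h1⟩

lemma exists_subset_sum_mem_Icc {f : ℕ → ℝ} (hf : ∀ n, f n ≤ 1) (Q : Finset ℕ)
    (hQ : 1 ≤ ∑ q ∈ Q, f q) : ∃ R ⊆ Q, 1 ≤ ∑ q ∈ R, f q ∧ ∑ q ∈ R, f q ≤ 2 := by
  classical
  induction Q using Finset.induction_on with
  | empty => simp at hQ; linarith
  | insert a s ha ih =>
    by_cases h : ∑ q ∈ insert a s, f q ≤ 2
    · exact ⟨_, subset_rfl, hQ, h⟩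
    · rw [Finset.sum_insert ha] at h
      obtain ⟨R, hR, hR'⟩ := ih (by linarith [hf a])
      exact ⟨R, hR.trans (Finset.subset_insert _ _), hR'⟩

/-- The reduced fractions modulo one, as pairs (denominator, numerator), with denominators
in `Q`. -/
def reducedFractions (Q : Finset ℕ) : Finset (Σ _ : ℕ, ℕ) :=
  Q.sigma fun q => (Finset.range q).filter fun m => m.Coprime q

lemma card_filter_coprime_range (q : ℕ) :
    ((Finset.range q).filter fun m => m.Coprime q).card = q.totient := by
  rw [Nat.totient]
  congr 1
  ext m
  simp [Nat.coprime_comm]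

/-- The interval attached to a fraction. -/
def fractionBall (ψ : ℕ → ℝ) (i : Σ _ : ℕ, ℕ) : Set UnitAddCircle :=
  Metric.ball (((i.2 : ℝ) / i.1 : ℝ) : UnitAddCircle) (ψ i.1 / i.1)

lemma measureReal_fractionBall {ψ : ℕ → ℝ} (h0 : ∀ q, 0 ≤ ψ q) (h1 : ∀ q, ψ q ≤ 1 / 2)
    {i : Σ _ : ℕ, ℕ} (hi : 0 < i.1) : volume.real (fractionBall ψ i) = 2 * (ψ i.1 / i.1) := by
  have hi0 : (1 : ℝ) ≤ i.1 := by exact_mod_cast hi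
  refine measureReal_ball_unitAddCircle _ (div_nonneg (h0 _) (by positivity)) ?_
  have := div_le_self (h0 i.1) hi0
  linarith [h1 i.1]

lemma sum_measureReal_fractionBall {ψ : ℕ → ℝ} (h0 : ∀ q, 0 ≤ ψ q) (h1 : ∀ q, ψ q ≤ 1 / 2)
    {Q : Finset ℕ} (hQ : ∀ q ∈ Q, 0 < q) :
    ∑ i ∈ reducedFractions Q, volume.real (fractionBall ψ i) =
      2 * ∑ q ∈ Q, ψ q * totientRatio q := by
  rw [reducedFractions, Finset.sum_sigma, Finset.mul_sum]
  refine Finset.sum_congr rfl fun q hq => ?_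
  have e : ∀ m ∈ (Finset.range q).filter (fun m => m.Coprime q),
      volume.real (fractionBall ψ ⟨q, m⟩) = 2 * (ψ q / q) :=
    fun m _ => measureReal_fractionBall h0 h1 (hQ q hq)
  rw [Finset.sum_congr rfl e, Finset.sum_const, card_filter_coprime_range, nsmul_eq_mul, totientRatio]
  ring

lemma sum_measureReal_inter_le_of_ne {ψ : ℕ → ℝ} (h0 : ∀ q, 0 ≤ ψ q) (h1 : ∀ q, ψ q ≤ 1 / 2)
    {q r : ℕ} (hq : 0 < q) (hr : 0 < r) :
    ∑ m ∈ (Finset.range q).filter (fun m => m.Coprime q),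
      ∑ n ∈ (Finset.range r).filter (fun n => n.Coprime r),
        volume.real (fractionBall ψ ⟨q, m⟩ ∩ fractionBall ψ ⟨r, n⟩) ≤ 2 * overlap ψ q r := by
  classical
  rw [← Finset.sum_product']
  set T := (Finset.range q).filter (fun m => m.Coprime q) ×ˢ
    (Finset.range r).filter (fun n => n.Coprime r) with hT
  have hsub : nearPairs q r (ψ q / q + ψ r / r) ⊆ T := by
    intro x hx
    obtain ⟨⟨a1, a2⟩, a3, a4, _⟩ := mem_nearPairs.mp hx
    simp only [hT, Finset.mem_product, Finset.mem_filter, Finset.mem_range]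
    exact ⟨⟨a1, a3⟩, a2, a4⟩
  rw [← Finset.sum_subset hsub]
  · rw [overlap, ← mul_assoc, mul_comm, ← nsmul_eq_mul]
    refine Finset.sum_le_card_nsmul _ _ _ fun x _ => ?_
    rw [mul_min_of_nonneg _ _ (by norm_num)]
    refine le_min ?_ ?_
    · rw [← measureReal_fractionBall h0 h1 (i := ⟨q, x.1⟩) hq]
      exact measureReal_mono Set.inter_subset_left
    · rw [← measureReal_fractionBall h0 h1 (i := ⟨r, x.2⟩) hr]
      exact measureReal_mono Set.inter_subset_right
  · intro x hx hn
    have : fractionBall ψ ⟨q, x.1⟩ ∩ fractionBall ψ ⟨r, x.2⟩ = ∅ := by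
      by_contra hne
      refine hn (mem_nearPairs.mpr ?_)
      simp only [hT, Finset.mem_product, Finset.mem_filter, Finset.mem_range] at hx
      exact ⟨⟨hx.1.1, hx.2.1⟩, hx.1.2, hx.2.2,
        exists_int_of_ball_inter_nonempty (Set.nonempty_iff_ne_empty.mpr hne)⟩
    rw [this, measureReal_empty]

lemma sum_measureReal_inter_le_of_eq {ψ : ℕ → ℝ} (h0 : ∀ q, 0 ≤ ψ q) (h1 : ∀ q, ψ q ≤ 1 / 2)
    {q : ℕ} (hq : 0 < q) :
    ∑ m ∈ (Finset.range q).filter (fun m => m.Coprime q),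
      ∑ n ∈ (Finset.range q).filter (fun n => n.Coprime q),
        volume.real (fractionBall ψ ⟨q, m⟩ ∩ fractionBall ψ ⟨q, n⟩) ≤
      2 * (ψ q * totientRatio q) := by
  have hq0 : (0 : ℝ) < q := by exact_mod_cast hq
  have hin : ∀ m ∈ (Finset.range q).filter (fun m => m.Coprime q),
      ∑ n ∈ (Finset.range q).filter (fun n => n.Coprime q),
        volume.real (fractionBall ψ ⟨q, m⟩ ∩ fractionBall ψ ⟨q, n⟩) = 2 * (ψ q / q) := by
    intro m hm
    rw [Finset.sum_eq_single_of_mem m hm, Set.inter_self, measureReal_fractionBall h0 h1 hq]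
    intro n hn hnm
    have : fractionBall ψ ⟨q, m⟩ ∩ fractionBall ψ ⟨q, n⟩ = ∅ := by
      by_contra hne
      obtain ⟨k, hk⟩ := exists_int_of_ball_inter_nonempty (Set.nonempty_iff_ne_empty.mpr hne)
      simp only at hk
      have e : (m : ℝ) / q - n / q - k = (m - n - k * q : ℤ) / q := by
        push_cast; field_simp
      have hlt : |((m - n - k * q : ℤ) : ℝ)| < 1 := by
        rw [e, abs_div, abs_of_pos hq0, ← add_div, div_lt_div_iff_of_pos_right hq0] at hk
        linarith [h1 q]
      have hz : (m : ℤ) - n - k * q = 0 := by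
        have : |(m : ℤ) - n - k * q| < 1 := by exact_mod_cast hlt
        exact Int.abs_lt_one_iff.mp this
      have hm' := Finset.mem_range.mp (Finset.mem_filter.mp hm).1
      have hn' := Finset.mem_range.mp (Finset.mem_filter.mp hn).1
      have hk0 : k = 0 := by
        have a1 : k * q < 1 * q := by linarith [(by exact_mod_cast hm' : (m : ℤ) < q)]
        have a2 : (-1) * (q : ℤ) < k * q := by linarith [(by exact_mod_cast hn' : (n : ℤ) < q)]
        have hqz : (0 : ℤ) < q := by exact_mod_cast hq
        have b1 := lt_of_mul_lt_mul_right a1 hqz.le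
        have b2 := lt_of_mul_lt_mul_right a2 hqz.le
        omega
      rw [hk0] at hz
      omega
    rw [this, measureReal_empty]
  rw [Finset.sum_congr rfl hin, Finset.sum_const, card_filter_coprime_range, nsmul_eq_mul,
    totientRatio]
  exact le_of_eq (by ring)

theorem exists_le_measureReal_fractionBall : ∃ c : ℝ, 0 < c ∧ ∀ (ψ : ℕ → ℝ) (Q : Finset ℕ),
    (∀ q, 0 ≤ ψ q) → (∀ q, ψ q ≤ 1 / 2) → (∀ q ∈ Q, 0 < q) →
    1 ≤ ∑ q ∈ Q, ψ q * totientRatio q → ∑ q ∈ Q, ψ q * totientRatio q ≤ 2 →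
    c ≤ volume.real (⋃ i ∈ reducedFractions Q, fractionBall ψ i) := by
  obtain ⟨C, hC, hov⟩ := exists_sum_overlap_le
  refine ⟨4 / (2 * C + 4), by positivity, fun ψ Q h0 h1 hQ hs1 hs2 => ?_⟩
  classical
  have hS2 : ∑ i ∈ reducedFractions Q, ∑ j ∈ reducedFractions Q,
      volume.real (fractionBall ψ i ∩ fractionBall ψ j) ≤ 2 * C + 4 := by
    have e : ∑ i ∈ reducedFractions Q, ∑ j ∈ reducedFractions Q,
        volume.real (fractionBall ψ i ∩ fractionBall ψ j) =
        ∑ e ∈ Q ×ˢ Q, ∑ m ∈ (Finset.range e.1).filter (fun m => m.Coprime e.1),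
          ∑ n ∈ (Finset.range e.2).filter (fun n => n.Coprime e.2),
            volume.real (fractionBall ψ ⟨e.1, m⟩ ∩ fractionBall ψ ⟨e.2, n⟩) := by
      rw [reducedFractions, Finset.sum_sigma, Finset.sum_product]
      refine Finset.sum_congr rfl fun q _ => ?_
      rw [Finset.sum_comm]
      rw [Finset.sum_sigma]
      refine Finset.sum_congr rfl fun r _ => ?_
      rw [Finset.sum_comm]
    rw [e, ← Finset.sum_filter_add_sum_filter_not _ fun e => e.1 ≠ e.2]
    refine add_le_add ?_ ?_
    · refine le_trans ?_ (mul_le_mul_of_nonneg_left (hov ψ Q h0 hQ hs2) (by norm_num))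
      rw [Finset.mul_sum]
      refine Finset.sum_le_sum fun x hx => ?_
      obtain ⟨hx1, hx2⟩ := Finset.mem_product.mp (Finset.mem_filter.mp hx).1
      exact sum_measureReal_inter_le_of_ne h0 h1 (hQ _ hx1) (hQ _ hx2)
    · have : (Q ×ˢ Q).filter (fun e => ¬ e.1 ≠ e.2) = Q.image fun q => (q, q) := by
        ext ⟨x, y⟩
        simp only [Finset.mem_filter, Finset.mem_product, not_not, Finset.mem_image,
          Prod.mk.injEq]
        constructor
        · rintro ⟨⟨a, _⟩, rfl⟩
          exact ⟨x, a, rfl, rfl⟩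
        · rintro ⟨z, hz, rfl, rfl⟩
          exact ⟨⟨hz, hz⟩, rfl⟩
      rw [this, Finset.sum_image (fun x _ y _ h => (Prod.mk.injEq _ _ _ _ ▸ h).1)]
      refine (Finset.sum_le_sum fun q hq => sum_measureReal_inter_le_of_eq h0 h1 (hQ q hq)).trans ?_
      rw [← Finset.mul_sum]
      linarith
  have : IsProbabilityMeasure (volume : Measure UnitAddCircle) := ⟨UnitAddCircle.measure_univ⟩
  have h := le_measureReal_biUnion (μ := (volume : Measure UnitAddCircle)) (reducedFractions Q)
    (B := fractionBall ψ) (fun i _ => Metric.isOpen_ball.measurableSet) (2 / (2 * C + 4))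
  rw [sum_measureReal_fractionBall h0 h1 hQ] at h
  refine le_trans ?_ h
  have hK : 0 < 2 * C + 4 := by positivity
  set K := 2 * C + 4
  have a1 : (2 / K) ^ 2 * ∑ i ∈ reducedFractions Q, ∑ j ∈ reducedFractions Q,
      volume.real (fractionBall ψ i ∩ fractionBall ψ j) ≤ (2 / K) ^ 2 * K :=
    mul_le_mul_of_nonneg_left hS2 (by positivity)
  have a2 : (2 / K) ^ 2 * K = 4 / K := by field_simp; norm_num
  have a3 : 2 * (2 / K) * (2 * 1) ≤ 2 * (2 / K) * (2 * ∑ q ∈ Q, ψ q * totientRatio q) :=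
    mul_le_mul_of_nonneg_left (by linarith) (by positivity)
  have a4 : 2 * (2 / K) * (2 * 1) = 2 * (4 / K) := by ring
  linarith

theorem ae_mem_addWellApproximable {ψ : ℕ → ℝ} (h0 : ∀ q, 0 ≤ ψ q) (h1 : ∀ q, ψ q ≤ 1 / 2)
    (hdiv : ∀ B : ℝ, ∃ Q : Finset ℕ, (∀ q ∈ Q, 0 < q) ∧ B ≤ ∑ q ∈ Q, ψ q * totientRatio q) :
    ∀ᵐ x : UnitAddCircle, x ∈ addWellApproximable UnitAddCircle fun q => ψ q / q := by
  obtain ⟨c, hc, hcb⟩ := exists_le_measureReal_fractionBall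
  have hlim : Tendsto (fun q : ℕ => ψ q / q) atTop (nhds 0) := by
    refine squeeze_zero (fun q => div_nonneg (h0 q) (by positivity)) (fun q => ?_)
      (tendsto_const_div_atTop_nhds_zero_nat (1 / 2 : ℝ))
    exact div_le_div_of_nonneg_right (h1 q) (by positivity)
  have hμ1 : ∀ q, ψ q * totientRatio q ≤ 1 := fun q => by
    have := mul_le_mul (h1 q) (totientRatio_le_one q) (totientRatio_nonneg q) (by norm_num)
    linarith
  let A : ℕ → Set UnitAddCircle := fun q => approxAddOrderOf UnitAddCircle q (ψ q / q)
  let U : ℕ → Set UnitAddCircle := fun X => ⋃ q ∈ {q | X < q}, A q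
  have hA : ∀ q, MeasurableSet (A q) := fun q => Metric.isOpen_thickening.measurableSet
  have hU : ∀ X, MeasurableSet (U X) := fun X =>
    MeasurableSet.biUnion (Set.to_countable _) fun q _ => hA q
  have hUanti : Antitone U := fun X Y hXY =>
    Set.biUnion_subset_biUnion_left fun q (hq : Y < q) => lt_of_le_of_lt hXY hq
  have hUc : ∀ X, c ≤ volume.real (U X) := by
    intro X
    obtain ⟨Q, hQ, hB⟩ := hdiv (X + 2)
    have hsplit := Finset.sum_filter_add_sum_filter_not Q (X < ·) fun q => ψ q * totientRatio q
    have hsmall : ∑ q ∈ Q.filter (fun q => ¬ X < q), ψ q * totientRatio q ≤ X + 1 := by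
      have hcard : (Q.filter (fun q => ¬ X < q)).card ≤ X + 1 := by
        rw [← Finset.card_range (X + 1)]
        refine Finset.card_le_card fun q hq => ?_
        have := (Finset.mem_filter.mp hq).2
        rw [Finset.mem_range]
        omega
      refine (Finset.sum_le_card_nsmul _ _ 1 fun q _ => hμ1 q).trans ?_
      rw [nsmul_eq_mul, mul_one]
      exact_mod_cast hcard
    obtain ⟨R, hR, hR1, hR2⟩ := exists_subset_sum_mem_Icc hμ1 (Q.filter (X < ·)) (by linarith)
    refine (hcb ψ R h0 h1 (fun q hq => hQ q (Finset.mem_filter.mp (hR hq)).1) hR1 hR2).trans ?_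
    refine measureReal_mono (Set.iUnion₂_subset fun i hi x hx => ?_) (measure_ne_top _ _)
    rw [reducedFractions, Finset.mem_sigma, Finset.mem_filter, Finset.mem_range] at hi
    obtain ⟨hi1, hi2, hi3⟩ := hi
    have hmem := Finset.mem_filter.mp (hR hi1)
    refine Set.mem_biUnion (show i.1 ∈ {q | X < q} from hmem.2) ?_
    refine (UnitAddCircle.mem_approxAddOrderOf_iff (hQ _ hmem.1)).mpr ⟨i.2, hi2, hi3, ?_⟩
    rw [fractionBall, Metric.mem_ball, dist_eq_norm] at hx
    exact hx
  have hInter : ⋂ X, U X ⊆ addWellApproximable UnitAddCircle fun q => ψ q / q := by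
    intro x hx
    rw [UnitAddCircle.mem_addWellApproximable_iff]
    refine Set.infinite_of_not_bddAbove fun ⟨X, hX⟩ => ?_
    have h2 := Set.mem_iInter.mp hx X
    simp only [U, Set.mem_iUnion] at h2
    obtain ⟨q, hq, hxq⟩ := h2
    have hq' : X < q := hq
    have := hX (show q ∈ _ from (UnitAddCircle.mem_approxAddOrderOf_iff (by omega)).mp hxq)
    omega
  have hpos : 0 < volume (⋂ X, U X) := by
    have ht := tendsto_measure_iInter_atTop (μ := (volume : Measure UnitAddCircle))
      (fun X => (hU X).nullMeasurableSet) hUanti ⟨0, measure_ne_top _ _⟩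
    have hle : ENNReal.ofReal c ≤ volume (⋂ X, U X) :=
      ge_of_tendsto' ht fun X =>
        (ENNReal.ofReal_le_iff_le_toReal (measure_ne_top _ _)).mpr (hUc X)
    exact (ENNReal.ofReal_pos.mpr hc).trans_le hle
  rcases AddCircle.addWellApproximable_ae_empty_or_univ (T := 1) (fun q => ψ q / q) hlim with h | h
  · exfalso
    have h3 : volume (addWellApproximable UnitAddCircle fun q => ψ q / q) = 0 :=
      measure_eq_zero_iff_ae_notMem.mpr h
    exact hpos.ne' (measure_mono_null hInter h3)
  · exact h

/-! ### A lower bound for Euler's function -/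

lemma sum_log_primeFactors_le (m : ℕ) (hm : 0 < m) :
    ∑ p ∈ m.primeFactors, Real.log p ≤ Real.log m := by
  rw [← Real.log_prod (fun p hp => by
    exact_mod_cast (Nat.prime_of_mem_primeFactors hp).ne_zero), ← Nat.cast_prod]
  exact Real.log_le_log (by
    exact_mod_cast Finset.prod_pos fun p hp => (Nat.prime_of_mem_primeFactors hp).pos)
    (by exact_mod_cast Nat.le_of_dvd hm (Nat.prod_primeFactors_dvd m))

lemma sum_log_div_prime_le {n : ℕ} (hn : 0 < n) :
    ∑ p ∈ (Finset.Ioc 0 n).filter Nat.Prime, Real.log p / p ≤ Real.log n + Real.log 4 := by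
  have hn0 : (0 : ℝ) < n := by exact_mod_cast hn
  have hfac : ∑ p ∈ (Finset.Ioc 0 n).filter Nat.Prime, ((n / p : ℕ) : ℝ) * Real.log p ≤
      n * Real.log n := by
    calc ∑ p ∈ (Finset.Ioc 0 n).filter Nat.Prime, ((n / p : ℕ) : ℝ) * Real.log p
        = ∑ p ∈ (Finset.Ioc 0 n).filter Nat.Prime, ∑ m ∈ Finset.Ioc 0 n,
            if p ∣ m then Real.log p else (0 : ℝ) := by
          refine Finset.sum_congr rfl fun p _ => ?_
          rw [← Finset.sum_filter, Finset.sum_const, Nat.Ioc_filter_dvd_card_eq_div, nsmul_eq_mul]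
      _ = ∑ m ∈ Finset.Ioc 0 n, ∑ p ∈ (Finset.Ioc 0 n).filter Nat.Prime,
            if p ∣ m then Real.log p else (0 : ℝ) := Finset.sum_comm
      _ = ∑ m ∈ Finset.Ioc 0 n, ∑ p ∈ m.primeFactors, Real.log p := by
          refine Finset.sum_congr rfl fun m hm => ?_
          obtain ⟨hm0, hmn⟩ := Finset.mem_Ioc.mp hm
          rw [← Finset.sum_filter]
          refine Finset.sum_congr ?_ fun _ _ => rfl
          ext p
          simp only [Finset.mem_filter, Finset.mem_Ioc, Nat.mem_primeFactors]
          constructor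
          · rintro ⟨⟨_, h1⟩, h2⟩
            exact ⟨h1, h2, hm0.ne'⟩
          · rintro ⟨h1, h2, _⟩
            exact ⟨⟨⟨h1.pos, (Nat.le_of_dvd hm0 h2).trans hmn⟩, h1⟩, h2⟩
      _ ≤ ∑ m ∈ Finset.Ioc 0 n, Real.log n := by
          refine Finset.sum_le_sum fun m hm => ?_
          obtain ⟨hm0, hmn⟩ := Finset.mem_Ioc.mp hm
          exact (sum_log_primeFactors_le m hm0).trans
            (Real.log_le_log (by exact_mod_cast hm0) (by exact_mod_cast hmn))
      _ = n * Real.log n := by simp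
  have hθ : ∑ p ∈ (Finset.Ioc 0 n).filter Nat.Prime, Real.log p ≤ Real.log 4 * n := by
    have := Chebyshev.theta_le_log4_mul_x hn0.le
    rwa [Chebyshev.theta, Nat.floor_natCast] at this
  have hdiv : ∑ p ∈ (Finset.Ioc 0 n).filter Nat.Prime, (n : ℝ) * (Real.log p / p) ≤
      ∑ p ∈ (Finset.Ioc 0 n).filter Nat.Prime,
        (((n / p : ℕ) : ℝ) * Real.log p + Real.log p) := by
    refine Finset.sum_le_sum fun p hp => ?_
    have hp0 : 0 < p := (Finset.mem_Ioc.mp (Finset.mem_filter.mp hp).1).1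
    have h1 : (n : ℝ) / p ≤ ((n / p : ℕ) : ℝ) + 1 := by
      rw [← Nat.floor_div_eq_div (K := ℝ)]
      exact (Nat.lt_floor_add_one _).le
    have h2 : 0 ≤ Real.log p := Real.log_natCast_nonneg p
    calc (n : ℝ) * (Real.log p / p) = n / p * Real.log p := by ring
      _ ≤ (((n / p : ℕ) : ℝ) + 1) * Real.log p := mul_le_mul_of_nonneg_right h1 h2
      _ = _ := by ring
  rw [← Finset.mul_sum, Finset.sum_add_distrib] at hdiv
  refine le_of_mul_le_mul_left ?_ hn0
  linarith

lemma filter_prime_Ioc_succ (N : ℕ) (f : ℕ → ℝ) :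
    ∑ p ∈ (Finset.Ioc 0 (N + 1)).filter Nat.Prime, f p =
      ∑ p ∈ (Finset.Ioc 0 N).filter Nat.Prime, f p + if (N + 1).Prime then f (N + 1) else (0 : ℝ) := by
  rw [Finset.sum_filter, Finset.sum_filter, Finset.sum_Ioc_succ_top (Nat.zero_le N)]

lemma sum_inv_prime_le {N : ℕ} (hN : 2 ≤ N) :
    ∑ p ∈ (Finset.Ioc 0 N).filter Nat.Prime, (p : ℝ)⁻¹ ≤ Real.log (Real.log N) + 4 := by
  set S : ℕ → ℝ := fun n => ∑ p ∈ (Finset.Ioc 0 n).filter Nat.Prime, Real.log p / p with hS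
  have hl2 : (1 / 2 : ℝ) < Real.log 2 := by linarith [Real.log_two_gt_d9]
  have hl4 : Real.log 4 = 2 * Real.log 2 := by
    rw [show (4 : ℝ) = 2 ^ 2 by norm_num, Real.log_pow]; norm_num
  have key : ∑ p ∈ (Finset.Ioc 0 N).filter Nat.Prime, (p : ℝ)⁻¹ - S N / Real.log N ≤
      Real.log (Real.log N) + 1 + Real.log 4 * (1 / Real.log 2 - 1 / Real.log N) := by
    induction N, hN using Nat.le_induction with
    | base =>
      have e : (Finset.Ioc 0 2).filter Nat.Prime = {2} := by decide
      have h1 : -1 ≤ Real.log (Real.log 2) := by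
        have h2 : Real.exp (-1) ≤ 1 / 2 := by
          rw [Real.exp_neg, ← one_div]
          exact one_div_le_one_div_of_le (by norm_num) (by linarith [Real.add_one_le_exp (1 : ℝ)])
        rw [← Real.log_exp (-1)]
        exact Real.log_le_log (Real.exp_pos _) (h2.trans hl2.le)
      rw [hS]
      simp only [e, Finset.sum_singleton, Nat.cast_ofNat]
      have h3 : Real.log 2 / 2 / Real.log 2 = (2 : ℝ)⁻¹ := by field_simp
      rw [h3]
      linarith
    | succ N hN ih =>
      have hN0 : (2 : ℝ) ≤ N := by exact_mod_cast hN
      have hlN : 0 < Real.log N := Real.log_pos (by linarith)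
      have hlN1 : 0 < Real.log (N + 1 : ℕ) := Real.log_pos (by push_cast; linarith)
      have hle : Real.log N ≤ Real.log (N + 1 : ℕ) :=
        Real.log_le_log (by linarith) (by push_cast; linarith)
      have hSN : S N ≤ Real.log N + Real.log 4 := sum_log_div_prime_le (by omega)
      have hstep : ∑ p ∈ (Finset.Ioc 0 (N + 1)).filter Nat.Prime, (p : ℝ)⁻¹ -
          S (N + 1) / Real.log (N + 1 : ℕ) =
          ∑ p ∈ (Finset.Ioc 0 N).filter Nat.Prime, (p : ℝ)⁻¹ - S N / Real.log (N + 1 : ℕ) := by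
        simp only [hS]
        rw [filter_prime_Ioc_succ, filter_prime_Ioc_succ]
        split_ifs
        · rw [add_div, div_div_cancel_left' hlN1.ne']
          ring
        · simp
      have hd : 0 ≤ 1 / Real.log N - 1 / Real.log (N + 1 : ℕ) :=
        sub_nonneg.mpr (one_div_le_one_div_of_le hlN hle)
      have h1 := mul_le_mul_of_nonneg_right hSN hd
      have h2 : Real.log N * (1 / Real.log N - 1 / Real.log (N + 1 : ℕ)) ≤
          Real.log (Real.log (N + 1 : ℕ)) - Real.log (Real.log N) := by
        have h3 := Real.log_le_sub_one_of_pos (div_pos hlN hlN1)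
        rw [Real.log_div hlN.ne' hlN1.ne'] at h3
        have h4 : Real.log N * (1 / Real.log N - 1 / Real.log (N + 1 : ℕ)) =
            1 - Real.log N / Real.log (N + 1 : ℕ) := by field_simp
        linarith
      rw [hstep]
      have e1 : S N / Real.log (N + 1 : ℕ) = S N / Real.log N -
        S N * (1 / Real.log N - 1 / Real.log (N + 1 : ℕ)) := by ring
      rw [e1]
      linarith
  have hN0 : (2 : ℝ) ≤ N := by exact_mod_cast hN
  have hlN : 0 < Real.log N := Real.log_pos (by linarith)
  have h1 : S N / Real.log N ≤ 1 + Real.log 4 / Real.log N := by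
    rw [div_le_iff₀ hlN, add_mul, div_mul_cancel₀ _ hlN.ne', one_mul]
    exact sum_log_div_prime_le (by omega)
  have h2 : Real.log 4 * (1 / Real.log 2 - 1 / Real.log N) = 2 - Real.log 4 / Real.log N := by
    rw [mul_sub, hl4]
    field_simp
  linarith

lemma sum_inv_pred_sub_inv_le (N : ℕ) :
    ∑ p ∈ (Finset.Ioc 0 N).filter Nat.Prime, (((p : ℝ) - 1)⁻¹ - (p : ℝ)⁻¹) ≤ 1 := by
  have h : ∑ p ∈ (Finset.Ioc 0 (N + 1)).filter Nat.Prime, (((p : ℝ) - 1)⁻¹ - (p : ℝ)⁻¹) ≤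
      1 - ((N + 1 : ℕ) : ℝ)⁻¹ := by
    induction N with
    | zero => 
      rw [filter_prime_Ioc_succ]
      norm_num
    | succ N ih =>
      rw [filter_prime_Ioc_succ]
      have h0 : (0 : ℝ) < N + 1 := by positivity
      have h1 : ((N : ℝ) + 1 + 1)⁻¹ ≤ ((N : ℝ) + 1)⁻¹ := inv_anti₀ h0 (by linarith)
      push_cast at ih ⊢
      split_ifs
      · rw [add_sub_cancel_right]
        linarith
      · linarith
  have h2 : ∑ p ∈ (Finset.Ioc 0 N).filter Nat.Prime, (((p : ℝ) - 1)⁻¹ - (p : ℝ)⁻¹) ≤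
      ∑ p ∈ (Finset.Ioc 0 (N + 1)).filter Nat.Prime, (((p : ℝ) - 1)⁻¹ - (p : ℝ)⁻¹) := by
    refine Finset.sum_le_sum_of_subset_of_nonneg
      (Finset.filter_subset_filter _ (Finset.Ioc_subset_Ioc_right (Nat.le_succ N))) fun p hp _ => ?_
    have : (2 : ℝ) ≤ p := by exact_mod_cast (Finset.mem_filter.mp hp).2.two_le
    exact sub_nonneg.mpr (inv_anti₀ (by linarith) (by linarith))
  have h3 : (0 : ℝ) ≤ ((N + 1 : ℕ) : ℝ)⁻¹ := by positivity
  linarith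

lemma eulerProd_prime_ge {N : ℕ} (hN : 2 ≤ N) :
    Real.exp (-5) / Real.log N ≤ eulerProd ((Finset.Ioc 0 N).filter Nat.Prime) := by
  have hN0 : (2 : ℝ) ≤ N := by exact_mod_cast hN
  have hlN : 0 < Real.log N := Real.log_pos (by linarith)
  have h1 : ∑ p ∈ (Finset.Ioc 0 N).filter Nat.Prime, ((p : ℝ) - 1)⁻¹ ≤
      Real.log (Real.log N) + 5 := by
    have := sum_inv_pred_sub_inv_le N
    rw [Finset.sum_sub_distrib] at this
    linarith [sum_inv_prime_le hN]
  calc Real.exp (-5) / Real.log N = Real.exp (-(Real.log (Real.log N) + 5)) := by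
        rw [neg_add, Real.exp_add, Real.exp_neg (Real.log _), Real.exp_log hlN]
        field_simp
    _ ≤ Real.exp (-∑ p ∈ (Finset.Ioc 0 N).filter Nat.Prime, ((p : ℝ) - 1)⁻¹) :=
        Real.exp_le_exp.mpr (neg_le_neg h1)
    _ = ∏ p ∈ (Finset.Ioc 0 N).filter Nat.Prime, Real.exp (-((p : ℝ) - 1)⁻¹) := by
        rw [← Finset.sum_neg_distrib, Real.exp_sum]
    _ ≤ eulerProd ((Finset.Ioc 0 N).filter Nat.Prime) := by
        refine Finset.prod_le_prod (fun _ _ => (Real.exp_pos _).le) fun p hp => ?_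
        have hp2 : (2 : ℝ) ≤ p := by exact_mod_cast (Finset.mem_filter.mp hp).2.two_le
        have h2 := Real.add_one_le_exp ((p : ℝ) - 1)⁻¹
        have h3 : ((p : ℝ) - 1)⁻¹ + 1 = (1 - (p : ℝ)⁻¹)⁻¹ := by
          have : (p : ℝ) - 1 ≠ 0 := by linarith
          rw [show 1 - (p : ℝ)⁻¹ = (p - 1) / p by field_simp, inv_div]
          field_simp
          ring
        rw [h3] at h2
        have h4 : 0 < 1 - (p : ℝ)⁻¹ := by
          have : (p : ℝ)⁻¹ ≤ 2⁻¹ := inv_anti₀ (by norm_num) hp2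
          norm_num at this ⊢
          linarith
        rw [Real.exp_neg]
        exact inv_le_of_inv_le₀ h4 h2

lemma one_le_Log (x : ℝ) : 1 ≤ Log x := le_max_left _ _

lemma Log_le_Log {x y : ℝ} (hx : 0 < x) (h : x ≤ y) : Log x ≤ Log y :=
  max_le_max le_rfl (Real.log_le_log hx h)

lemma Log2_le_Log2 {x y : ℝ} (hx : 0 < x) (h : x ≤ y) : Log2 x ≤ Log2 y :=
  Log_le_Log (zero_lt_one.trans_le (one_le_Log x)) (Log_le_Log hx h)

lemma one_sub_sum_le_prod_one_sub (s : Finset ℕ) (x : ℕ → ℝ) (h0 : ∀ i ∈ s, 0 ≤ x i)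
    (h1 : ∀ i ∈ s, x i ≤ 1) : 1 - ∑ i ∈ s, x i ≤ ∏ i ∈ s, (1 - x i) := by
  classical
  induction s using Finset.induction_on with
  | empty => simp
  | insert a s ha ih =>
    rw [Finset.sum_insert ha, Finset.prod_insert ha]
    have i1 := ih (fun i hi => h0 i (Finset.mem_insert_of_mem hi))
      (fun i hi => h1 i (Finset.mem_insert_of_mem hi))
    have a0 := h0 a (Finset.mem_insert_self _ _)
    have a1 := h1 a (Finset.mem_insert_self _ _)
    have s0 : 0 ≤ ∑ i ∈ s, x i :=
      Finset.sum_nonneg fun i hi => h0 i (Finset.mem_insert_of_mem hi)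
    nlinarith [mul_le_mul_of_nonneg_left i1 (sub_nonneg.mpr a1), mul_nonneg a0 s0]

lemma card_primeFactors_le {n : ℕ} (hn : 0 < n) : (n.primeFactors.card : ℝ) ≤ 2 * Real.log n := by
  have h1 : ∑ p ∈ n.primeFactors, Real.log 2 ≤ ∑ p ∈ n.primeFactors, Real.log p :=
    Finset.sum_le_sum fun p hp => Real.log_le_log (by norm_num)
      (by exact_mod_cast (Nat.prime_of_mem_primeFactors hp).two_le)
  have h2 := h1.trans (sum_log_primeFactors_le n hn)
  rw [Finset.sum_const, nsmul_eq_mul] at h2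
  have h3 : (1 / 2 : ℝ) ≤ Real.log 2 := by linarith [Real.log_two_gt_d9]
  nlinarith [mul_le_mul_of_nonneg_left h3 (Nat.cast_nonneg (α := ℝ) n.primeFactors.card)]

theorem le_totientRatio_mul_Log2 {n : ℕ} (hn : 0 < n) :
    Real.exp (-5) / 6 ≤ totientRatio n * Log2 n := by
  set L := ⌈4 * Log n⌉₊ with hL
  have hLog := one_le_Log (n : ℝ)
  have hL1 : 4 * Log n ≤ L := Nat.le_ceil _
  have hL2 : (L : ℝ) < 4 * Log n + 1 := Nat.ceil_lt_add_one (by linarith)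
  have hL4 : (4 : ℝ) ≤ L := by linarith
  have hLn : 2 ≤ L := by
    have : 4 ≤ L := by exact_mod_cast hL4
    omega
  have hlL : 0 < Real.log L := Real.log_pos (by linarith)
  have hlog : Real.log L ≤ 3 * Log2 n := by
    have h5 : Real.log 5 ≤ 2 := by
      rw [Real.log_le_iff_le_exp (by norm_num)]
      have h6 := Real.add_one_le_exp (1 : ℝ)
      have h7 := Real.exp_one_gt_d9
      have : Real.exp 2 = Real.exp 1 * Real.exp 1 := by rw [← Real.exp_add]; norm_num
      rw [this]
      nlinarith
    have h8 : Real.log L ≤ Real.log (5 * Log n) := Real.log_le_log (by linarith) (by linarith)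
    rw [Real.log_mul (by norm_num) (by linarith)] at h8
    have h9 : Real.log (Log n) ≤ Log2 n := le_max_right _ _
    have h10 : 1 ≤ Log2 (n : ℝ) := one_le_Log _
    linarith
  have hprime : ∀ p ∈ n.primeFactors, p.Prime := fun p hp => Nat.prime_of_mem_primeFactors hp
  have hpos : ∀ p ∈ n.primeFactors, 0 ≤ 1 - (p : ℝ)⁻¹ := fun p hp =>
    (one_sub_inv_prime_pos (hprime p hp)).le
  have hsmall : eulerProd ((Finset.Ioc 0 L).filter Nat.Prime) ≤
      ∏ p ∈ n.primeFactors.filter (· ≤ L), (1 - (p : ℝ)⁻¹) := by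
    have hsub : n.primeFactors.filter (· ≤ L) ⊆ (Finset.Ioc 0 L).filter Nat.Prime := by
      intro p hp
      obtain ⟨h1, h2⟩ := Finset.mem_filter.mp hp
      exact Finset.mem_filter.mpr ⟨Finset.mem_Ioc.mpr ⟨(hprime p h1).pos, h2⟩, hprime p h1⟩
    rw [eulerProd, ← Finset.prod_sdiff hsub]
    refine mul_le_of_le_one_left (Finset.prod_nonneg fun p hp => hpos p (Finset.mem_filter.mp hp).1)
      (Finset.prod_le_one (fun p hp => ?_) fun p hp => one_sub_inv_natCast_le_one p)
    exact (one_sub_inv_prime_pos (Finset.mem_filter.mp (Finset.mem_sdiff.mp hp).1).2).le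
  have hlarge : 1 / 2 ≤ ∏ p ∈ n.primeFactors.filter (fun p => ¬ p ≤ L), (1 - (p : ℝ)⁻¹) := by
    refine le_trans ?_ (one_sub_sum_le_prod_one_sub _ _ (fun p _ => by positivity) fun p hp => ?_)
    · have h1 : ∑ p ∈ n.primeFactors.filter (fun p => ¬ p ≤ L), (p : ℝ)⁻¹ ≤
          (n.primeFactors.filter (fun p => ¬ p ≤ L)).card • (L : ℝ)⁻¹ := by
        refine Finset.sum_le_card_nsmul _ _ _ fun p hp => ?_
        have h2 := (Finset.mem_filter.mp hp).2
        exact inv_anti₀ (by linarith) (by exact_mod_cast (not_le.mp h2).le)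
      rw [nsmul_eq_mul] at h1
      have h3 : ((n.primeFactors.filter (fun p => ¬ p ≤ L)).card : ℝ) ≤ L / 2 := by
        have h4 : ((n.primeFactors.filter (fun p => ¬ p ≤ L)).card : ℝ) ≤ n.primeFactors.card := by
          exact_mod_cast Finset.card_filter_le _ _
        have h5 : Real.log n ≤ Log n := le_max_right _ _
        linarith [card_primeFactors_le hn]
      have h6 := mul_le_mul_of_nonneg_right h3 (show 0 ≤ (L : ℝ)⁻¹ by positivity)
      have h7 : (L : ℝ) / 2 * (L : ℝ)⁻¹ = 1 / 2 := by
        have : (L : ℝ) ≠ 0 := by linarith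
        field_simp
      linarith
    · exact Nat.cast_inv_le_one p
  have h1 : Real.exp (-5) / Real.log L * (1 / 2) ≤ totientRatio n := by
    rw [totientRatio_eq_prod hn, ← Finset.prod_filter_mul_prod_filter_not _ (· ≤ L)]
    exact mul_le_mul ((eulerProd_prime_ge hLn).trans hsmall) hlarge (by norm_num)
      (Finset.prod_nonneg fun p hp => hpos p (Finset.mem_filter.mp hp).1)
  have h2 : Real.exp (-5) / 6 ≤ Real.exp (-5) / Real.log L * (1 / 2) * Log2 n := by
    rw [div_mul_eq_mul_div, div_mul_eq_mul_div, div_le_div_iff₀ (by norm_num) hlL]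
    nlinarith [mul_le_mul_of_nonneg_left hlog (Real.exp_pos (-5)).le]
  exact h2.trans (mul_le_mul_of_nonneg_right h1 (zero_le_one.trans (one_le_Log _)))

/-! ### A divergent series -/

lemma Log_le_of_log_le {x : ℝ} {y : ℝ} (hy : 1 ≤ y) (hxy : Real.log x ≤ y) : Log x ≤ y := max_le hy hxy

lemma one_third_log_div_le {x y : ℝ} (hx : 0 < x) (hxy : x ≤ y) (hyx : y ≤ 3 * x) :
    1 / 3 * (Real.log y - Real.log x) ≤ (y - x) / y := by
  have hy : 0 < y := hx.trans_le hxy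
  have h1 := Real.log_le_sub_one_of_pos (div_pos hy hx)
  rw [Real.log_div hy.ne' hx.ne'] at h1
  have h2 : y / x - 1 ≤ 3 * ((y - x) / y) := by
    rw [div_sub_one hx.ne', ← mul_div_assoc, div_le_div_iff₀ hx hy]
    nlinarith [sub_nonneg.mpr hxy]
  linarith

lemma sum_Ioc_sub_div_ge {D : ℕ → ℝ} (h1 : ∀ N : ℕ, (N : ℝ) - 1 ≤ D N)
    (h3 : ∀ N, D N ≤ D (N + 1)) (h4 : ∀ N : ℕ, D (N + 1) ≤ D N + N) {M : ℕ} (hM : 2 ≤ M)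
    {M' : ℕ} (hM' : M ≤ M') :
    1 / 3 * (Real.log (D M') - Real.log (D M)) ≤
      ∑ N ∈ Finset.Ioc M M', (D N - D (N - 1)) / D N := by
  induction M', hM' using Nat.le_induction with
  | base => simp
  | succ n hn ih =>
    have hn2 : (2 : ℝ) ≤ n := by exact_mod_cast hM.trans hn
    have hD := h1 n
    rw [Finset.sum_Ioc_succ_top hn, Nat.add_sub_cancel]
    have := one_third_log_div_le (by linarith) (h3 n) (by linarith [h4 n] : D (n + 1) ≤ 3 * D n)
    linarith

lemma block_sum_ge {D : ℕ → ℝ} (h1 : ∀ N : ℕ, (N : ℝ) - 1 ≤ D N) (h2 : ∀ N : ℕ, D N ≤ (N : ℝ) ^ 2)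
    (h3 : ∀ N, D N ≤ D (N + 1)) (h4 : ∀ N : ℕ, D (N + 1) ≤ D N + N) (k : ℕ) :
    1 / (36 * ((k : ℝ) + 2)) ≤ ∑ N ∈ Finset.Ioc (4 ^ 3 ^ k) (4 ^ 3 ^ (k + 1)),
      (D N - D (N - 1)) / (D N * (Log ((N : ℝ) / 9) * Log2 ((N : ℝ) / 9))) := by
  set M : ℕ := 4 ^ 3 ^ k with hM
  have hM3 : 4 ^ 3 ^ (k + 1) = M ^ 3 := by rw [hM, ← pow_mul, pow_succ]
  rw [hM3]
  have hM4 : 4 ≤ M := by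
    calc 4 = 4 ^ 1 := by norm_num
      _ ≤ 4 ^ 3 ^ k := Nat.pow_le_pow_right (by norm_num) (Nat.one_le_pow _ _ (by norm_num))
  have hM4' : (4 : ℝ) ≤ M := by exact_mod_cast hM4
  have hMM : M ≤ M ^ 3 := Nat.le_self_pow (by norm_num) M
  have hl4 : Real.log 4 = 2 * Real.log 2 := by
    rw [show (4 : ℝ) = 2 ^ 2 by norm_num, Real.log_pow]; norm_num
  have hl2 := Real.log_two_gt_d9
  have hl2' := Real.log_two_lt_d9
  have hlM : Real.log M = 3 ^ k * Real.log 4 := by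
    rw [hM]; push_cast; rw [Real.log_pow]; push_cast; ring
  have h3k : (1 : ℝ) ≤ 3 ^ k := one_le_pow₀ (by norm_num)
  have hlM4 : Real.log 4 ≤ Real.log M := Real.log_le_log (by norm_num) hM4'
  set G : ℝ := 3 * Real.log M * (2 * ((k : ℝ) + 2)) with hG
  have hG0 : 0 < G := by
    have : 0 < Real.log M := by linarith
    positivity
  have hlog3 : Real.log 3 ≤ 3 / 2 := by
    have : Real.log 3 ≤ Real.log 4 := Real.log_le_log (by norm_num) (by norm_num)
    linarith
  have hg : ∀ N ∈ Finset.Ioc M (M ^ 3), Log ((N : ℝ) / 9) * Log2 ((N : ℝ) / 9) ≤ G := by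
    intro N hN
    obtain ⟨hN1, hN2⟩ := Finset.mem_Ioc.mp hN
    have hN0 : (0 : ℝ) < N := by exact_mod_cast (by omega : 0 < N)
    have hN2' : (N : ℝ) ≤ (M : ℝ) ^ 3 := by exact_mod_cast hN2
    have e1 : Log ((N : ℝ) / 9) ≤ 3 * Real.log M := by
      refine Log_le_of_log_le (by linarith) ?_
      have : Real.log ((N : ℝ) / 9) ≤ Real.log ((M : ℝ) ^ 3) :=
        Real.log_le_log (by positivity) ((div_le_self hN0.le (by norm_num)).trans hN2')
      rw [Real.log_pow] at this
      exact_mod_cast this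
    have e2 : Log2 ((N : ℝ) / 9) ≤ 2 * ((k : ℝ) + 2) := by
      refine Log_le_of_log_le (by linarith [Nat.cast_nonneg (α := ℝ) k]) ?_
      refine (Real.log_le_log (zero_lt_one.trans_le (one_le_Log _)) e1).trans ?_
      rw [hlM, Real.log_mul (by norm_num) (by positivity), Real.log_mul (by positivity)
        (by positivity), Real.log_pow]
      have := Real.log_le_sub_one_of_pos (show 0 < Real.log 4 by linarith)
      nlinarith [mul_le_mul_of_nonneg_left hlog3 (Nat.cast_nonneg (α := ℝ) k)]
    exact mul_le_mul e1 e2 (zero_le_one.trans (one_le_Log _)) (by linarith)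
  have hsum : (∑ N ∈ Finset.Ioc M (M ^ 3), (D N - D (N - 1)) / D N) / G ≤
      ∑ N ∈ Finset.Ioc M (M ^ 3),
        (D N - D (N - 1)) / (D N * (Log ((N : ℝ) / 9) * Log2 ((N : ℝ) / 9))) := by
    rw [Finset.sum_div]
    refine Finset.sum_le_sum fun N hN => ?_
    obtain ⟨hN1, hN2⟩ := Finset.mem_Ioc.mp hN
    have hN4 : (4 : ℝ) ≤ N := by exact_mod_cast (by omega : 4 ≤ N)
    have hD : 0 < D N := by linarith [h1 N]
    have hd : 0 ≤ D N - D (N - 1) := by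
      have := h3 (N - 1)
      rw [Nat.sub_add_cancel (by omega)] at this
      linarith
    rw [← div_div (D N - D (N - 1)) (D N)]
    exact div_le_div_of_nonneg_left (div_nonneg hd hD.le)
      (mul_pos (zero_lt_one.trans_le (one_le_Log _)) (zero_lt_one.trans_le (one_le_Log _))) (hg N hN)
  refine le_trans ?_ hsum
  have hblock := sum_Ioc_sub_div_ge h1 h3 h4 (by omega : 2 ≤ M) hMM
  have hlow : Real.log M - Real.log 2 ≤ Real.log (D (M ^ 3)) - Real.log (D M) := by
    have hDM : 0 < D M := by linarith [h1 M]
    have hDM3 : (M : ℝ) ^ 3 / 2 ≤ D (M ^ 3) := by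
      have := h1 (M ^ 3)
      push_cast at this
      nlinarith [pow_le_pow_left₀ (by norm_num) hM4' 3]
    have a1 := Real.log_le_log (by positivity) hDM3
    have a2 := Real.log_le_log hDM (h2 M)
    rw [Real.log_div (by positivity) (by norm_num), Real.log_pow] at a1
    rw [Real.log_pow] at a2
    push_cast at a1 a2
    linarith
  have hfin : 1 / 6 * Real.log M ≤ ∑ N ∈ Finset.Ioc M (M ^ 3), (D N - D (N - 1)) / D N := by
    linarith
  rw [le_div_iff₀ hG0]
  refine le_trans (le_of_eq ?_) hfin
  rw [hG]
  field_simp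
  ring

theorem exists_le_sum_Ioc {D : ℕ → ℝ} (h1 : ∀ N : ℕ, (N : ℝ) - 1 ≤ D N)
    (h2 : ∀ N : ℕ, D N ≤ (N : ℝ) ^ 2) (h3 : ∀ N, D N ≤ D (N + 1))
    (h4 : ∀ N : ℕ, D (N + 1) ≤ D N + N) (N₀ : ℕ) (B : ℝ) :
    ∃ N₁, N₀ ≤ N₁ ∧ B ≤ ∑ N ∈ Finset.Ioc N₀ N₁,
      (D N - D (N - 1)) / (D N * (Log ((N : ℝ) / 9) * Log2 ((N : ℝ) / 9))) := by
  set f : ℕ → ℝ := fun N =>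
    (D N - D (N - 1)) / (D N * (Log ((N : ℝ) / 9) * Log2 ((N : ℝ) / 9))) with hf
  set k₀ := N₀ with hk₀
  have hlt : ∀ k : ℕ, k < 4 ^ 3 ^ k := fun k =>
    (Nat.lt_pow_self (by norm_num : 1 < 3)).trans (Nat.lt_pow_self (by norm_num))
  have hmono : ∀ k l : ℕ, k ≤ l → 4 ^ 3 ^ k ≤ 4 ^ 3 ^ l := fun k l h =>
    Nat.pow_le_pow_right (by norm_num) (Nat.pow_le_pow_right (by norm_num) h)
  have hblocks : ∀ n : ℕ, 1 / (36 * ((k₀ : ℝ) + 2)) * ∑ i ∈ Finset.range n, 1 / ((i : ℝ) + 1) ≤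
      ∑ N ∈ Finset.Ioc (4 ^ 3 ^ k₀) (4 ^ 3 ^ (k₀ + n)), f N := by
    intro n
    induction n with
    | zero => simp
    | succ n ih =>
      rw [Finset.sum_range_succ, mul_add, ← Finset.sum_Ioc_consecutive f
        (hmono k₀ (k₀ + n) (by omega)) (hmono (k₀ + n) (k₀ + (n + 1)) (by omega))]
      refine add_le_add ih (le_trans ?_ (block_sum_ge h1 h2 h3 h4 (k₀ + n)))
      rw [div_mul_div_comm, mul_one]
      refine one_div_le_one_div_of_le (by positivity) ?_
      push_cast
      nlinarith [mul_nonneg (Nat.cast_nonneg (α := ℝ) k₀) (Nat.cast_nonneg (α := ℝ) n),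
        Nat.cast_nonneg (α := ℝ) n]
  have hdiv := (Real.tendsto_sum_range_one_div_nat_succ_atTop.const_mul_atTop
    (show 0 < 1 / (36 * ((k₀ : ℝ) + 2)) by positivity)).eventually_ge_atTop B
  obtain ⟨n, hn⟩ := hdiv.exists
  refine ⟨4 ^ 3 ^ (k₀ + n), ((hlt k₀).trans_le (hmono _ _ (by omega))).le,
    (hn.trans (hblocks n)).trans ?_⟩
  refine Finset.sum_le_sum_of_subset_of_nonneg (Finset.Ioc_subset_Ioc_left (hlt k₀).le)
    fun N hN _ => ?_
  have hN0 : 0 < N := by have := (Finset.mem_Ioc.mp hN).1; omega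
  have hd : 0 ≤ D N - D (N - 1) := by
    have := h3 (N - 1)
    rw [Nat.sub_add_cancel hN0] at this
    linarith
  have hD : 0 ≤ D N := by
    have := h1 N
    have : (1 : ℝ) ≤ N := by exact_mod_cast hN0
    linarith
  exact div_nonneg hd (mul_nonneg hD (mul_nonneg (zero_le_one.trans (one_le_Log _))
    (zero_le_one.trans (one_le_Log _))))

/-! ### Differences of an integer sequence -/

/-- The positive differences of the first `N` terms of a sequence of distinct integers. -/
def diffs (a : ℕ → ℕ) (N : ℕ) : Finset ℕ :=
  (Finset.Icc 1 N).offDiag.image fun x => ((a x.1 : ℤ) - a x.2).natAbs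

lemma mem_diffs {a : ℕ → ℕ} {N q : ℕ} : q ∈ diffs a N ↔ ∃ m n : ℕ, 1 ≤ m ∧ m ≤ N ∧ 1 ≤ n ∧
    n ≤ N ∧ m ≠ n ∧ ((a m : ℤ) - a n).natAbs = q := by
  simp only [diffs, Finset.mem_image, Finset.mem_offDiag, Finset.mem_Icc, Prod.exists]
  constructor
  · rintro ⟨m, n, ⟨⟨h1, h2⟩, ⟨h3, h4⟩, h5⟩, h6⟩
    exact ⟨m, n, h1, h2, h3, h4, h5, h6⟩
  · rintro ⟨m, n, h1, h2, h3, h4, h5, h6⟩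
    exact ⟨m, n, ⟨⟨h1, h2⟩, ⟨h3, h4⟩, h5⟩, h6⟩

lemma diffs_mono (a : ℕ → ℕ) : Monotone (diffs a) := by
  intro M N h q hq
  obtain ⟨m, n, h1, h2, h3, h4, h5⟩ := mem_diffs.mp hq
  exact mem_diffs.mpr ⟨m, n, h1, h2.trans h, h3, h4.trans h, h5⟩

lemma cast_natAbs_sub (x y : ℕ) : ((((x : ℤ) - y).natAbs : ℕ) : ℝ) = |(x : ℝ) - y| := by
  rw [Nat.cast_natAbs, Int.cast_abs]
  push_cast
  rfl

lemma Dcard_eq_card_diffs (a : ℕ → ℕ) (N : ℕ) :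
    Dcard (fun n => (a n : ℝ)) N = (diffs a N).card := by
  rw [Dcard, ← Finset.card_image_of_injective _ (Nat.cast_injective (R := ℝ)),
    ← Set.ncard_coe_finset]
  congr 1
  ext x
  simp only [Finset.coe_image, Set.mem_image, Finset.mem_coe, mem_diffs]
  constructor
  · rintro ⟨m, n, h1, h2, h3, h4, h5, rfl⟩
    exact ⟨_, ⟨m, n, h1, h2, h3, h4, h5, rfl⟩, cast_natAbs_sub _ _⟩
  · rintro ⟨_, ⟨m, n, h1, h2, h3, h4, h5, rfl⟩, rfl⟩
    exact ⟨m, n, h1, h2, h3, h4, h5, cast_natAbs_sub _ _⟩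

lemma card_diffs_le_sq (a : ℕ → ℕ) (N : ℕ) : (diffs a N).card ≤ N ^ 2 := by
  refine Finset.card_image_le.trans ?_
  rw [Finset.offDiag_card, Nat.card_Icc, Nat.add_sub_cancel, sq]
  exact Nat.sub_le _ _

lemma card_diffs_succ_le (a : ℕ → ℕ) (N : ℕ) :
    (diffs a (N + 1)).card ≤ (diffs a N).card + N := by
  classical
  have hsub : diffs a (N + 1) ⊆ diffs a N ∪
      (Finset.Icc 1 N).image fun n => ((a (N + 1) : ℤ) - a n).natAbs := by
    intro q hq
    obtain ⟨m, n, h1, h2, h3, h4, h5, h6⟩ := mem_diffs.mp hq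
    rw [Finset.mem_union, Finset.mem_image]
    rcases h2.eq_or_lt with rfl | h2
    · exact Or.inr ⟨n, Finset.mem_Icc.mpr ⟨h3, by omega⟩, h6⟩
    rcases h4.eq_or_lt with rfl | h4
    · exact Or.inr ⟨m, Finset.mem_Icc.mpr ⟨h1, by omega⟩, by omega⟩
    · exact Or.inl (mem_diffs.mpr ⟨m, n, h1, by omega, h3, by omega, h5, h6⟩)
  refine (Finset.card_le_card hsub).trans ((Finset.card_union_le _ _).trans ?_)
  refine Nat.add_le_add_left (Finset.card_image_le.trans ?_) _
  simp

lemma pos_of_mem_diffs {a : ℕ → ℕ} (hdist : ∀ m n, 1 ≤ m → 1 ≤ n → m ≠ n → a m ≠ a n)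
    {N q : ℕ} (hq : q ∈ diffs a N) : 0 < q := by
  obtain ⟨m, n, h1, h2, h3, h4, h5, rfl⟩ := mem_diffs.mp hq
  have := hdist m n h1 h3 h5
  omega

lemma pred_le_card_diffs {a : ℕ → ℕ} (hdist : ∀ m n, 1 ≤ m → 1 ≤ n → m ≠ n → a m ≠ a n)
    (N : ℕ) : N - 1 ≤ (diffs a N).card := by
  classical
  rcases Nat.eq_zero_or_pos N with rfl | hN
  · simp
  obtain ⟨i, hi, hmin⟩ := Finset.exists_min_image (Finset.Icc 1 N) a
    ⟨1, Finset.mem_Icc.mpr ⟨le_rfl, hN⟩⟩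
  obtain ⟨hi1, hi2⟩ := Finset.mem_Icc.mp hi
  have hsub : ((Finset.Icc 1 N).erase i).image (fun n => ((a n : ℤ) - a i).natAbs) ⊆
      diffs a N := by
    intro q hq
    obtain ⟨n, hn, rfl⟩ := Finset.mem_image.mp hq
    obtain ⟨hni, hn'⟩ := Finset.mem_erase.mp hn
    obtain ⟨hn1, hn2⟩ := Finset.mem_Icc.mp hn'
    exact mem_diffs.mpr ⟨n, i, hn1, hn2, hi1, hi2, hni, rfl⟩
  refine le_trans (le_of_eq ?_) (Finset.card_le_card hsub)
  rw [Finset.card_image_of_injOn, Finset.card_erase_of_mem hi, Nat.card_Icc, Nat.add_sub_cancel]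
  intro m hm n hn hmn
  have hm' := Finset.mem_of_mem_erase hm
  have hn' := Finset.mem_of_mem_erase hn
  have e1 := hmin m hm'
  have e2 := hmin n hn'
  by_contra hne
  have := hdist m n (Finset.mem_Icc.mp hm').1 (Finset.mem_Icc.mp hn').1 hne
  simp only at hmn
  omega

lemma le_sSup_terms (a : ℕ → ℕ) {n N : ℕ} (h1 : 1 ≤ n) (h2 : n ≤ N) :
    a n ≤ sSup {x : ℕ | ∃ n : ℕ, 1 ≤ n ∧ n ≤ N ∧ x = a n} := by
  refine le_csSup ?_ ⟨n, h1, h2, rfl⟩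
  refine (Set.Finite.subset ((Finset.Icc 1 N).image a).finite_toSet ?_).bddAbove
  rintro x ⟨n, h1, h2, rfl⟩
  exact Finset.mem_coe.mpr (Finset.mem_image_of_mem _ (Finset.mem_Icc.mpr ⟨h1, h2⟩))

lemma le_sSup_of_mem_diffs {a : ℕ → ℕ} {N q : ℕ} (hq : q ∈ diffs a N) :
    q ≤ sSup {x : ℕ | ∃ n : ℕ, 1 ≤ n ∧ n ≤ N ∧ x = a n} := by
  obtain ⟨m, n, h1, h2, h3, h4, h5, rfl⟩ := mem_diffs.mp hq
  have e1 := le_sSup_terms a h1 h2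
  have e2 := le_sSup_terms a h3 h4
  omega

lemma deltaMin_le {a : ℕ → ℝ} {α : ℝ} {N m n : ℕ} (h1 : 1 ≤ m) (h2 : m ≤ N) (h3 : 1 ≤ n)
    (h4 : n ≤ N) (h5 : m ≠ n) : deltaMin a α N ≤ nint (α * (a m - a n)) := by
  refine csInf_le ⟨0, ?_⟩ ⟨m, n, h1, h2, h3, h4, h5, rfl⟩
  rintro d ⟨_, _, _, _, _, _, _, rfl⟩
  exact abs_nonneg _

lemma nint_neg (x : ℝ) : nint (-x) = nint x := by
  refine le_antisymm ?_ ?_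
  · have := round_le (-x) (-round x)
    push_cast at this
    rw [show -x - -(round x : ℝ) = -(x - round x) by ring, abs_neg] at this
    exact this
  · have := round_le x (-round (-x))
    push_cast at this
    rw [show x - -(round (-x) : ℝ) = -(-x - round (-x)) by ring, abs_neg] at this
    exact this

lemma deltaMin_le_of_mem_diffs {a : ℕ → ℕ} {N q : ℕ} (hq : q ∈ diffs a N) (α : ℝ) :
    deltaMin (fun n => (a n : ℝ)) α N ≤ nint (q * α) := by
  obtain ⟨m, n, h1, h2, h3, h4, h5, rfl⟩ := mem_diffs.mp hq
  refine (deltaMin_le h1 h2 h3 h4 h5).trans (le_of_eq ?_)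
  rw [cast_natAbs_sub]
  rcases abs_choice ((a m : ℝ) - a n) with h | h <;> rw [h]
  · rw [mul_comm]
  · rw [neg_mul, nint_neg, mul_comm]

lemma deltaMin_le_half {a : ℕ → ℝ} {α : ℝ} {N : ℕ} (hN : 2 ≤ N) : deltaMin a α N ≤ 1 / 2 :=
  (deltaMin_le (m := 1) (n := 2) le_rfl (by omega) (by omega) hN (by omega)).trans
    (abs_sub_round _)

/-! ### Small gaps for almost every dilation -/

/-- The maximum of the first `N` terms. -/
noncomputable def maxTerm (a : ℕ → ℕ) (N : ℕ) : ℕ :=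
  sSup {x : ℕ | ∃ n : ℕ, 1 ≤ n ∧ n ≤ N ∧ x = a n}

/-- The bound for the minimal gap. -/
noncomputable def gapBound (a : ℕ → ℕ) (N : ℕ) : ℝ :=
  4 * Log2 (maxTerm a N : ℝ) /
    ((Dcard (fun n => (a n : ℝ)) N : ℝ) * Log ((N : ℝ) / 9) * Log2 ((N : ℝ) / 9))

lemma gapBound_nonneg (a : ℕ → ℕ) (N : ℕ) : 0 ≤ gapBound a N := by
  have h : ∀ x, 0 ≤ Log x := fun x => zero_le_one.trans (one_le_Log x)
  exact div_nonneg (mul_nonneg (by norm_num) (h _))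
    (mul_nonneg (mul_nonneg (Nat.cast_nonneg _) (h _)) (h _))

open Classical in
/-- The approximation function attached to the differences of a sequence: a difference gets the
gap bound at its first appearance, truncated at `1 / 2`. -/
noncomputable def gapFun (a : ℕ → ℕ) (q : ℕ) : ℝ :=
  if h : ∃ N, q ∈ diffs a N then min (1 / 2) (gapBound a (Nat.find h)) else 0

lemma gapFun_nonneg (a : ℕ → ℕ) (q : ℕ) : 0 ≤ gapFun a q := by
  unfold gapFun
  split_ifs
  · exact le_min (by norm_num) (gapBound_nonneg _ _)
  · exact le_rfl

lemma gapFun_le_half (a : ℕ → ℕ) (q : ℕ) : gapFun a q ≤ 1 / 2 := by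
  unfold gapFun
  split_ifs
  · exact min_le_left _ _
  · norm_num

lemma exists_of_gapFun_pos {a : ℕ → ℕ} {q : ℕ} (h : 0 < gapFun a q) :
    ∃ N, q ∈ diffs a N ∧ gapFun a q ≤ gapBound a N := by
  unfold gapFun at h ⊢
  split_ifs at h ⊢ with hN
  · exact ⟨_, Nat.find_spec hN, min_le_right _ _⟩
  · exact absurd h (lt_irrefl _)

lemma gapFun_eq {a : ℕ → ℕ} {q N : ℕ} (h1 : q ∈ diffs a (N + 1)) (h2 : q ∉ diffs a N)
    (h3 : gapBound a (N + 1) ≤ 1 / 2) : gapFun a q = gapBound a (N + 1) := by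
  unfold gapFun
  have h : ∃ N, q ∈ diffs a N := ⟨_, h1⟩
  rw [dif_pos h]
  have : Nat.find h = N + 1 := by
    rw [Nat.find_eq_iff]
    exact ⟨h1, fun n hn hq => h2 (diffs_mono a (Nat.lt_succ_iff.mp hn) hq)⟩
  rw [this, min_eq_right h3]

lemma gapFun_mul_totientRatio_ge {a : ℕ → ℕ}
    (hdist : ∀ m n, 1 ≤ m → 1 ≤ n → m ≠ n → a m ≠ a n) {q N : ℕ}
    (h1 : q ∈ diffs a (N + 1)) (h2 : q ∉ diffs a N) (h3 : gapBound a (N + 1) ≤ 1 / 2) :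
    4 * (Real.exp (-5) / 6) / (((diffs a (N + 1)).card : ℝ) *
      (Log (((N + 1 : ℕ) : ℝ) / 9) * Log2 (((N + 1 : ℕ) : ℝ) / 9))) ≤
        gapFun a q * totientRatio q := by
  have hq := pos_of_mem_diffs hdist h1
  have hL : Log2 (q : ℝ) ≤ Log2 (maxTerm a (N + 1) : ℝ) :=
    Log2_le_Log2 (by exact_mod_cast hq) (by exact_mod_cast le_sSup_of_mem_diffs h1)
  have h4 : Real.exp (-5) / 6 ≤ totientRatio q * Log2 (maxTerm a (N + 1) : ℝ) :=
    (le_totientRatio_mul_Log2 hq).trans (mul_le_mul_of_nonneg_left hL (totientRatio_nonneg q))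
  rw [gapFun_eq h1 h2 h3, gapBound, Dcard_eq_card_diffs, mul_assoc ((diffs a (N + 1)).card : ℝ),
    div_mul_eq_mul_div]
  refine div_le_div_of_nonneg_right (by linarith) (mul_nonneg (Nat.cast_nonneg _)
    (mul_nonneg (zero_le_one.trans (one_le_Log _)) (zero_le_one.trans (one_le_Log _))))

lemma exists_le_sum_gapFun {a : ℕ → ℕ} (hdist : ∀ m n, 1 ≤ m → 1 ≤ n → m ≠ n → a m ≠ a n)
    {N₀ : ℕ} (hN₀ : ∀ N, N₀ ≤ N → gapBound a N ≤ 1 / 2) (B : ℝ) :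
    ∃ Q : Finset ℕ, (∀ q ∈ Q, 0 < q) ∧ B ≤ ∑ q ∈ Q, gapFun a q * totientRatio q := by
  set c : ℝ := 4 * (Real.exp (-5) / 6) with hc
  have hc0 : 0 < c := by positivity
  set D : ℕ → ℝ := fun N => ((diffs a N).card : ℝ) with hD
  obtain ⟨N₁, hN, hB⟩ := exists_le_sum_Ioc (D := D)
    (fun N => by
      have h : (N : ℝ) ≤ (diffs a N).card + 1 := by
        exact_mod_cast Nat.sub_le_iff_le_add.mp (pred_le_card_diffs hdist N)
      simp only [hD]
      linarith)
    (fun N => by simp only [hD]; exact_mod_cast card_diffs_le_sq a N)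
    (fun N => by
      simp only [hD]; exact_mod_cast Finset.card_le_card (diffs_mono a (Nat.le_succ N)))
    (fun N => by simp only [hD]; exact_mod_cast card_diffs_succ_le a N) N₀ (B / c)
  refine ⟨diffs a N₁, fun q => pos_of_mem_diffs hdist, ?_⟩
  rw [div_le_iff₀' hc0] at hB
  refine hB.trans ?_
  clear hB
  induction N₁, hN using Nat.le_induction with
  | base =>
    simp only [Finset.Ioc_self, Finset.sum_empty, mul_zero]
    exact Finset.sum_nonneg fun q _ => mul_nonneg (gapFun_nonneg a q) (totientRatio_nonneg q)
  | succ N hN ih =>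
    rw [Finset.sum_Ioc_succ_top hN, mul_add, Nat.add_sub_cancel,
      ← Finset.sum_sdiff (diffs_mono a (Nat.le_succ N)), add_comm]
    refine add_le_add ?_ ih
    have h := Finset.card_nsmul_le_sum (diffs a (N + 1) \ diffs a N)
      (fun q => gapFun a q * totientRatio q) _ fun q hq =>
        gapFun_mul_totientRatio_ge hdist (Finset.mem_sdiff.mp hq).1 (Finset.mem_sdiff.mp hq).2
          (hN₀ (N + 1) (by omega))
    refine le_trans (le_of_eq ?_) h
    rw [nsmul_eq_mul, Finset.card_sdiff_of_subset (diffs_mono a (Nat.le_succ N)),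
      Nat.cast_sub (Finset.card_le_card (diffs_mono a (Nat.le_succ N)))]
    simp only [hD, hc]
    ring

lemma frequently_deltaMin_le {a : ℕ → ℕ} {α : ℝ}
    (h : (α : UnitAddCircle) ∈ addWellApproximable UnitAddCircle fun q => gapFun a q / q) :
    ∃ᶠ N in atTop, deltaMin (fun n => (a n : ℝ)) α N ≤ gapBound a N := by
  rw [UnitAddCircle.mem_addWellApproximable_iff] at h
  rw [frequently_atTop]
  intro M
  obtain ⟨q, hq, hqM⟩ := h.exists_notMem_finset (diffs a M)
  obtain ⟨m, hm, _, hlt⟩ := hq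
  have hq0 : (0 : ℝ) < q := by exact_mod_cast (Nat.zero_le m).trans_lt hm
  have hpos : 0 < gapFun a q := by
    have h1 := (norm_nonneg _).trans_lt hlt
    exact (div_pos_iff_of_pos_right hq0).mp h1
  obtain ⟨N, hN, hle⟩ := exists_of_gapFun_pos hpos
  refine ⟨N, ?_, (deltaMin_le_of_mem_diffs hN α).trans (le_trans ?_ hle)⟩
  · by_contra hNM
    exact hqM (diffs_mono a (not_le.mp hNM).le hN)
  · rw [← AddCircle.coe_sub, UnitAddCircle.norm_eq] at hlt
    set k := round (α - (m : ℝ) / q)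
    have h1 := round_le ((q : ℝ) * α) (m + k * q)
    have h2 : (q : ℝ) * α - ((m + k * q : ℤ) : ℝ) = q * (α - (m : ℝ) / q - k) := by
      push_cast
      field_simp
      ring
    rw [h2, abs_mul, abs_of_pos hq0] at h1
    rw [lt_div_iff₀ hq0, mul_comm] at hlt
    exact h1.trans hlt.le

theorem stmt14 (a : ℕ → ℕ)
    (hpos : ∀ n, 1 ≤ n → 0 < a n)
    (hdist : ∀ m n, 1 ≤ m → 1 ≤ n → m ≠ n → a m ≠ a n) :
    ∀ᵐ α ∂(volume.restrict (Set.Icc (0:ℝ) 1)),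
      ∃ᶠ N in atTop,
        deltaMin (fun n => (a n : ℝ)) α N ≤
          4 * Log2 ((sSup {x : ℕ | ∃ n : ℕ, 1 ≤ n ∧ n ≤ N ∧ x = a n} : ℕ) : ℝ) /
            ((Dcard (fun n => (a n : ℝ)) N : ℝ) * Log ((N : ℝ) / 9) *
              Log2 ((N : ℝ) / 9)) := by
  change ∀ᵐ α ∂(volume.restrict (Set.Icc (0:ℝ) 1)),
    ∃ᶠ N in atTop, deltaMin (fun n => (a n : ℝ)) α N ≤ gapBound a N
  by_cases hlarge : ∃ᶠ N in atTop, 1 / 2 ≤ gapBound a N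
  · refine ae_of_all _ fun α => ?_
    exact (hlarge.and_eventually (eventually_ge_atTop 2)).mono fun N hN =>
      (deltaMin_le_half hN.2).trans hN.1
  · rw [not_frequently, eventually_atTop] at hlarge
    obtain ⟨N₀, hN₀⟩ := hlarge
    have hae := ae_mem_addWellApproximable (gapFun_nonneg a) (gapFun_le_half a)
      (exists_le_sum_gapFun hdist fun N hN => (not_le.mp (hN₀ N hN)).le)
    rw [← Measure.restrict_congr_set (Ioc_ae_eq_Icc (a := (0 : ℝ)) (b := 1))]
    have hmp := UnitAddCircle.measurePreserving_mk 0
    rw [zero_add] at hmp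
    exact (hmp.quasiMeasurePreserving.ae hae).mono fun α hα => frequently_deltaMin_le hα
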